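/- In the fast diffusion setting below, for every q > 1 there exists a constant C > 0, depending only on n, Ω, T, p, b, c₀, q and ∫_Ω ( |∇u(x,0)|² + u(x,0)² ) dx, such that M_q(t) ≤ C for all t ∈ (T/4, T], where M_q(t) = ∫_Ω |𝓡(x,t) − 1|^q u(x,t)^{p+1} dx and 𝓡(x,t) = u(x,t)^{−p} ( −Δu(x,t) − b u(x,t) ). -/

import Mathlib

open MeasureTheory Real Set

noncomputable section

/-- Partial derivative in the `i`-th coordinate direction. -/
def pderiv' {n : ℕ} (i : Fin n) (f : EuclideanSpace ℝ (Fin n) → ℝ)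
    (x : EuclideanSpace ℝ (Fin n)) : ℝ :=
  fderiv ℝ f x (EuclideanSpace.single i 1)

/-- The Laplacian `Δf = ∑ᵢ ∂ᵢ∂ᵢ f`. -/
def lap {n : ℕ} (f : EuclideanSpace ℝ (Fin n) → ℝ) (x : EuclideanSpace ℝ (Fin n)) : ℝ :=
  ∑ i, pderiv' i (pderiv' i f) x

/-- Distance to the boundary of `Ω`. -/
def dB {n : ℕ} (Ω : Set (EuclideanSpace ℝ (Fin n))) (x : EuclideanSpace ℝ (Fin n)) : ℝ :=
  Metric.infDist x (frontier Ω)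

/-- A smooth bounded domain: a nonempty bounded open set which is the sublevel set
of a smooth defining function with nonvanishing gradient on the boundary. -/
def IsSmoothDomain {n : ℕ} (Ω : Set (EuclideanSpace ℝ (Fin n))) : Prop :=
  IsOpen Ω ∧ Bornology.IsBounded Ω ∧ Ω.Nonempty ∧
    ∃ Φ : EuclideanSpace ℝ (Fin n) → ℝ, ContDiff ℝ (⊤ : ℕ∞) Φ ∧
      Ω = {x | Φ x < 0} ∧ frontier Ω = {x | Φ x = 0} ∧
      ∀ x ∈ frontier Ω, gradient Φ x ≠ 0

/-- A function on `Ω × [0,T]` extends continuously to `closure Ω × [0,T]`. -/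
def ExtendsCont {n : ℕ} (Ω : Set (EuclideanSpace ℝ (Fin n))) (T : ℝ)
    (f : EuclideanSpace ℝ (Fin n) → ℝ → ℝ) : Prop :=
  ∃ g : EuclideanSpace ℝ (Fin n) → ℝ → ℝ,
    ContinuousOn (fun z : EuclideanSpace ℝ (Fin n) × ℝ => g z.1 z.2)
      (closure Ω ×ˢ Set.Icc 0 T) ∧
    ∀ x ∈ Ω, ∀ t ∈ Set.Icc 0 T, g x t = f x t

/-- Membership in `C^{3,2}(closure Ω × [0,T])`, with the first and second time
derivatives recorded as the functions `ut` and `utt`:  `u`, `D_x u`, `D_x² u`,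
`D_x³ u`, `∂ₜ u`, `D_x ∂ₜ u`, `D_x² ∂ₜ u`, `∂ₜ² u` all extend continuously to
`closure Ω × [0,T]`. -/
def C32 {n : ℕ} (Ω : Set (EuclideanSpace ℝ (Fin n))) (T : ℝ)
    (u ut utt : EuclideanSpace ℝ (Fin n) → ℝ → ℝ) : Prop :=
  (∀ t ∈ Set.Icc (0 : ℝ) T, ContDiffOn ℝ 3 (fun x => u x t) Ω) ∧
  (∀ t ∈ Set.Icc (0 : ℝ) T, ContDiffOn ℝ 2 (fun x => ut x t) Ω) ∧
  (∀ x ∈ Ω, ∀ t ∈ Set.Icc (0 : ℝ) T, HasDerivWithinAt (u x) (ut x t) (Set.Icc 0 T) t) ∧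
  (∀ x ∈ Ω, ∀ t ∈ Set.Icc (0 : ℝ) T, HasDerivWithinAt (ut x) (utt x t) (Set.Icc 0 T) t) ∧
  ContinuousOn (fun z : EuclideanSpace ℝ (Fin n) × ℝ => u z.1 z.2)
    (closure Ω ×ˢ Set.Icc 0 T) ∧
  ContinuousOn (fun z : EuclideanSpace ℝ (Fin n) × ℝ => ut z.1 z.2)
    (closure Ω ×ˢ Set.Icc 0 T) ∧
  ContinuousOn (fun z : EuclideanSpace ℝ (Fin n) × ℝ => utt z.1 z.2)
    (closure Ω ×ˢ Set.Icc 0 T) ∧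
  (∀ i : Fin n, ExtendsCont Ω T fun x t => pderiv' i (fun y => u y t) x) ∧
  (∀ i j : Fin n, ExtendsCont Ω T fun x t => pderiv' i (pderiv' j fun y => u y t) x) ∧
  (∀ i j k : Fin n,
    ExtendsCont Ω T fun x t => pderiv' i (pderiv' j (pderiv' k fun y => u y t)) x) ∧
  (∀ i : Fin n, ExtendsCont Ω T fun x t => pderiv' i (fun y => ut y t) x) ∧
  (∀ i j : Fin n, ExtendsCont Ω T fun x t => pderiv' i (pderiv' j fun y => ut y t) x)

/-- The fast diffusion setting of Section 4 of the paper: `u ∈ C^{3,2}(closure Ω × [0,T])`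
is positive in `Ω × [0,T]`, solves `∂ₜ(u^p) = Δu + bu + u^p` in `Ω × (0,T]`, vanishes
on `∂Ω × [0,T]`, and is comparable to the distance to the boundary. -/
def FDSetting {n : ℕ} (Ω : Set (EuclideanSpace ℝ (Fin n))) (p b T c₀ : ℝ)
    (u ut utt : EuclideanSpace ℝ (Fin n) → ℝ → ℝ) : Prop :=
  IsSmoothDomain Ω ∧ 1 < p ∧ (n ≤ 2 ∨ p ≤ ((n : ℝ) + 2) / ((n : ℝ) - 2)) ∧
  0 < T ∧ 1 ≤ c₀ ∧
  C32 Ω T u ut utt ∧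
  (∀ x ∈ Ω, ∀ t ∈ Set.Icc (0 : ℝ) T, 0 < u x t) ∧
  (∀ x ∈ Ω, ∀ t ∈ Set.Ioc (0 : ℝ) T,
      HasDerivWithinAt (fun s => u x s ^ p)
        (lap (fun y => u y t) x + b * u x t + u x t ^ p) (Set.Icc 0 T) t) ∧
  (∀ x ∈ frontier Ω, ∀ t ∈ Set.Icc (0 : ℝ) T, u x t = 0) ∧
  (∀ x ∈ Ω, ∀ t ∈ Set.Icc (0 : ℝ) T,
      c₀⁻¹ * dB Ω x ≤ u x t ∧ u x t ≤ c₀ * dB Ω x)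

/-- The curvature-like quantity `𝓡 = u^{-p} (-Δu - bu)`. -/
def curvQ {n : ℕ} (p b : ℝ) (u : EuclideanSpace ℝ (Fin n) → ℝ → ℝ)
    (x : EuclideanSpace ℝ (Fin n)) (t : ℝ) : ℝ :=
  u x t ^ (-p) * (-(lap (fun y => u y t) x) - b * u x t)

open Filter Topology

section Cutoffs

variable {n : ℕ}

local notation "V" => EuclideanSpace ℝ (Fin n)

lemma pderiv'_mul (i : Fin n) {f g : V → ℝ} {x : V} (hf : DifferentiableAt ℝ f x)
    (hg : DifferentiableAt ℝ g x) :
    pderiv' i (fun y => f y * g y) x = f x * pderiv' i g x + g x * pderiv' i f x := by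
  simp only [pderiv']
  rw [fderiv_fun_mul hf hg]
  simp

lemma pderiv'_sub (i : Fin n) {f g : V → ℝ} {x : V} (hf : DifferentiableAt ℝ f x)
    (hg : DifferentiableAt ℝ g x) :
    pderiv' i (fun y => f y - g y) x = pderiv' i f x - pderiv' i g x := by
  simp only [pderiv']
  rw [fderiv_fun_sub hf hg]
  simp

lemma pderiv'_comp (i : Fin n) {f : V → ℝ} {g : ℝ → ℝ} {g' : ℝ} {x : V}
    (hg : HasDerivAt g g' (f x)) (hf : DifferentiableAt ℝ f x) :
    pderiv' i (fun y => g (f y)) x = g' * pderiv' i f x := by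
  simp only [pderiv']
  have := (hg.comp_hasFDerivAt x hf.hasFDerivAt).fderiv
  rw [show (fun y => g (f y)) = g ∘ f from rfl, this]
  simp

lemma pderiv'_congr (i : Fin n) {f g : V → ℝ} {x : V} (h : f =ᶠ[𝓝 x] g) :
    pderiv' i f x = pderiv' i g x := by
  simp only [pderiv', h.fderiv_eq]

lemma pderiv'_const (i : Fin n) (c : ℝ) (x : V) : pderiv' i (fun _ => c) x = 0 := by
  simp [pderiv']

lemma pderiv'_eq_zero_of_eventually (i : Fin n) {f : V → ℝ} {x : V} {c : ℝ}
    (h : ∀ᶠ y in 𝓝 x, f y = c) : pderiv' i f x = 0 := by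
  rw [pderiv'_congr i (g := fun _ => c) h, pderiv'_const]

lemma fderiv_norm_sq_eq (f : V → ℝ) (x : V) :
    ‖fderiv ℝ f x‖ ^ 2 = ∑ i, pderiv' i f x ^ 2 := by
  have h1 : ‖gradient f x‖ = ‖fderiv ℝ f x‖ := by
    simp [gradient]
  rw [← h1, EuclideanSpace.norm_sq_eq]
  refine Finset.sum_congr rfl fun i _ => ?_
  have : pderiv' i f x = inner ℝ (gradient f x) (EuclideanSpace.single i 1) := by
    simp [gradient, pderiv']
  rw [this, EuclideanSpace.inner_single_right]
  simp

lemma gradient_norm_sq_eq (f : V → ℝ) (x : V) :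
    ‖gradient f x‖ ^ 2 = ∑ i, pderiv' i f x ^ 2 := by
  rw [← fderiv_norm_sq_eq]
  simp [gradient]

lemma norm_fderiv_le_sum (f : V → ℝ) (x : V) : ‖fderiv ℝ f x‖ ≤ ∑ i, |pderiv' i f x| := by
  apply le_of_sq_le_sq _ (Finset.sum_nonneg fun i _ => abs_nonneg _)
  rw [fderiv_norm_sq_eq]
  simp_rw [← sq_abs (pderiv' _ f x)]
  exact Finset.sum_sq_le_sq_sum_of_nonneg fun i _ => abs_nonneg _

lemma contDiff_pderiv' {f : V → ℝ} (hf : ContDiff ℝ (⊤ : ℕ∞) f) (i : Fin n) :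
    ContDiff ℝ (⊤ : ℕ∞) (pderiv' i f) := by
  unfold pderiv'
  exact (hf.fderiv_right (m := (⊤ : ℕ∞)) (by simp)).clm_apply contDiff_const

lemma ContDiffOn.pderiv'_of_isOpen {Ω : Set V} (hΩ : IsOpen Ω) {f : V → ℝ} {m k : WithTop ℕ∞}
    (hf : ContDiffOn ℝ k f Ω) (hmk : m + 1 ≤ k) (i : Fin n) :
    ContDiffOn ℝ m (pderiv' i f) Ω := by
  unfold pderiv'
  exact (hf.fderiv_of_isOpen hΩ hmk).clm_apply contDiffOn_const

/-- A bump that is `1` where `r ≥ 2 ε` and `0` where `r ≤ ε`. -/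
def cutoffLevel (r : V → ℝ) (ε : ℝ) (x : V) : ℝ := Real.smoothTransition (r x / ε - 1)

lemma bounded_deriv_smoothTransition :
    ∃ C, 0 ≤ C ∧ ∀ s, |deriv Real.smoothTransition s| ≤ C := by
  have hc : Continuous (deriv Real.smoothTransition) :=
    (Real.smoothTransition.contDiff (n := 1)).continuous_deriv le_rfl
  obtain ⟨C, hC⟩ := (isCompact_Icc (a := (-1 : ℝ)) (b := 2)).exists_bound_of_continuousOn
    hc.continuousOn
  refine ⟨max C 0, le_max_right _ _, fun s => ?_⟩
  by_cases h : s ∈ Icc (-1 : ℝ) 2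
  · exact (hC s h).trans (le_max_left _ _)
  · have : deriv Real.smoothTransition s = 0 := by
      rw [mem_Icc, not_and_or, not_le, not_le] at h
      rcases h with h | h
      · have : Real.smoothTransition =ᶠ[𝓝 s] fun _ => 0 := by
          filter_upwards [Iio_mem_nhds h] with y hy
          exact Real.smoothTransition.zero_of_nonpos (by simp only [mem_Iio] at hy; linarith)
        rw [this.deriv_eq]; simp
      · have : Real.smoothTransition =ᶠ[𝓝 s] fun _ => 1 := by
          filter_upwards [Ioi_mem_nhds h] with y hy
          exact Real.smoothTransition.one_of_one_le (by simp only [mem_Ioi] at hy; linarith)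
        rw [this.deriv_eq]; simp
    rw [this]; simp

lemma exists_bound_of_bounded {Ω : Set V} (hb : Bornology.IsBounded Ω) {f : V → ℝ}
    (hf : Continuous f) : ∃ C, 0 < C ∧ ∀ x ∈ closure Ω, |f x| ≤ C := by
  obtain ⟨C, hC⟩ := hb.isCompact_closure.exists_bound_of_continuousOn hf.continuousOn
  exact ⟨max C 1, by positivity, fun x hx => (hC x hx).trans (le_max_left _ _)⟩

/-- Existence of smooth cutoff functions adapted to the domain `{r > 0}`. -/
lemma exists_cutoffs {Ω : Set V} (hb : Bornology.IsBounded Ω) {r : V → ℝ}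
    (hr : ContDiff ℝ (⊤ : ℕ∞) r) (hΩ : ∀ x, x ∈ Ω ↔ 0 < r x) :
    ∃ (η : ℕ → V → ℝ) (C : ℝ), 0 ≤ C ∧ (∀ k, ContDiff ℝ (⊤ : ℕ∞) (η k)) ∧
      (∀ k x, 0 ≤ η k x ∧ η k x ≤ 1) ∧ (∀ k, HasCompactSupport (η k)) ∧
      (∀ k, tsupport (η k) ⊆ Ω) ∧ (∀ k, ∀ x ∈ Ω, ∀ i, |r x * pderiv' i (η k) x| ≤ C) ∧
      ∀ x ∈ Ω, ∀ᶠ k in atTop, η k x = 1 ∧ ∀ i, pderiv' i (η k) x = 0 := by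
  obtain ⟨C1, hC1, hC1'⟩ := bounded_deriv_smoothTransition
  have h2 : ∃ C2, 0 ≤ C2 ∧ ∀ i, ∀ x ∈ closure Ω, |pderiv' i r x| ≤ C2 := by
    have : ∀ i : Fin n, ∃ C, 0 < C ∧ ∀ x ∈ closure Ω, |pderiv' i r x| ≤ C := fun i =>
      exists_bound_of_bounded hb (contDiff_pderiv' hr i).continuous
    choose C hC hC' using this
    exact ⟨∑ i, C i, Finset.sum_nonneg fun i _ => (hC i).le, fun i x hx => (hC' i x hx).trans
      (Finset.single_le_sum (fun i _ => (hC i).le) (Finset.mem_univ i))⟩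
  obtain ⟨C2, hC2, hC2'⟩ := h2
  have hpos : ∀ k : ℕ, (0 : ℝ) < 1 / (k + 1) := fun k => Nat.one_div_pos_of_nat
  have hts : ∀ k : ℕ, tsupport (cutoffLevel r (1 / (k + 1))) ⊆ {x | 1 / ((k : ℝ) + 1) ≤ r x} := by
    intro k
    apply closure_minimal _ (isClosed_le continuous_const hr.continuous)
    intro x hx
    by_contra hlt
    simp only [mem_ofPred_eq, not_le] at hlt
    apply hx
    unfold cutoffLevel
    apply Real.smoothTransition.zero_of_nonpos
    have := (div_lt_one (hpos k)).2 hlt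
    linarith
  have hts' : ∀ k : ℕ, tsupport (cutoffLevel r (1 / (k + 1))) ⊆ Ω := fun k x hx =>
    (hΩ x).2 ((hpos k).trans_le (hts k hx))
  have hdiff : ∀ (ε : ℝ) (x : V) (i : Fin n), pderiv' i (cutoffLevel r ε) x =
      deriv Real.smoothTransition (r x / ε - 1) * (pderiv' i r x / ε) := by
    intro ε x i
    have hd : DifferentiableAt ℝ r x := (hr.differentiable (by simp)).differentiableAt
    have h1 : HasDerivAt (fun s : ℝ => Real.smoothTransition (s / ε - 1))
        (deriv Real.smoothTransition (r x / ε - 1) * (1 / ε)) (r x) := by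
      have ha : HasDerivAt Real.smoothTransition
          (deriv Real.smoothTransition (r x / ε - 1)) (r x / ε - 1) :=
        ((Real.smoothTransition.contDiff (n := 1)).differentiable
          (by simp)).differentiableAt.hasDerivAt
      exact ha.comp (r x) (((hasDerivAt_id (r x)).div_const ε).sub_const 1)
    have := pderiv'_comp i h1 hd
    unfold cutoffLevel
    rw [this]; ring
  refine ⟨fun k => cutoffLevel r (1 / (k + 1)), 2 * (C1 * C2), by positivity, ?_, ?_, ?_,
    hts', ?_, ?_⟩
  · intro k
    exact Real.smoothTransition.contDiff.comp ((hr.div_const _).sub contDiff_const)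
  · exact fun k x => ⟨Real.smoothTransition.nonneg _, Real.smoothTransition.le_one _⟩
  · intro k
    exact HasCompactSupport.of_support_subset_isCompact hb.isCompact_closure
      ((subset_tsupport _).trans ((hts' k).trans subset_closure))
  · intro k x hx i
    by_cases hlt : 2 * (1 / ((k : ℝ) + 1)) < r x
    · have h0 : pderiv' i (cutoffLevel r (1 / ((k : ℝ) + 1))) x = 0 := by
        apply pderiv'_eq_zero_of_eventually i (c := 1)
        filter_upwards [hr.continuous.continuousAt.eventually (Ioi_mem_nhds hlt)] with y hy
        apply Real.smoothTransition.one_of_one_le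
        have := (le_div_iff₀ (hpos k)).2 (le_of_lt hy)
        linarith
      simp only [h0]; simp; positivity
    · simp only
      rw [hdiff]
      have hrx := (hΩ x).1 hx
      have e1 : |r x * (deriv Real.smoothTransition (r x / (1 / ((k : ℝ) + 1)) - 1) *
          (pderiv' i r x / (1 / ((k : ℝ) + 1))))| = (r x / (1 / ((k : ℝ) + 1))) *
          (|deriv Real.smoothTransition (r x / (1 / ((k : ℝ) + 1)) - 1)| * |pderiv' i r x|) := by
        rw [abs_mul, abs_mul, abs_div, abs_of_pos hrx, abs_of_pos (hpos k)]; ring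
      rw [e1]
      have : r x / (1 / ((k : ℝ) + 1)) ≤ 2 := by
        rw [div_le_iff₀ (hpos k)]; exact not_lt.1 hlt
      exact mul_le_mul this (mul_le_mul (hC1' _) (hC2' i x (subset_closure hx))
        (abs_nonneg _) hC1) (by positivity) (by norm_num)
  · intro x hx
    have hrx := (hΩ x).1 hx
    have ht : Tendsto (fun k : ℕ => 2 * (1 / ((k : ℝ) + 1))) atTop (𝓝 0) := by
      simpa using (tendsto_one_div_add_atTop_nhds_zero_nat (𝕜 := ℝ)).const_mul 2
    filter_upwards [ht.eventually (Iio_mem_nhds hrx)] with k hk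
    have : ∀ᶠ y in 𝓝 x, cutoffLevel r (1 / ((k : ℝ) + 1)) y = 1 := by
      filter_upwards [hr.continuous.continuousAt.eventually (Ioi_mem_nhds hk)] with y hy
      apply Real.smoothTransition.one_of_one_le
      have := (le_div_iff₀ (hpos k)).2 (le_of_lt hy)
      linarith
    exact ⟨this.self_of_nhds, fun i => pderiv'_eq_zero_of_eventually i this⟩

lemma continuous_mul_of_tsupport_subset {Ω : Set V} (hΩ : IsOpen Ω) {η g : V → ℝ}
    (hη : Continuous η) (hs : tsupport η ⊆ Ω) (hg : ContinuousOn g Ω) :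
    Continuous fun x => η x * g x := by
  refine continuous_of_tsupport fun x hx => ?_
  have hx' : x ∈ Ω := hs (tsupport_mul_subset_left hx)
  exact hη.continuousAt.mul (hg.continuousAt (hΩ.mem_nhds hx'))

lemma integrable_mul_of_tsupport_subset {Ω : Set V} (hΩ : IsOpen Ω) {η g : V → ℝ}
    (hη : Continuous η) (hs : tsupport η ⊆ Ω) (hc : HasCompactSupport η)
    (hg : ContinuousOn g Ω) : Integrable (fun x => η x * g x) volume :=
  (continuous_mul_of_tsupport_subset hΩ hη hs hg).integrable_of_hasCompactSupport hc.mul_right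

lemma tsupport_pderiv'_subset (i : Fin n) (f : V → ℝ) : tsupport (pderiv' i f) ⊆ tsupport f := by
  apply closure_minimal _ (isClosed_tsupport f)
  intro x hx
  apply support_fderiv_subset ℝ (f := f)
  intro h0
  apply hx
  simp [pderiv', h0]

/-- Divergence theorem for a vector field on `{r > 0}` that vanishes at least linearly on the
boundary. -/
theorem integral_div_eq_zero {Ω : Set V} (hb : Bornology.IsBounded Ω) {r : V → ℝ}
    (hr : ContDiff ℝ (⊤ : ℕ∞) r) (hΩ : ∀ x, x ∈ Ω ↔ 0 < r x) {X : Fin n → V → ℝ}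
    (hX : ∀ i, ContDiffOn ℝ 1 (X i) Ω) {C : ℝ} (hC : ∀ i, ∀ x ∈ Ω, |X i x| ≤ C * r x)
    (hint : IntegrableOn (fun x => ∑ i, pderiv' i (X i) x) Ω) :
    ∫ x in Ω, ∑ i, pderiv' i (X i) x = 0 := by
  have hΩo : IsOpen Ω := by
    have : Ω = {x | 0 < r x} := by ext x; exact hΩ x
    rw [this]; exact isOpen_lt continuous_const hr.continuous
  obtain ⟨η, D, hD, hηs, hη01, hηc, hηt, hηd, hη1⟩ := exists_cutoffs hb hr hΩ
  have hXd : ∀ i, ContinuousOn (pderiv' i (X i)) Ω := fun i =>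
    ((hX i).pderiv'_of_isOpen hΩo (m := 0) (by simp) i).continuousOn
  have hηd' : ∀ k i, Continuous (pderiv' i (η k)) := fun k i =>
    (contDiff_pderiv' (hηs k) i).continuous
  have hpt : ∀ k i, tsupport (pderiv' i (η k)) ⊆ Ω := fun k i =>
    (tsupport_pderiv'_subset i _).trans (hηt k)
  have hpc : ∀ k i, HasCompactSupport (pderiv' i (η k)) := fun k i =>
    (hηc k).mono' ((subset_tsupport _).trans (tsupport_pderiv'_subset i _))
  have key : ∀ k, ∫ x in Ω, η k x * ∑ i, pderiv' i (X i) x =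
      - ∫ x in Ω, ∑ i, pderiv' i (η k) x * X i x := by
    intro k
    have i1 : ∀ i, Integrable (fun x => η k x * pderiv' i (X i) x) volume := fun i =>
      integrable_mul_of_tsupport_subset hΩo (hηs k).continuous (hηt k) (hηc k) (hXd i)
    have i2 : ∀ i, Integrable (fun x => pderiv' i (η k) x * X i x) volume := fun i =>
      integrable_mul_of_tsupport_subset hΩo (hηd' k i) (hpt k i) (hpc k i) (hX i).continuousOn
    have i3 : ∀ i, Integrable (fun x => η k x * X i x) volume := fun i =>
      integrable_mul_of_tsupport_subset hΩo (hηs k).continuous (hηt k) (hηc k) (hX i).continuousOn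
    have e1 : ∀ i, ∫ x, η k x * pderiv' i (X i) x = - ∫ x, pderiv' i (η k) x * X i x := fun i =>
      integral_mul_fderiv_eq_neg_fderiv_mul_of_integrable (i2 i) (i1 i) (i3 i)
        (fun x _ => ((hηs k).differentiable (by simp)).differentiableAt)
        (fun x hx => ((hX i).differentiableOn (by simp)).differentiableAt
          (hΩo.mem_nhds (hηt k hx)))
    rw [setIntegral_eq_integral_of_forall_compl_eq_zero,
      setIntegral_eq_integral_of_forall_compl_eq_zero]
    · simp_rw [Finset.mul_sum]
      rw [integral_finsetSum _ fun i _ => i1 i, integral_finsetSum _ fun i _ => i2 i,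
        ← Finset.sum_neg_distrib]
      exact Finset.sum_congr rfl fun i _ => e1 i
    · intro x hx
      refine Finset.sum_eq_zero fun i _ => ?_
      rw [image_eq_zero_of_notMem_tsupport fun h => hx (hpt k i h), zero_mul]
    · intro x hx
      rw [image_eq_zero_of_notMem_tsupport fun h => hx (hηt k h), zero_mul]
  have l1 : Tendsto (fun k => ∫ x in Ω, η k x * ∑ i, pderiv' i (X i) x) atTop
      (𝓝 (∫ x in Ω, ∑ i, pderiv' i (X i) x)) := by
    apply tendsto_integral_of_dominated_convergence (fun x => ‖∑ i, pderiv' i (X i) x‖)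
    · exact fun k => (hηs k).continuous.aestronglyMeasurable.mul hint.aestronglyMeasurable
    · exact hint.norm
    · intro k
      refine Eventually.of_forall fun x => ?_
      rw [norm_mul, Real.norm_of_nonneg (hη01 k x).1]
      exact mul_le_of_le_one_left (norm_nonneg _) (hη01 k x).2
    · refine (ae_restrict_iff' hΩo.measurableSet).2 (Eventually.of_forall fun x hx => ?_)
      refine tendsto_const_nhds.congr' ?_
      filter_upwards [hη1 x hx] with k hk
      rw [hk.1, one_mul]
  have l2 : Tendsto (fun k => ∫ x in Ω, ∑ i, pderiv' i (η k) x * X i x) atTop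
      (𝓝 (∫ x in Ω, (0 : ℝ))) := by
    apply tendsto_integral_of_dominated_convergence (fun _ => ∑ _i : Fin n, D * C)
    · intro k
      refine ContinuousOn.aestronglyMeasurable ?_ hΩo.measurableSet
      exact continuousOn_finsetSum _ fun i _ => (hηd' k i).continuousOn.mul (hX i).continuousOn
    · exact integrableOn_const hb.measure_lt_top.ne
    · intro k
      refine (ae_restrict_iff' hΩo.measurableSet).2 (Eventually.of_forall fun x hx => ?_)
      refine (norm_sum_le _ _).trans (Finset.sum_le_sum fun i _ => ?_)
      have hrx := (hΩ x).1 hx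
      have h1 := hηd k x hx i
      have h2 := hC i x hx
      rw [abs_mul, abs_of_pos hrx] at h1
      rw [norm_mul, Real.norm_eq_abs, Real.norm_eq_abs]
      have hC0 : 0 ≤ C := by
        by_contra hneg
        have : C * r x < 0 := mul_neg_of_neg_of_pos (not_le.1 hneg) hrx
        linarith [abs_nonneg (X i x)]
      calc |pderiv' i (η k) x| * |X i x| ≤ |pderiv' i (η k) x| * (C * r x) := by gcongr
        _ = (r x * |pderiv' i (η k) x|) * C := by ring
        _ ≤ D * C := by gcongr
    · refine (ae_restrict_iff' hΩo.measurableSet).2 (Eventually.of_forall fun x hx => ?_)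
      refine tendsto_const_nhds.congr' ?_
      filter_upwards [hη1 x hx] with k hk
      exact (Finset.sum_eq_zero fun i _ => by rw [hk.2 i, zero_mul]).symm
  have l3 := l2.neg
  simp_rw [← key] at l3
  simpa using tendsto_nhds_unique l1 l3

end Cutoffs

section DefiningFunction

variable {n : ℕ}

local notation "V" => EuclideanSpace ℝ (Fin n)

lemma IsCompact.exists_pos_le_of_pos_on_zeros {K : Set V} (hK : IsCompact K) {r H : V → ℝ}
    (hr : Continuous r) (hH : Continuous H) (h0 : ∀ x ∈ K, 0 ≤ r x)
    (h : ∀ x ∈ K, r x = 0 → 0 < H x) : ∃ c > 0, ∀ x ∈ K, r x < c → c ≤ H x := by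
  rcases K.eq_empty_or_nonempty with rfl | hne
  · exact ⟨1, one_pos, by simp⟩
  obtain ⟨x0, hx0, hmin⟩ := hK.exists_isMinOn hne (hr.max hH).continuousOn
  refine ⟨max (r x0) (H x0), ?_, fun x hx hlt => ?_⟩
  · rcases (h0 x0 hx0).eq_or_lt with he | hl
    · exact lt_max_of_lt_right (h x0 hx0 he.symm)
    · exact lt_max_of_lt_left hl
  · have : max (r x0) (H x0) ≤ max (r x) (H x) := hmin hx
    rcases le_max_iff.1 this with h1 | h1
    · linarith
    · exact h1

lemma dB_le_infDist_compl {Ω : Set V} (hΩ : Ω ≠ univ) {x : V} (hx : x ∈ Ω) :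
    dB Ω x ≤ Metric.infDist x Ωᶜ := by
  obtain ⟨y, hy, he⟩ := exists_mem_frontier_infDist_compl_eq_dist hx hΩ
  rw [he]
  exact Metric.infDist_le_dist_of_mem hy

lemma ne_univ_of_isBounded (hn : 1 ≤ n) {Ω : Set V} (hb : Bornology.IsBounded Ω) :
    Ω ≠ univ := by
  rintro rfl
  have : NeZero n := ⟨by omega⟩
  have : Nontrivial V := inferInstance
  exact NormedSpace.unbounded_univ ℝ V hb

/-- A smooth bounded domain has a smooth defining function comparable to the distance to the
boundary. -/
theorem IsSmoothDomain.exists_defining (hn : 1 ≤ n) {Ω : Set V} (h : IsSmoothDomain Ω) :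
    ∃ r : V → ℝ, ContDiff ℝ (⊤ : ℕ∞) r ∧ (∀ x, x ∈ Ω ↔ 0 < r x) ∧
      (∃ c > 0, ∀ x ∈ Ω, c * dB Ω x ≤ r x ∧ c * r x ≤ dB Ω x) ∧
      ∃ c > 0, ∀ x ∈ Ω, r x < c → c ≤ (∑ i, pderiv' i r x ^ 2) / 2 + r x * lap r x := by
  obtain ⟨hΩo, hb, hne, Φ, hΦ, hΩ, hfr, hgrad⟩ := h
  have huniv := ne_univ_of_isBounded hn hb
  have hfne : (frontier Ω).Nonempty := by
    obtain ⟨x, hx⟩ := hne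
    obtain ⟨y, hy, -⟩ := exists_mem_frontier_infDist_compl_eq_dist hx huniv
    exact ⟨y, hy⟩
  set r : V → ℝ := fun x => - Φ x with hrdef
  have hr : ContDiff ℝ (⊤ : ℕ∞) r := hΦ.neg
  have hΩr : ∀ x, x ∈ Ω ↔ 0 < r x := fun x => by
    rw [hΩ]; simp [hrdef]
  have hr0 : ∀ x ∈ frontier Ω, r x = 0 := fun x hx => by
    rw [hfr] at hx
    have hx' : Φ x = 0 := hx
    simp [hrdef, hx']
  have hrcl : ∀ x ∈ closure Ω, 0 ≤ r x := fun x hx => by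
    rw [closure_eq_self_union_frontier] at hx
    rcases hx with hx | hx
    · exact ((hΩr x).1 hx).le
    · exact (hr0 x hx).ge
  have hKfr : ∀ x ∈ closure Ω, r x = 0 → x ∈ frontier Ω := fun x hx h0 => by
    rw [hfr]
    have : Φ x = 0 := by simpa [hrdef] using h0
    exact this
  have hgrad' : ∀ x ∈ closure Ω, r x = 0 → 0 < ∑ i, pderiv' i r x ^ 2 := fun x hx h0 => by
    have h1 := hgrad x (hKfr x hx h0)
    rw [← fderiv_norm_sq_eq]
    have h2 : fderiv ℝ r x ≠ 0 := by
      intro h3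
      apply h1
      have h4 : fderiv ℝ Φ x = 0 := by
        have : fderiv ℝ r x = - fderiv ℝ Φ x := by
          rw [hrdef]; exact fderiv_fun_neg
        rw [this] at h3
        simpa using h3
      simp [gradient, h4]
    have := norm_pos_iff.2 h2
    positivity
  have hK := hb.isCompact_closure
  have hcg : Continuous fun x => ∑ i, pderiv' i r x ^ 2 :=
    continuous_finsetSum _ fun i _ => (contDiff_pderiv' hr i).continuous.pow 2
  have hclap : Continuous (lap r) := by
    unfold lap
    exact continuous_finsetSum _ fun i _ =>
      (contDiff_pderiv' (contDiff_pderiv' hr i) i).continuous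
  refine ⟨r, hr, hΩr, ?_, ?_⟩
  · -- comparison with the distance
    have hupper : ∃ L > 0, ∀ x ∈ Ω, r x ≤ L * dB Ω x := by
      obtain ⟨R, hR⟩ := hb.closure.subset_closedBall (0 : V)
      obtain ⟨L, hL0, hL⟩ := exists_bound_of_bounded
        (Metric.isBounded_closedBall (x := (0 : V)) (r := R))
        (hr.continuous_fderiv (by simp)).norm
      refine ⟨L, hL0, fun x hx => ?_⟩
      obtain ⟨y, hy, he⟩ := isClosed_frontier.exists_infDist_eq_dist hfne x
      have := (convex_closedBall (0 : V) R).norm_image_sub_le_of_norm_fderiv_le (𝕜 := ℝ)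
        (f := r) (C := L) (fun z _ => (hr.differentiable (by simp)).differentiableAt)
        (fun z hz => by simpa using hL z (subset_closure hz)) (hR (frontier_subset_closure hy))
        (hR (subset_closure hx))
      rw [hr0 y hy, sub_zero] at this
      unfold dB
      rw [he, dist_eq_norm]
      exact (le_abs_self _).trans this
    have hlower : ∃ L > 0, ∀ x ∈ Ω, dB Ω x ≤ L * r x := by
      obtain ⟨c, hc, hcr⟩ := hK.exists_pos_le_of_pos_on_zeros hr.continuous hcg hrcl hgrad'
      obtain ⟨D, hD0, hD⟩ := exists_bound_of_bounded hb (f := dB Ω)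
        (Metric.continuous_infDist_pt _)
      set a := √c / 2 with ha
      have ha0 : 0 < a := by positivity
      have hunif := hK.uniformContinuousAt_of_continuousAt (fderiv ℝ r)
        (fun x _ => (hr.continuous_fderiv (by simp)).continuousAt)
        (Metric.dist_mem_uniformity ha0)
      obtain ⟨δ, hδ, hδ'⟩ := Metric.mem_uniformity_dist.1 hunif
      set m := min c (a * δ / 2) with hm
      have hm0 : 0 < m := by positivity
      refine ⟨max (1 / a) (D / m), by positivity, fun x hx => ?_⟩
      have hrx := (hΩr x).1 hx
      by_cases hlt : r x < m
      · refine le_trans ?_ (mul_le_mul_of_nonneg_right (le_max_left _ _) hrx.le)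
        have h1 : √c ≤ ‖fderiv ℝ r x‖ := by
          rw [Real.sqrt_le_left (norm_nonneg _), fderiv_norm_sq_eq]
          exact hcr x (subset_closure hx) (hlt.trans_le (min_le_left _ _))
        set g := gradient r x with hg
        have hgn : ‖g‖ = ‖fderiv ℝ r x‖ := by simp [hg, gradient]
        have hg0 : 0 < ‖g‖ := by rw [hgn]; exact (by positivity : 0 < √c).trans_le h1
        set s := r x / a with hs
        have hs0 : 0 < s := by positivity
        have hsδ : s < δ := by
          rw [hs, div_lt_iff₀ ha0]
          have := hlt.trans_le (min_le_right _ _)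
          have : 0 < a * δ := by positivity
          linarith
        set y := x - (s / ‖g‖) • g with hy
        have hxy : dist x y = s := by
          rw [dist_eq_norm, hy, sub_sub_cancel, norm_smul, Real.norm_of_nonneg (by positivity)]
          field_simp
        have hmv := (convex_ball x δ).norm_image_sub_le_of_norm_fderiv_le' (𝕜 := ℝ)
          (f := r) (C := a) (φ := fderiv ℝ r x)
          (fun z _ => (hr.differentiable (by simp)).differentiableAt)
          (fun z hz => by
            have := hδ' (a := x) (b := z) (by rw [dist_comm]; exact hz) (subset_closure hx)
            rw [← dist_eq_norm, dist_comm]; exact le_of_lt this)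
          (Metric.mem_ball_self hδ) (y := y) (by rw [Metric.mem_ball, dist_comm, hxy]; exact hsδ)
        have hval : fderiv ℝ r x (y - x) = - s * ‖g‖ := by
          have e1 : ∀ w, fderiv ℝ r x w = inner ℝ g w := fun w => by simp [hg, gradient]
          rw [e1, hy, sub_sub_cancel_left, inner_neg_right, inner_smul_right,
            real_inner_self_eq_norm_sq]
          field_simp
        rw [hval, ← dist_eq_norm y x, dist_comm, hxy, Real.norm_eq_abs] at hmv
        have h2 := (abs_le.1 hmv).2
        have hrs : a * s = r x := by rw [hs]; field_simp
        have h3 : 2 * a ≤ ‖g‖ := by rw [hgn, ha]; linarith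
        have hry : r y ≤ 0 := by nlinarith
        have hyΩ : y ∈ Ωᶜ := fun hy' => absurd ((hΩr y).1 hy') (not_lt.2 hry)
        calc dB Ω x ≤ Metric.infDist x Ωᶜ := dB_le_infDist_compl huniv hx
          _ ≤ dist x y := Metric.infDist_le_dist_of_mem hyΩ
          _ = 1 / a * r x := by rw [hxy, hs]; ring
      · refine le_trans ?_ (mul_le_mul_of_nonneg_right (le_max_right _ _) hrx.le)
        have h1 := hD x (subset_closure hx)
        rw [div_mul_eq_mul_div, le_div_iff₀ hm0]
        have h2 : dB Ω x ≤ D := (le_abs_self _).trans h1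
        push Not at hlt
        have h3 : 0 ≤ dB Ω x := Metric.infDist_nonneg
        nlinarith
    obtain ⟨L1, hL1, h1⟩ := hupper
    obtain ⟨L2, hL2, h2⟩ := hlower
    refine ⟨min (1 / L1) (1 / L2), by positivity, fun x hx => ⟨?_, ?_⟩⟩
    · calc min (1 / L1) (1 / L2) * dB Ω x ≤ 1 / L2 * dB Ω x :=
            mul_le_mul_of_nonneg_right (min_le_right _ _) Metric.infDist_nonneg
        _ ≤ 1 / L2 * (L2 * r x) := by gcongr; exact h2 x hx
        _ = r x := by field_simp
    · have := (hΩr x).1 hx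
      calc min (1 / L1) (1 / L2) * r x ≤ 1 / L1 * r x := by gcongr; exact min_le_left _ _
        _ ≤ 1 / L1 * (L1 * dB Ω x) := by gcongr; exact h1 x hx
        _ = dB Ω x := by field_simp
  · obtain ⟨c, hc, h⟩ := hK.exists_pos_le_of_pos_on_zeros hr.continuous
      ((hcg.div_const 2).add (hr.continuous.mul hclap)) hrcl (fun x hx h0 => by
        have := hgrad' x hx h0
        change 0 < (∑ i, pderiv' i r x ^ 2) / 2 + r x * lap r x
        rw [h0, zero_mul, add_zero]; linarith)
    exact ⟨c, hc, fun x hx => h x (subset_closure hx)⟩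

end DefiningFunction

section WeightedSobolev

variable {n : ℕ}

local notation "V" => EuclideanSpace ℝ (Fin n)

lemma integrableOn_of_continuousOn_of_bounded {Ω : Set V} (hΩo : IsOpen Ω)
    (hb : Bornology.IsBounded Ω) {g : V → ℝ} {B : ℝ} (hg : ContinuousOn g Ω)
    (hB : ∀ x ∈ Ω, |g x| ≤ B) : IntegrableOn g Ω := by
  refine Integrable.mono' (g := fun _ => B) (integrableOn_const hb.measure_lt_top.ne)
    (hg.aestronglyMeasurable hΩo.measurableSet) ?_
  exact (ae_restrict_iff' hΩo.measurableSet).2 (Eventually.of_forall hB)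

lemma exists_bound_pderiv' {Ω : Set V} (hb : Bornology.IsBounded Ω) {r : V → ℝ}
    (hr : ContDiff ℝ (⊤ : ℕ∞) r) : ∃ C, 0 < C ∧ ∀ i, ∀ x ∈ closure Ω, |pderiv' i r x| ≤ C := by
  have : ∀ i : Fin n, ∃ C, 0 < C ∧ ∀ x ∈ closure Ω, |pderiv' i r x| ≤ C := fun i =>
    exists_bound_of_bounded hb (contDiff_pderiv' hr i).continuous
  choose C hC hC' using this
  refine ⟨1 + ∑ i, C i, by have := Finset.sum_nonneg fun i (_ : i ∈ Finset.univ) => (hC i).le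
                           linarith, fun i x hx => (hC' i x hx).trans ?_⟩
  linarith [Finset.single_le_sum (fun i _ => (hC i).le) (Finset.mem_univ i)]

/-- A weighted Hardy inequality: the unweighted `L²` norm is controlled by the weighted energy. -/
theorem weighted_hardy {Ω : Set V} (hb : Bornology.IsBounded Ω) {r : V → ℝ}
    (hr : ContDiff ℝ (⊤ : ℕ∞) r) (hΩ : ∀ x, x ∈ Ω ↔ 0 < r x) {c : ℝ} (hc : 0 < c)
    (hcr : ∀ x ∈ Ω, r x < c → c ≤ (∑ i, pderiv' i r x ^ 2) / 2 + r x * lap r x)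
    {P : ℝ} (hP : 0 < P) :
    ∃ C > 0, ∀ f : V → ℝ, ContDiffOn ℝ 1 f Ω →
      (∃ B, ∀ x ∈ Ω, |f x| ≤ B ∧ ∀ i, |r x * pderiv' i f x| ≤ B) →
      ∫ x in Ω, f x ^ 2 ≤ C * ((∫ x in Ω, r x ^ 2 * ∑ i, pderiv' i f x ^ 2) +
        ∫ x in Ω, r x ^ P * f x ^ 2) := by
  have hΩo : IsOpen Ω := by
    have : Ω = {x | 0 < r x} := by ext x; exact hΩ x
    rw [this]; exact isOpen_lt continuous_const hr.continuous
  have hcg : Continuous fun x => ∑ i, pderiv' i r x ^ 2 :=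
    continuous_finsetSum _ fun i _ => (contDiff_pderiv' hr i).continuous.pow 2
  have hclap : Continuous (lap r) := by
    unfold lap
    exact continuous_finsetSum _ fun i _ =>
      (contDiff_pderiv' (contDiff_pderiv' hr i) i).continuous
  obtain ⟨M, hM, hGM⟩ : ∃ M, 0 < M ∧ ∀ x ∈ closure Ω,
      |(∑ i, pderiv' i r x ^ 2) / 2 + r x * lap r x| ≤ M :=
    exists_bound_of_bounded hb ((hcg.div_const 2).add (hr.continuous.mul hclap))
  obtain ⟨L, hL, hrL⟩ := exists_bound_pderiv' hb hr
  obtain ⟨R, hR, hrR⟩ := exists_bound_of_bounded hb hr.continuous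
  set C1 := (c + M) / c ^ P with hC1
  have hC1p : 0 < C1 := by positivity
  have hG : ∀ x ∈ Ω, c ≤ (∑ i, pderiv' i r x ^ 2) / 2 + r x * lap r x + C1 * r x ^ P := by
    intro x hx
    have hrx := (hΩ x).1 hx
    by_cases hlt : r x < c
    · have := hcr x hx hlt
      have : 0 ≤ C1 * r x ^ P := by positivity
      linarith
    · have h1 : c ^ P ≤ r x ^ P := Real.rpow_le_rpow hc.le (not_lt.1 hlt) hP.le
      have h2 : c + M ≤ C1 * r x ^ P := by
        calc c + M = C1 * c ^ P := by rw [hC1]; field_simp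
          _ ≤ _ := by gcongr
      have h3 := (abs_le.1 (hGM x (subset_closure hx))).1
      linarith
  refine ⟨(2 + C1) / c, by positivity, fun f hf ⟨B, hB⟩ => ?_⟩
  have hfc : ContinuousOn f Ω := hf.continuousOn
  have hfd : ∀ i, ContinuousOn (pderiv' i f) Ω := fun i =>
    (hf.pderiv'_of_isOpen hΩo (m := 0) (by simp) i).continuousOn
  have hrc : ContinuousOn r Ω := hr.continuous.continuousOn
  have hri : ∀ i, ContinuousOn (pderiv' i r) Ω := fun i =>
    (contDiff_pderiv' hr i).continuous.continuousOn
  have hrP : ContinuousOn (fun x => r x ^ P) Ω :=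
    hrc.rpow_const fun x hx => Or.inl ((hΩ x).1 hx).ne'
  have int1 : IntegrableOn (fun x => f x ^ 2) Ω :=
    integrableOn_of_continuousOn_of_bounded (B := B ^ 2) hΩo hb (hfc.pow 2) fun x hx => by
      rw [abs_pow]; exact pow_le_pow_left₀ (abs_nonneg _) (hB x hx).1 2
  have int2 : IntegrableOn (fun x => r x ^ 2 * ∑ i, pderiv' i f x ^ 2) Ω := by
    refine integrableOn_of_continuousOn_of_bounded (B := ∑ _i : Fin n, B ^ 2) hΩo hb
      ((hrc.pow 2).mul (continuousOn_finsetSum _ fun i _ => (hfd i).pow 2)) fun x hx => ?_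
    rw [Finset.mul_sum]
    refine (Finset.abs_sum_le_sum_abs _ _).trans (Finset.sum_le_sum fun i _ => ?_)
    rw [← mul_pow, abs_pow]; exact pow_le_pow_left₀ (abs_nonneg _) ((hB x hx).2 i) 2
  have int3 : IntegrableOn (fun x => r x ^ P * f x ^ 2) Ω := by
    refine integrableOn_of_continuousOn_of_bounded (B := R ^ P * B ^ 2) hΩo hb
      (hrP.mul (hfc.pow 2)) fun x hx => ?_
    have hrx := (hΩ x).1 hx
    rw [abs_mul, abs_pow, abs_of_pos (by positivity)]
    have := (abs_le.1 (hrR x (subset_closure hx))).2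
    exact mul_le_mul (Real.rpow_le_rpow hrx.le this hP.le)
      (pow_le_pow_left₀ (abs_nonneg _) (hB x hx).1 2) (by positivity) (by positivity)
  set X : Fin n → V → ℝ := fun i x => (f x * f x) * (r x * pderiv' i r x) with hX
  have hXi : ∀ i, ContDiffOn ℝ 1 (X i) Ω := fun i =>
    (hf.mul hf).mul (((hr.mul (contDiff_pderiv' hr i)).of_le (by exact_mod_cast le_top)).contDiffOn)
  have hdX : ∀ x ∈ Ω, ∑ i, pderiv' i (X i) x =
      f x ^ 2 * ((∑ i, pderiv' i r x ^ 2) + r x * lap r x) +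
        2 * f x * r x * ∑ i, pderiv' i f x * pderiv' i r x := by
    intro x hx
    have df : DifferentiableAt ℝ f x :=
      (hf.differentiableOn (by simp)).differentiableAt (hΩo.mem_nhds hx)
    have dr : DifferentiableAt ℝ r x := (hr.differentiable (by simp)).differentiableAt
    have dri : ∀ i, DifferentiableAt ℝ (pderiv' i r) x := fun i =>
      ((contDiff_pderiv' hr i).differentiable (by simp)).differentiableAt
    have : ∀ i, pderiv' i (X i) x = f x ^ 2 * (pderiv' i r x ^ 2 + r x * pderiv' i (pderiv' i r) x) +
        2 * f x * r x * (pderiv' i f x * pderiv' i r x) := by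
      intro i
      rw [hX]
      simp only
      rw [pderiv'_mul i (f := fun y => f y * f y) (g := fun y => r y * pderiv' i r y)
          (df.mul df) (dr.mul (dri i)), pderiv'_mul i df df, pderiv'_mul i dr (dri i)]
      ring
    simp_rw [this]
    unfold lap
    rw [Finset.sum_add_distrib, ← Finset.mul_sum, ← Finset.mul_sum, Finset.sum_add_distrib,
      ← Finset.mul_sum]
  have hlow : ∀ x ∈ Ω, c * f x ^ 2 - C1 * (r x ^ P * f x ^ 2) -
      2 * (r x ^ 2 * ∑ i, pderiv' i f x ^ 2) ≤ ∑ i, pderiv' i (X i) x := by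
    intro x hx
    rw [hdX x hx]
    have h1 := hG x hx
    have h2 : 0 ≤ ∑ i, (f x * pderiv' i r x + 2 * (r x * pderiv' i f x)) ^ 2 :=
      Finset.sum_nonneg fun i _ => sq_nonneg _
    have h3 : ∑ i, (f x * pderiv' i r x + 2 * (r x * pderiv' i f x)) ^ 2 =
        f x ^ 2 * (∑ i, pderiv' i r x ^ 2) + 4 * (f x * r x * ∑ i, pderiv' i f x * pderiv' i r x) +
        4 * (r x ^ 2 * ∑ i, pderiv' i f x ^ 2) := by
      simp only [Finset.mul_sum, ← Finset.sum_add_distrib]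
      refine Finset.sum_congr rfl fun i _ => by ring
    have h4 := mul_le_mul_of_nonneg_left h1 (sq_nonneg (f x))
    rw [h3] at h2
    nlinarith
  have hint : IntegrableOn (fun x => ∑ i, pderiv' i (X i) x) Ω := by
    refine integrableOn_of_continuousOn_of_bounded
      (B := B ^ 2 * (2 * M + |∑ _i : Fin n, L ^ 2| + M) + 2 * B * ∑ _i : Fin n, B * L) hΩo hb
      (continuousOn_finsetSum _ fun i _ =>
        ((hXi i).pderiv'_of_isOpen hΩo (m := 0) (by simp) i).continuousOn) fun x hx => ?_
    have hB0 : 0 ≤ B := (abs_nonneg _).trans (hB x hx).1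
    rw [hdX x hx]
    refine (abs_add_le _ _).trans (add_le_add ?_ ?_)
    · rw [abs_mul, abs_pow]
      refine mul_le_mul (pow_le_pow_left₀ (abs_nonneg _) (hB x hx).1 2) ?_ (abs_nonneg _)
        (by positivity)
      have h1 := hGM x (subset_closure hx)
      have h2 : |∑ i, pderiv' i r x ^ 2| ≤ |∑ _i : Fin n, L ^ 2| := by
        rw [abs_of_nonneg (Finset.sum_nonneg fun i _ => sq_nonneg _),
          abs_of_nonneg (Finset.sum_nonneg fun i _ => sq_nonneg _)]
        refine Finset.sum_le_sum fun i _ => ?_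
        rw [← sq_abs]
        exact pow_le_pow_left₀ (abs_nonneg _) (hrL i x (subset_closure hx)) 2
      rw [abs_le] at *
      have := Finset.sum_nonneg fun i (_ : i ∈ Finset.univ) => sq_nonneg (pderiv' i r x)
      constructor <;> linarith
    · have : 2 * f x * r x * ∑ i, pderiv' i f x * pderiv' i r x =
          (2 * f x) * ∑ i, (r x * pderiv' i f x) * pderiv' i r x := by
        simp only [Finset.mul_sum]
        refine Finset.sum_congr rfl fun i _ => by ring
      rw [this, abs_mul, abs_mul, abs_two]
      refine mul_le_mul (by linarith [(hB x hx).1]) ?_ (abs_nonneg _) (by positivity)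
      refine (Finset.abs_sum_le_sum_abs _ _).trans (Finset.sum_le_sum fun i _ => ?_)
      rw [abs_mul]
      exact mul_le_mul ((hB x hx).2 i) (hrL i x (subset_closure hx)) (abs_nonneg _) hB0
  have hzero := integral_div_eq_zero hb hr hΩ hXi (C := B ^ 2 * L) (fun i x hx => by
    have hrx := (hΩ x).1 hx
    have hB0 : 0 ≤ B := (abs_nonneg _).trans (hB x hx).1
    rw [hX]
    simp only [abs_mul, abs_of_pos hrx]
    have h1 := hrL i x (subset_closure hx)
    calc |f x| * |f x| * (r x * |pderiv' i r x|) ≤ B * B * (r x * L) := by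
          gcongr <;> exact (hB x hx).1
      _ = _ := by ring) hint
  have hmono := setIntegral_mono_on (((int1.const_mul c).sub (int3.const_mul C1)).sub
    (int2.const_mul 2))
    hint hΩo.measurableSet hlow
  rw [hzero] at hmono
  simp only [Pi.sub_apply] at hmono
  have e1 : ∫ x in Ω, (c * f x ^ 2 - C1 * (r x ^ P * f x ^ 2) -
      2 * (r x ^ 2 * ∑ i, pderiv' i f x ^ 2)) = c * (∫ x in Ω, f x ^ 2) -
      C1 * (∫ x in Ω, r x ^ P * f x ^ 2) - 2 * ∫ x in Ω, r x ^ 2 * ∑ i, pderiv' i f x ^ 2 := by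
    rw [integral_sub, integral_sub, integral_const_mul, integral_const_mul, integral_const_mul]
    · exact int1.const_mul c
    · exact int3.const_mul C1
    · exact (int1.const_mul c).sub (int3.const_mul C1)
    · exact int2.const_mul 2
  rw [e1] at hmono
  have n2 : 0 ≤ ∫ x in Ω, r x ^ 2 * ∑ i, pderiv' i f x ^ 2 :=
    setIntegral_nonneg hΩo.measurableSet fun x _ => mul_nonneg (sq_nonneg _)
      (Finset.sum_nonneg fun i _ => sq_nonneg _)
  have n3 : 0 ≤ ∫ x in Ω, r x ^ P * f x ^ 2 :=
    setIntegral_nonneg hΩo.measurableSet fun x hx => mul_nonneg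
      (Real.rpow_nonneg ((hΩ x).1 hx).le _) (sq_nonneg _)
  rw [div_mul_eq_mul_div, le_div_iff₀ hc]
  nlinarith

end WeightedSobolev

section Sobolev

variable {n : ℕ}

local notation "V" => EuclideanSpace ℝ (Fin n)

lemma eLpNorm_le_mul_of_support_subset {F : Type*} [NormedAddCommGroup F] {Ω : Set V} {g : V → F}
    {s q : ENNReal} (hsq : s ≤ q) (hg : AEStronglyMeasurable g) (hsub : Function.support g ⊆ Ω) :
    eLpNorm g s volume ≤ (volume Ω) ^ (1 / s.toReal - 1 / q.toReal) * eLpNorm g q volume := by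
  have e1 (q : ENNReal) : eLpNorm g q (volume.restrict Ω) =
      eLpNorm g q volume := eLpNorm_restrict_eq_of_support_subset hsub
  rw [← e1 s, ← e1 q, mul_comm]
  simpa using eLpNorm_le_eLpNorm_mul_rpow_measure_univ (μ := volume.restrict Ω) hsq hg.restrict

lemma eLpNorm_fderiv_le_two {Ω : Set V} (hb : Bornology.IsBounded Ω) {s : ENNReal}
    (hs : 1 ≤ s) (hs2 : s ≤ 2) : ∃ K : NNReal, ∀ h : V → ℝ, ContDiff ℝ 1 h → tsupport h ⊆ Ω →
      eLpNorm (fderiv ℝ h) s volume ≤ K * eLpNorm (fderiv ℝ h) 2 volume := by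
  have hexp : (0 : ℝ) ≤ 1 / s.toReal - 1 / (2 : ENNReal).toReal := by
    have h1 : 1 ≤ s.toReal := by
      simpa using ENNReal.toReal_mono (ne_top_of_le_ne_top (by simp) hs2) hs
    have h2 : s.toReal ≤ 2 := by simpa using ENNReal.toReal_mono (by simp) hs2
    have := one_div_le_one_div_of_le (by linarith) h2
    simpa using this
  have hfin : (volume Ω) ^ (1 / s.toReal - 1 / (2 : ENNReal).toReal) ≠ ⊤ :=
    ENNReal.rpow_ne_top_of_nonneg hexp hb.measure_lt_top.ne
  refine ⟨((volume Ω) ^ (1 / s.toReal - 1 / (2 : ENNReal).toReal)).toNNReal, fun h hh hsup => ?_⟩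
  have hsub : Function.support (fderiv ℝ h) ⊆ Ω :=
    (support_fderiv_subset ℝ (f := h)).trans hsup
  rw [ENNReal.coe_toNNReal hfin]
  exact eLpNorm_le_mul_of_support_subset hs2
    (hh.continuous_fderiv (by simp)).aestronglyMeasurable hsub

lemma enorm_le_lintegral_fderiv_dim_one {h : EuclideanSpace ℝ (Fin 1) → ℝ}
    (hh : ContDiff ℝ 1 h) (hc : HasCompactSupport h) (x : EuclideanSpace ℝ (Fin 1)) :
    ‖h x‖ₑ ≤ ∫⁻ y, ‖fderiv ℝ h y‖ₑ := by
  set e : ℝ ≃ₗᵢ[ℝ] EuclideanSpace ℝ (Fin 1) :=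
    ((stdOrthonormalBasis ℝ ℝ).reindex (finCongr (Module.finrank_self ℝ))).repr with he
  have hg : ContDiff ℝ 1 (h ∘ e) := hh.comp e.toContinuousLinearEquiv.contDiff
  have hgc : HasCompactSupport (h ∘ e) := hc.comp_homeomorph e.toHomeomorph
  have h1 := HasCompactSupport.enorm_le_lintegral_Ici_deriv hg hgc (e.symm x)
  simp only [Function.comp_apply, LinearIsometryEquiv.apply_symm_apply] at h1
  refine h1.trans ((lintegral_mono' Measure.restrict_le_self le_rfl).trans ?_)
  have h2 : ∀ y, ‖deriv (h ∘ e) y‖ₑ ≤ ‖fderiv ℝ h (e y)‖ₑ := by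
    intro y
    have hd : HasDerivAt (h ∘ e) (fderiv ℝ h (e y) (e 1)) y := by
      have ha : HasFDerivAt h (fderiv ℝ h (e y)) (e y) :=
        (hh.differentiable (by simp)).differentiableAt.hasFDerivAt
      have hb : HasDerivAt e (e 1) y := by
        simpa using (e.toContinuousLinearEquiv.hasFDerivAt (x := y)).hasDerivAt
      exact ha.comp_hasDerivAt y hb
    rw [hd.deriv]
    have := (fderiv ℝ h (e y)).le_opNorm (e 1)
    rw [e.norm_map, norm_one, mul_one] at this
    simpa only [enorm_le_iff_norm_le] using this
  refine (lintegral_mono h2).trans (le_of_eq ?_)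
  exact e.measurePreserving.lintegral_comp
    (hh.continuous_fderiv (by simp)).enorm.measurable

/-- Sobolev inequality for compactly supported functions in a bounded domain, in the subcritical
and critical range. -/
theorem exists_sobolev_const (hn : 1 ≤ n) {Ω : Set V} (hb : Bornology.IsBounded Ω) {P : ℝ}
    (hP : 2 < P) (hcrit : n ≤ 2 ∨ P ≤ 2 * n / ((n : ℝ) - 2)) :
    ∃ K : NNReal, ∀ h : V → ℝ, ContDiff ℝ 1 h → tsupport h ⊆ Ω →
      eLpNorm h (ENNReal.ofReal P) volume ≤ K * eLpNorm (fderiv ℝ h) 2 volume := by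
  rcases hn.eq_or_lt with h1 | h1
  · subst h1
    obtain ⟨K, hK⟩ := eLpNorm_fderiv_le_two hb (s := 1) le_rfl (by simp)
    have hfin : (volume Ω) ^ ((ENNReal.ofReal P).toReal⁻¹) ≠ ⊤ :=
      ENNReal.rpow_ne_top_of_nonneg (by simp) hb.measure_lt_top.ne
    refine ⟨((volume Ω) ^ ((ENNReal.ofReal P).toReal⁻¹)).toNNReal * K, fun h hh hs => ?_⟩
    have hc : HasCompactSupport h := HasCompactSupport.of_support_subset_isCompact
      hb.isCompact_closure ((subset_tsupport _).trans (hs.trans subset_closure))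
    have hle := hK h hh hs
    rw [eLpNorm_one_eq_lintegral_enorm] at hle
    have hsup : ∀ x, ‖h x‖ₑ ≤ K * eLpNorm (fderiv ℝ h) 2 volume := fun x =>
      (enorm_le_lintegral_fderiv_dim_one hh hc x).trans hle
    rw [← eLpNorm_restrict_eq_of_support_subset ((subset_tsupport _).trans hs)]
    push_cast
    rw [ENNReal.coe_toNNReal hfin, mul_assoc]
    have hlt : K * eLpNorm (fderiv ℝ h) 2 volume ≠ ⊤ := by
      refine ENNReal.mul_ne_top (by simp) ?_
      exact ((hh.continuous_fderiv (by simp)).memLp_of_hasCompactSupport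
        (hc.fderiv ℝ)).eLpNorm_lt_top.ne
    have := eLpNorm_le_of_ae_bound (p := ENNReal.ofReal P) (μ := volume.restrict Ω) (f := h)
      (C := (K * eLpNorm (fderiv ℝ h) 2 volume).toReal) (Eventually.of_forall fun x => by
        have h2 := ENNReal.toReal_mono hlt (hsup x)
        simpa using h2)
    rw [ENNReal.ofReal_toReal hlt] at this
    simpa using this
  · have hfr : Module.finrank ℝ V = n := by simp
    have hPt : ENNReal.ofReal P = ((P.toNNReal : NNReal) : ENNReal) := rfl
    have hPr : ((P.toNNReal : NNReal) : ℝ) = P := Real.coe_toNNReal _ (by linarith)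
    have main : ∀ s : NNReal, 1 ≤ s → s ≤ 2 → (s : ℝ) < n → (s : ℝ)⁻¹ - (n : ℝ)⁻¹ ≤ P⁻¹ →
        ∃ K : NNReal, ∀ h : V → ℝ, ContDiff ℝ 1 h → tsupport h ⊆ Ω →
      eLpNorm h (ENNReal.ofReal P) volume ≤ K * eLpNorm (fderiv ℝ h) 2 volume := by
      intro s hs1 hs2 hsn hsP
      obtain ⟨K, hK⟩ := eLpNorm_fderiv_le_two hb (s := s) (by exact_mod_cast hs1)
        (by exact_mod_cast hs2)
      refine ⟨eLpNormLESNormFDerivOfLeConst ℝ (volume : Measure V) Ω s P.toNNReal * K,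
        fun h hh hs => ?_⟩
      have := eLpNorm_le_eLpNorm_fderiv_of_le (volume : Measure V) hh
        ((subset_tsupport _).trans hs) (p := s) (q := P.toNNReal) hs1
        (by rw [hfr]; exact_mod_cast hsn) (by rw [hfr, hPr]; exact_mod_cast hsP) hb
      rw [hPt]
      refine this.trans ?_
      push_cast
      rw [mul_assoc]
      gcongr
      exact hK h hh hs
    rcases Nat.lt_or_ge 2 n with h2 | h2
    · have hn2 : (2 : ℝ) < n := by exact_mod_cast h2
      have hcrit' : P ≤ 2 * n / ((n : ℝ) - 2) := by
        rcases hcrit with h | h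
        · omega
        · exact h
      apply main 2 (by norm_num) le_rfl (by simpa using hn2)
      have hnp : (0 : ℝ) < n - 2 := by linarith
      rw [le_div_iff₀ hnp] at hcrit'
      have hP0 : 0 < P := by linarith
      have hn0 : (0 : ℝ) < n := by linarith
      push_cast
      rw [inv_eq_one_div P, le_div_iff₀ hP0]
      field_simp
      linarith
    · have hn2 : n = 2 := by omega
      have hP0 : 0 < P := by linarith
      set s : ℝ := 2 * P / (P + 2) with hs
      have hs1 : 1 ≤ s := by rw [hs, le_div_iff₀ (by linarith)]; linarith
      have hs2 : s < 2 := by rw [hs, div_lt_iff₀ (by linarith)]; linarith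
      have hsr : ((s.toNNReal : NNReal) : ℝ) = s := Real.coe_toNNReal _ (by linarith)
      apply main s.toNNReal (by rw [← NNReal.coe_le_coe, hsr]; simpa using hs1)
        (by rw [← NNReal.coe_le_coe, hsr]; exact hs2.le) (by rw [hsr, hn2]; exact hs2)
      rw [hsr, hn2, hs]
      apply le_of_eq
      push_cast
      field_simp
      ring

/-- The weighted Sobolev inequality on a smooth bounded domain. -/
theorem weighted_sobolev (hn : 1 ≤ n) {Ω : Set V} (hb : Bornology.IsBounded Ω) {r : V → ℝ}
    (hr : ContDiff ℝ (⊤ : ℕ∞) r) (hΩ : ∀ x, x ∈ Ω ↔ 0 < r x) {c : ℝ} (hc : 0 < c)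
    (hcr : ∀ x ∈ Ω, r x < c → c ≤ (∑ i, pderiv' i r x ^ 2) / 2 + r x * lap r x)
    {P : ℝ} (hP : 2 < P) (hcrit : n ≤ 2 ∨ P ≤ 2 * n / ((n : ℝ) - 2)) :
    ∃ C > 0, ∀ f : V → ℝ, ContDiffOn ℝ 1 f Ω →
      (∃ B, ∀ x ∈ Ω, |f x| ≤ B ∧ ∀ i, |r x * pderiv' i f x| ≤ B) →
      (∫ x in Ω, (r x * |f x|) ^ P) ^ (2 / P) ≤
        C * ((∫ x in Ω, r x ^ 2 * ∑ i, pderiv' i f x ^ 2) + ∫ x in Ω, r x ^ P * f x ^ 2) := by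
  have hΩo : IsOpen Ω := by
    have : Ω = {x | 0 < r x} := by ext x; exact hΩ x
    rw [this]; exact isOpen_lt continuous_const hr.continuous
  have hP0 : 0 < P := by linarith
  obtain ⟨C1, hC1, hardy⟩ := weighted_hardy hb hr hΩ hc hcr hP0
  obtain ⟨K, hK⟩ := exists_sobolev_const hn hb hP hcrit
  obtain ⟨L, hL, hrL⟩ := exists_bound_pderiv' hb hr
  obtain ⟨R, hR, hrR⟩ := exists_bound_of_bounded hb hr.continuous
  obtain ⟨η, D, hD, hηs, hη01, hηc, hηt, hηd, hη1⟩ := exists_cutoffs hb hr hΩ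
  refine ⟨(K : ℝ) ^ 2 * (2 + 2 * (n * (D + L) ^ 2) * C1) + 1, by positivity, fun f hf hB' => ?_⟩
  have hardyf := hardy f hf hB'
  obtain ⟨B, hB⟩ := hB'
  have hfc : ContinuousOn f Ω := hf.continuousOn
  have hfd : ∀ i, ContinuousOn (pderiv' i f) Ω := fun i =>
    (hf.pderiv'_of_isOpen hΩo (m := 0) (by simp) i).continuousOn
  have hrc : ContinuousOn r Ω := hr.continuous.continuousOn
  have int1 : IntegrableOn (fun x => f x ^ 2) Ω :=
    integrableOn_of_continuousOn_of_bounded (B := B ^ 2) hΩo hb (hfc.pow 2) fun x hx => by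
      rw [abs_pow]; exact pow_le_pow_left₀ (abs_nonneg _) (hB x hx).1 2
  have int2 : IntegrableOn (fun x => r x ^ 2 * ∑ i, pderiv' i f x ^ 2) Ω := by
    refine integrableOn_of_continuousOn_of_bounded (B := ∑ _i : Fin n, B ^ 2) hΩo hb
      ((hrc.pow 2).mul (continuousOn_finsetSum _ fun i _ => (hfd i).pow 2)) fun x hx => ?_
    rw [Finset.mul_sum]
    refine (Finset.abs_sum_le_sum_abs _ _).trans (Finset.sum_le_sum fun i _ => ?_)
    rw [← mul_pow, abs_pow]; exact pow_le_pow_left₀ (abs_nonneg _) ((hB x hx).2 i) 2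
  set h : ℕ → V → ℝ := fun k x => η k x * (r x * f x) with hh
  have hht : ∀ k, tsupport (h k) ⊆ Ω := fun k => tsupport_mul_subset_left.trans (hηt k)
  have hhc : ∀ k, HasCompactSupport (h k) := fun k => (hηc k).mul_right
  have hhs : ∀ k, ContDiff ℝ 1 (h k) := by
    intro k
    rw [contDiff_iff_contDiffAt]
    intro x
    by_cases hx : x ∈ tsupport (η k)
    · have hxΩ := hΩo.mem_nhds (hηt k hx)
      exact ((hηs k).of_le (by exact_mod_cast le_top)).contDiffAt.mul
        ((hr.of_le (by exact_mod_cast le_top)).contDiffAt.mul (hf.contDiffAt hxΩ))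
    · have : h k =ᶠ[𝓝 x] fun _ => 0 := by
        filter_upwards [notMem_tsupport_iff_eventuallyEq.1 hx] with y hy
        simp [hh, hy]
      exact contDiffAt_const.congr_of_eventuallyEq this
  set A := ∫ x in Ω, r x ^ 2 * ∑ i, pderiv' i f x ^ 2 with hA
  set F := ∫ x in Ω, f x ^ 2 with hF
  have hfder : ∀ k, ∀ x ∈ Ω, ‖fderiv ℝ (h k) x‖ ^ 2 ≤ 2 * (r x ^ 2 * ∑ i, pderiv' i f x ^ 2) +
      2 * (n * (D + L) ^ 2) * f x ^ 2 := by
    intro k x hx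
    have hrx := (hΩ x).1 hx
    have df : DifferentiableAt ℝ f x :=
      (hf.differentiableOn (by simp)).differentiableAt (hΩo.mem_nhds hx)
    have dr : DifferentiableAt ℝ r x := (hr.differentiable (by simp)).differentiableAt
    have dη : DifferentiableAt ℝ (η k) x := ((hηs k).differentiable (by simp)).differentiableAt
    have e : ∀ i, pderiv' i (h k) x ^ 2 ≤ 2 * (r x ^ 2 * pderiv' i f x ^ 2) +
        2 * (D + L) ^ 2 * f x ^ 2 := by
      intro i
      have e1 : pderiv' i (h k) x = η k x * (r x * pderiv' i f x) +
          (η k x * pderiv' i r x + r x * pderiv' i (η k) x) * f x := by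
        rw [hh]
        simp only
        rw [pderiv'_mul i (g := fun y => r y * f y) dη (dr.mul df), pderiv'_mul i dr df]
        ring
      have e2 : (η k x * (r x * pderiv' i f x)) ^ 2 ≤ r x ^ 2 * pderiv' i f x ^ 2 := by
        rw [mul_pow, mul_pow]
        exact mul_le_of_le_one_left (by positivity) (pow_le_one₀ (hη01 k x).1 (hη01 k x).2)
      have e3 : |η k x * pderiv' i r x + r x * pderiv' i (η k) x| ≤ D + L := by
        refine (abs_add_le _ _).trans ?_
        rw [add_comm]
        refine add_le_add (hηd k x hx i) ?_
        rw [abs_mul, abs_of_nonneg (hη01 k x).1]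
        exact (mul_le_of_le_one_left (abs_nonneg _) (hη01 k x).2).trans
          (hrL i x (subset_closure hx))
      have e4 : ((η k x * pderiv' i r x + r x * pderiv' i (η k) x) * f x) ^ 2 ≤
          (D + L) ^ 2 * f x ^ 2 := by
        rw [mul_pow]
        refine mul_le_mul_of_nonneg_right ?_ (sq_nonneg _)
        rw [← sq_abs]
        exact pow_le_pow_left₀ (abs_nonneg _) e3 2
      rw [e1]
      refine (add_sq_le).trans ?_
      linarith
    rw [fderiv_norm_sq_eq]
    refine (Finset.sum_le_sum fun i _ => e i).trans (le_of_eq ?_)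
    rw [Finset.sum_add_distrib, ← Finset.mul_sum, ← Finset.mul_sum]
    simp
    ring
  have hint : ∀ k, (∫ x, ‖fderiv ℝ (h k) x‖ ^ 2) ≤ 2 * A + 2 * (n * (D + L) ^ 2) * F := by
    intro k
    have hcd : Continuous (fderiv ℝ (h k)) := (hhs k).continuous_fderiv (by simp)
    rw [← setIntegral_eq_integral_of_forall_compl_eq_zero (s := Ω)]
    · have : ∫ x in Ω, (2 * (r x ^ 2 * ∑ i, pderiv' i f x ^ 2) +
          2 * (n * (D + L) ^ 2) * f x ^ 2) = 2 * A + 2 * (n * (D + L) ^ 2) * F := by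
        rw [integral_add, integral_const_mul, integral_const_mul]
        · exact int2.const_mul 2
        · exact int1.const_mul _
      rw [← this]
      refine setIntegral_mono_on ?_ ((int2.const_mul 2).add (int1.const_mul _))
        hΩo.measurableSet (hfder k)
      have m : MemLp (fderiv ℝ (h k)) 2 volume :=
        hcd.memLp_of_hasCompactSupport ((hhc k).fderiv ℝ)
      exact (m.integrable_norm_pow (by simp)).integrableOn
    · intro x hx
      have : fderiv ℝ (h k) x = 0 := by
        by_contra hne
        exact hx (hht k (support_fderiv_subset ℝ hne))
      simp [this]
  have hsob : ∀ k, (∫ x in Ω, |h k x| ^ P) ^ (2 / P) ≤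
      (K : ℝ) ^ 2 * (2 * A + 2 * (n * (D + L) ^ 2) * F) := by
    intro k
    have hcd : Continuous (fderiv ℝ (h k)) := (hhs k).continuous_fderiv (by simp)
    have m1 : MemLp (h k) (ENNReal.ofReal P) volume :=
      (hhs k).continuous.memLp_of_hasCompactSupport (hhc k)
    have m2 : MemLp (fderiv ℝ (h k)) 2 volume :=
      hcd.memLp_of_hasCompactSupport ((hhc k).fderiv ℝ)
    have hle := hK (h k) (hhs k) (hht k)
    rw [m1.eLpNorm_eq_integral_rpow_norm (by simpa using hP0) (by simp),
      m2.eLpNorm_eq_integral_rpow_norm (by simp) (by simp), ← ENNReal.ofReal_coe_nnreal,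
      ← ENNReal.ofReal_mul (by positivity),
      ENNReal.ofReal_le_ofReal_iff (mul_nonneg (by positivity)
        (Real.rpow_nonneg (integral_nonneg fun x => by positivity) _)),
      ENNReal.toReal_ofReal hP0.le] at hle
    simp only [Real.norm_eq_abs, ENNReal.toReal_ofNat] at hle
    rw [← setIntegral_eq_integral_of_forall_compl_eq_zero (s := Ω)] at hle
    · have n1 : 0 ≤ ∫ x in Ω, |h k x| ^ P := integral_nonneg fun x => by positivity
      have n2 : 0 ≤ ∫ x, ‖fderiv ℝ (h k) x‖ ^ (2 : ℝ) := integral_nonneg fun x => by positivity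
      have hsq := pow_le_pow_left₀ (Real.rpow_nonneg n1 _) hle 2
      rw [mul_pow, ← Real.rpow_natCast (_ ^ P⁻¹), ← Real.rpow_mul n1,
        ← Real.rpow_natCast (_ ^ (2 : ℝ)⁻¹), ← Real.rpow_mul n2] at hsq
      have e1 : P⁻¹ * ((2 : ℕ) : ℝ) = 2 / P := by push_cast; ring
      have e2 : (2 : ℝ)⁻¹ * ((2 : ℕ) : ℝ) = 1 := by norm_num
      rw [e1, e2, Real.rpow_one] at hsq
      refine hsq.trans (mul_le_mul_of_nonneg_left ?_ (by positivity))
      have := hint k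
      simpa only [Real.rpow_two] using this
    · intro x hx
      rw [image_eq_zero_of_notMem_tsupport fun hx' => hx (hht k hx')]
      simp [hP0.ne']
  have hlim : Tendsto (fun k => ∫ x in Ω, |h k x| ^ P) atTop (𝓝 (∫ x in Ω, (r x * |f x|) ^ P)) := by
    apply tendsto_integral_of_dominated_convergence (fun _ => (R * B) ^ P)
    · exact fun k => ((hhs k).continuous.abs.rpow_const fun x => Or.inr hP0.le).aestronglyMeasurable
    · exact integrableOn_const hb.measure_lt_top.ne
    · intro k
      refine (ae_restrict_iff' hΩo.measurableSet).2 (Eventually.of_forall fun x hx => ?_)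
      have hrx := (hΩ x).1 hx
      rw [Real.norm_of_nonneg (by positivity)]
      refine Real.rpow_le_rpow (abs_nonneg _) ?_ hP0.le
      rw [hh]
      simp only [abs_mul]
      rw [abs_of_nonneg (hη01 k x).1]
      refine (mul_le_of_le_one_left (by positivity) (hη01 k x).2).trans ?_
      exact mul_le_mul (hrR x (subset_closure hx)) (hB x hx).1 (abs_nonneg _) hR.le
    · refine (ae_restrict_iff' hΩo.measurableSet).2 (Eventually.of_forall fun x hx => ?_)
      refine tendsto_const_nhds.congr' ?_
      filter_upwards [hη1 x hx] with k hk
      rw [hh]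
      simp only [hk.1, one_mul, abs_mul]
      rw [abs_of_pos ((hΩ x).1 hx)]
  have hlim2 := le_of_tendsto (hlim.rpow_const (Or.inr (by positivity : 0 ≤ 2 / P)))
    (Eventually.of_forall hsob)
  refine hlim2.trans ?_
  have nA : 0 ≤ A := setIntegral_nonneg hΩo.measurableSet fun x _ =>
    mul_nonneg (sq_nonneg _) (Finset.sum_nonneg fun i _ => sq_nonneg _)
  have nW : 0 ≤ ∫ x in Ω, r x ^ P * f x ^ 2 :=
    setIntegral_nonneg hΩo.measurableSet fun x hx => mul_nonneg
      (Real.rpow_nonneg ((hΩ x).1 hx).le _) (sq_nonneg _)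
  set W := ∫ x in Ω, r x ^ P * f x ^ 2 with hW
  calc (K : ℝ) ^ 2 * (2 * A + 2 * (n * (D + L) ^ 2) * F)
      ≤ (K : ℝ) ^ 2 * (2 * (A + W) + 2 * (n * (D + L) ^ 2) * (C1 * (A + W))) := by
        gcongr; linarith
    _ = ((K : ℝ) ^ 2 * (2 + 2 * (n * (D + L) ^ 2) * C1)) * (A + W) := by ring
    _ ≤ _ := by gcongr; linarith

end Sobolev

section Regularity

variable {n : ℕ}

local notation "V" => EuclideanSpace ℝ (Fin n)

lemma hasDerivAt_line {f : V → ℝ} {x : V} {i : Fin n} {τ : ℝ}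
    (hf : DifferentiableAt ℝ f (x + τ • EuclideanSpace.single i 1)) :
    HasDerivAt (fun s : ℝ => f (x + s • EuclideanSpace.single i 1))
      (pderiv' i f (x + τ • EuclideanSpace.single i 1)) τ := by
  have h1 : HasDerivAt (fun s : ℝ => x + s • (EuclideanSpace.single i 1 : V))
      (EuclideanSpace.single i 1) τ := by
    simpa using ((hasDerivAt_id τ).smul_const (EuclideanSpace.single i (1 : ℝ))).const_add x
  exact hf.hasFDerivAt.comp_hasDerivAt τ h1

/-- Time and space derivatives commute when the mixed derivative is bounded and continuous in
time. -/
theorem hasDerivAt_pderiv'_of_hasDerivAt {Ω : Set V} (hΩ : IsOpen Ω) {T B : ℝ} {i : Fin n}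
    {F g : V → ℝ → ℝ}
    (hF : ∀ t ∈ Icc (0 : ℝ) T, DifferentiableOn ℝ (fun y => F y t) Ω)
    (hg : ∀ t ∈ Icc (0 : ℝ) T, DifferentiableOn ℝ (fun y => g y t) Ω)
    (hFc : ∀ x ∈ Ω, ContinuousOn (F x) (Icc 0 T))
    (hFt : ∀ x ∈ Ω, ∀ t ∈ Ioo (0 : ℝ) T, HasDerivAt (F x) (g x t) t)
    (hgc : ∀ x ∈ Ω, ContinuousOn (g x) (Icc 0 T))
    (hdg : ∀ x ∈ Ω, ContinuousOn (fun t => pderiv' i (fun y => g y t) x) (Icc 0 T))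
    (hB : ∀ x ∈ Ω, ∀ t ∈ Icc (0 : ℝ) T, |pderiv' i (fun y => g y t) x| ≤ B)
    {x : V} (hx : x ∈ Ω) {t : ℝ} (ht : t ∈ Ioo (0 : ℝ) T) :
    HasDerivAt (fun s => pderiv' i (fun y => F y s) x) (pderiv' i (fun y => g y t) x) t := by
  set e : V := EuclideanSpace.single i 1 with he
  have hT : 0 < T := ht.1.trans ht.2
  have hcont : Continuous fun s : ℝ => x + s • e := by fun_prop
  have hline : ∀ᶠ s in 𝓝 (0 : ℝ), x + s • e ∈ Ω := by
    refine hcont.continuousAt.eventually_mem (hΩ.mem_nhds ?_)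
    simpa using hx
  have key : ∀ s ∈ Icc (0 : ℝ) T, pderiv' i (fun y => F y s) x =
      pderiv' i (fun y => F y 0) x + ∫ σ in (0 : ℝ)..s, pderiv' i (fun y => g y σ) x := by
    intro s hs
    have hsub : uIoc 0 s ⊆ Icc (0 : ℝ) T := by
      rw [uIoc_of_le hs.1]
      exact fun σ hσ => ⟨hσ.1.le, hσ.2.trans hs.2⟩
    have hsub' : Icc 0 s ⊆ Icc (0 : ℝ) T := Icc_subset_Icc_right hs.2
    have hmeas : ∀ y ∈ Ω, IntervalIntegrable (g y) volume 0 s := fun y hy =>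
      ((hgc y hy).mono hsub').intervalIntegrable_of_Icc hs.1
    have h1 := (intervalIntegral.hasDerivAt_integral_of_dominated_loc_of_deriv_le
      (μ := volume) (a := 0) (b := s) (x₀ := (0 : ℝ)) (bound := fun _ => B)
      (F := fun τ σ => g (x + τ • e) σ)
      (F' := fun τ σ => pderiv' i (fun y => g y σ) (x + τ • e))
      (s := {τ | x + τ • e ∈ Ω}) hline
      (by
        filter_upwards [hline] with τ hτ
        exact (intervalIntegrable_iff.1 (hmeas _ hτ)).aestronglyMeasurable)
      (by simpa using hmeas x hx)
      (by
        have : IntervalIntegrable (fun σ => pderiv' i (fun y => g y σ) x) volume 0 s :=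
          ((hdg x hx).mono hsub').intervalIntegrable_of_Icc hs.1
        simpa using (intervalIntegrable_iff.1 this).aestronglyMeasurable)
      (Eventually.of_forall fun σ hσ τ hτ => hB _ hτ σ (hsub hσ))
      intervalIntegrable_const
      (Eventually.of_forall fun σ hσ τ hτ => hasDerivAt_line
        ((hg σ (hsub hσ)).differentiableAt (hΩ.mem_nhds hτ)))).2
    have h2 : HasDerivAt (fun τ : ℝ => F (x + τ • e) s - F (x + τ • e) 0)
        (∫ σ in (0 : ℝ)..s, pderiv' i (fun y => g y σ) (x + (0 : ℝ) • e)) 0 := by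
      refine h1.congr_of_eventuallyEq ?_
      filter_upwards [hline] with τ hτ
      rw [intervalIntegral.integral_eq_sub_of_hasDerivAt_of_le hs.1
        ((hFc _ hτ).mono hsub') (fun σ hσ => hFt _ hτ σ ⟨hσ.1, hσ.2.trans_le hs.2⟩) (hmeas _ hτ)]
    have h3 : ∀ σ ∈ Icc (0 : ℝ) T, HasDerivAt (fun τ : ℝ => F (x + τ • e) σ)
        (pderiv' i (fun y => F y σ) (x + (0 : ℝ) • e)) 0 := fun σ hσ =>
      hasDerivAt_line (f := fun y => F y σ)
        ((hF σ hσ).differentiableAt (hΩ.mem_nhds (by simpa using hx)))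
    have h4 := h2.unique ((h3 s hs).sub (h3 0 ⟨le_rfl, hT.le⟩))
    simp only [zero_smul, add_zero] at h4
    linarith
  have hderiv : HasDerivAt (fun s => ∫ σ in (0 : ℝ)..s, pderiv' i (fun y => g y σ) x)
      (pderiv' i (fun y => g y t) x) t := by
    have hnhds : Icc (0 : ℝ) T ∈ 𝓝 t := Icc_mem_nhds ht.1 ht.2
    refine intervalIntegral.integral_hasDerivAt_right
      (((hdg x hx).mono (Icc_subset_Icc_right ht.2.le)).intervalIntegrable_of_Icc ht.1.le)
      ?_ ((hdg x hx).continuousAt hnhds)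
    exact ((hdg x hx).mono Ioo_subset_Icc_self).stronglyMeasurableAtFilter isOpen_Ioo t ht
  refine (hderiv.const_add (pderiv' i (fun y => F y 0) x)).congr_of_eventuallyEq ?_
  filter_upwards [Icc_mem_nhds ht.1 ht.2] with s hs using key s hs

/-- A function vanishing on the boundary with bounded derivative is controlled by the distance
to the boundary. -/
theorem abs_le_mul_dB {Ω : Set V} (hΩ : IsOpen Ω) (hne : Ω ≠ univ) {g : V → ℝ} {B : ℝ}
    (hc : ContinuousOn g (closure Ω)) (hd : DifferentiableOn ℝ g Ω)
    (hB : ∀ x ∈ Ω, ∀ i, |pderiv' i g x| ≤ B) (h0 : ∀ x ∈ frontier Ω, g x = 0) :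
    ∀ x ∈ Ω, |g x| ≤ n * B * dB Ω x := by
  intro x hx
  obtain ⟨y, hy, hxy⟩ := exists_mem_frontier_infDist_compl_eq_dist hx hne
  set ρ := Metric.infDist x Ωᶜ with hρ
  have hρ0 : 0 < ρ := by
    rw [hρ]
    have hcl : IsClosed Ωᶜ := hΩ.isClosed_compl
    exact (hcl.notMem_iff_infDist_pos (nonempty_compl.2 hne)).1 (by simpa using hx)
  have hball : Metric.ball x ρ ⊆ Ω := Metric.ball_infDist_compl_subset
  have hnorm : ∀ z ∈ Ω, ‖fderiv ℝ g z‖ ≤ n * B := fun z hz =>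
    (norm_fderiv_le_sum _ _).trans ((Finset.sum_le_sum fun i _ => hB z hz i).trans (by simp))
  have hB0 : 0 ≤ n * B := (norm_nonneg _).trans (hnorm x hx)
  have hlip : ∀ z ∈ Metric.ball x ρ, ‖g z - g x‖ ≤ n * B * ρ := by
    intro z hz
    refine ((convex_ball x ρ).norm_image_sub_le_of_norm_fderiv_le
      (fun w hw => hd.differentiableAt (hΩ.mem_nhds (hball hw)))
      (fun w hw => hnorm w (hball hw)) (Metric.mem_ball_self hρ0) hz).trans ?_
    gcongr
    rw [← dist_eq_norm]; exact (Metric.mem_ball.1 hz).le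
  have hycl : y ∈ closure (Metric.ball x ρ) := by
    rw [closure_ball x hρ0.ne', Metric.mem_closedBall, dist_comm, ← hxy]
  have hgc : ContinuousOn g (closure (Metric.ball x ρ)) := hc.mono (closure_mono hball)
  have := le_on_closure hlip (f := fun z => ‖g z - g x‖) (g := fun _ => n * B * ρ)
    (hgc.sub continuousOn_const).norm continuousOn_const hycl
  simp only [h0 y hy, zero_sub, norm_neg, Real.norm_eq_abs] at this
  refine this.trans (mul_le_mul_of_nonneg_left ?_ hB0)
  have hfr : frontier Ω ⊆ Ωᶜ := by
    rw [hΩ.frontier_eq]; exact fun z hz => hz.2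
  exact Metric.infDist_le_infDist_of_subset hfr ⟨y, hy⟩

lemma ExtendsCont.exists_bound {Ω : Set V} (hb : Bornology.IsBounded Ω) {T : ℝ} {f : V → ℝ → ℝ}
    (h : ExtendsCont Ω T f) : ∃ B, ∀ x ∈ Ω, ∀ t ∈ Icc (0 : ℝ) T, |f x t| ≤ B := by
  obtain ⟨g, hg, hfg⟩ := h
  obtain ⟨B, hB⟩ := (hb.isCompact_closure.prod isCompact_Icc).exists_bound_of_continuousOn hg
  exact ⟨B, fun x hx t ht => by rw [← hfg x hx t ht]; exact hB (x, t) ⟨subset_closure hx, ht⟩⟩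

lemma ExtendsCont.continuousOn_time {Ω : Set V} {T : ℝ} {f : V → ℝ → ℝ}
    (h : ExtendsCont Ω T f) {x : V} (hx : x ∈ Ω) : ContinuousOn (f x) (Icc 0 T) := by
  obtain ⟨g, hg, hfg⟩ := h
  have : ContinuousOn (fun t => g x t) (Icc 0 T) :=
    hg.comp (f := fun t : ℝ => (x, t)) (by fun_prop) fun t ht => ⟨subset_closure hx, ht⟩
  exact this.congr fun t ht => (hfg x hx t ht).symm

lemma extendsCont_of_continuousOn {Ω : Set V} {T : ℝ} {f : V → ℝ → ℝ}
    (h : ContinuousOn (fun z : V × ℝ => f z.1 z.2) (closure Ω ×ˢ Icc 0 T)) : ExtendsCont Ω T f :=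
  ⟨f, h, fun _ _ _ _ => rfl⟩

/-- The time derivative of a function vanishing on the boundary vanishes on the boundary. -/
theorem time_deriv_eq_zero_of_mem_frontier {Ω : Set V} {T : ℝ} (hT : 0 < T) {u ut : V → ℝ → ℝ}
    (hd : ∀ x ∈ Ω, ∀ t ∈ Icc (0 : ℝ) T, HasDerivWithinAt (u x) (ut x t) (Icc 0 T) t)
    (hu : ContinuousOn (fun z : V × ℝ => u z.1 z.2) (closure Ω ×ˢ Icc 0 T))
    (hut : ContinuousOn (fun z : V × ℝ => ut z.1 z.2) (closure Ω ×ˢ Icc 0 T))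
    (h0 : ∀ x ∈ frontier Ω, ∀ t ∈ Icc (0 : ℝ) T, u x t = 0) :
    ∀ x ∈ frontier Ω, ∀ t ∈ Icc (0 : ℝ) T, ut x t = 0 := by
  intro x hx t ht
  have hxc : x ∈ closure Ω := frontier_subset_closure hx
  by_contra hne
  set a := ut x t with ha
  have ha0 : 0 < |a| / 2 := half_pos (abs_pos.2 hne)
  obtain ⟨δ, hδ, hδ'⟩ := Metric.continuousOn_iff.1 hut (x, t) ⟨hxc, ht⟩ (|a| / 2) ha0
  obtain ⟨s, hs, hst, hsδ⟩ : ∃ s ∈ Icc (0 : ℝ) T, s ≠ t ∧ |s - t| < δ := by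
    rcases lt_or_ge t T with h | h
    · refine ⟨min T (t + δ / 2), ⟨le_min hT.le (by linarith [ht.1]), min_le_left _ _⟩, ?_, ?_⟩
      · exact (lt_min h (by linarith)).ne'
      · rw [abs_of_pos (by linarith [lt_min h (by linarith : t < t + δ / 2)])]
        linarith [min_le_right T (t + δ / 2)]
    · have h' : t = T := le_antisymm ht.2 h
      subst h'
      refine ⟨max 0 (t - δ / 2), ⟨le_max_left _ _, max_le hT.le (by linarith)⟩, ?_, ?_⟩
      · exact (max_lt hT (by linarith)).ne
      · rw [abs_of_neg (by linarith [max_lt hT (by linarith : t - δ / 2 < t)])]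
        linarith [le_max_right 0 (t - δ / 2)]
  have hseg : uIcc t s ⊆ Icc 0 T := by
    rw [← segment_eq_uIcc]; exact (convex_Icc 0 T).segment_subset ht hs
  have hmv : ∀ y ∈ Ω, dist y x < δ → |u y s - u y t - a * (s - t)| ≤ |a| / 2 * |s - t| := by
    intro y hy hyx
    have h1 : ∀ σ ∈ uIcc t s, HasDerivWithinAt (fun σ => u y σ - a * σ) (ut y σ - a)
        (uIcc t s) σ := fun σ hσ => by
      have h := ((hd y hy σ (hseg hσ)).mono hseg).sub
        ((hasDerivWithinAt_id σ (uIcc t s)).const_mul a)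
      rw [mul_one] at h
      exact h
    have h2 : ∀ σ ∈ uIcc t s, ‖ut y σ - a‖ ≤ |a| / 2 := fun σ hσ => by
      rw [← dist_eq_norm]
      refine (hδ' (y, σ) ⟨subset_closure hy, hseg hσ⟩ ?_).le
      rw [Prod.dist_eq]
      refine max_lt hyx ?_
      rw [Real.dist_eq]
      exact (abs_sub_left_of_mem_uIcc hσ).trans_lt hsδ
    have := (convex_uIcc t s).norm_image_sub_le_of_norm_hasDerivWithin_le h1 h2
      left_mem_uIcc right_mem_uIcc
    rw [Real.norm_eq_abs, Real.norm_eq_abs] at this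
    convert this using 2
    ring
  have hcl : x ∈ closure (Ω ∩ Metric.ball x δ) := by
    rw [inter_comm]
    exact mem_closure_iff_nhds.2 fun U hU => by
      obtain ⟨z, hz⟩ := mem_closure_iff_nhds.1 hxc (U ∩ Metric.ball x δ)
        (inter_mem hU (Metric.ball_mem_nhds x hδ))
      exact ⟨z, hz.1.1, hz.1.2, hz.2⟩
  have hcs : ∀ σ ∈ Icc (0 : ℝ) T, ContinuousOn (fun y => u y σ) (closure (Ω ∩ Metric.ball x δ)) :=
    fun σ hσ => hu.comp (f := fun y : V => (y, σ)) (by fun_prop)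
      fun y hy => ⟨closure_mono inter_subset_left hy, hσ⟩
  have hmv' : ∀ y ∈ Ω ∩ Metric.ball x δ,
      |u y s - u y t - a * (s - t)| ≤ |a| / 2 * |s - t| := fun y hy => hmv y hy.1 hy.2
  have := le_on_closure hmv' (f := fun y => |u y s - u y t - a * (s - t)|)
    (g := fun _ => |a| / 2 * |s - t|)
    (((hcs s hs).sub (hcs t ht)).sub continuousOn_const).abs continuousOn_const hcl
  simp only [h0 x hx s hs, h0 x hx t ht, sub_self, zero_sub, abs_neg, abs_mul] at this
  have h3 : 0 < |s - t| := abs_pos.2 (sub_ne_zero.2 hst)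
  nlinarith [abs_pos.2 hne]

end Regularity

section Solutions

variable {n : ℕ}

local notation "V" => EuclideanSpace ℝ (Fin n)

/-- The qualitative regularity information on a solution that is used below.  The function `r` is a
defining function of the domain, and the bound `B` may depend on the solution. -/
structure RegSol (Ω : Set V) (p b T : ℝ) (u ut utt : V → ℝ → ℝ) (r : V → ℝ) (B : ℝ) : Prop where
  one_lt : 1 < p
  T_pos : 0 < T
  B_pos : 0 < B
  isOpen : IsOpen Ω
  bounded : Bornology.IsBounded Ω
  smooth_r : ContDiff ℝ (⊤ : ℕ∞) r
  mem_iff : ∀ x, x ∈ Ω ↔ 0 < r x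
  smooth_u : ∀ t ∈ Icc (0 : ℝ) T, ContDiffOn ℝ 2 (fun x => u x t) Ω
  smooth_ut : ∀ t ∈ Icc (0 : ℝ) T, ContDiffOn ℝ 2 (fun x => ut x t) Ω
  cont_utt : ∀ t ∈ Icc (0 : ℝ) T, ContinuousOn (fun x => utt x t) Ω
  pos : ∀ x ∈ Ω, ∀ t ∈ Icc (0 : ℝ) T, 0 < u x t
  cont_u : ∀ x ∈ Ω, ContinuousOn (u x) (Icc 0 T)
  cont_ut : ∀ x ∈ Ω, ContinuousOn (ut x) (Icc 0 T)
  cont_du : ∀ i, ∀ x ∈ Ω, ContinuousOn (fun t => pderiv' i (fun y => u y t) x) (Icc 0 T)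
  deriv_u : ∀ x ∈ Ω, ∀ t ∈ Ioo (0 : ℝ) T, HasDerivAt (u x) (ut x t) t
  deriv_ut : ∀ x ∈ Ω, ∀ t ∈ Ioo (0 : ℝ) T, HasDerivAt (ut x) (utt x t) t
  deriv_du : ∀ i, ∀ x ∈ Ω, ∀ t ∈ Ioo (0 : ℝ) T,
    HasDerivAt (fun s => pderiv' i (fun y => u y s) x) (pderiv' i (fun y => ut y t) x) t
  u_le_r : ∀ x ∈ Ω, ∀ t ∈ Icc (0 : ℝ) T, u x t ≤ B * r x
  r_le_u : ∀ x ∈ Ω, ∀ t ∈ Icc (0 : ℝ) T, r x ≤ B * u x t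
  abs_ut_le : ∀ x ∈ Ω, ∀ t ∈ Icc (0 : ℝ) T, |ut x t| ≤ B * u x t
  u_le : ∀ x ∈ Ω, ∀ t ∈ Icc (0 : ℝ) T, u x t ≤ B
  utt_le : ∀ x ∈ Ω, ∀ t ∈ Icc (0 : ℝ) T, |utt x t| ≤ B
  du_le : ∀ i, ∀ x ∈ Ω, ∀ t ∈ Icc (0 : ℝ) T, |pderiv' i (fun y => u y t) x| ≤ B
  dut_le : ∀ i, ∀ x ∈ Ω, ∀ t ∈ Icc (0 : ℝ) T, |pderiv' i (fun y => ut y t) x| ≤ B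
  ddu_le : ∀ i, ∀ x ∈ Ω, ∀ t ∈ Icc (0 : ℝ) T, |pderiv' i (pderiv' i fun y => u y t) x| ≤ B
  ddut_le : ∀ i, ∀ x ∈ Ω, ∀ t ∈ Icc (0 : ℝ) T, |pderiv' i (pderiv' i fun y => ut y t) x| ≤ B
  pde : ∀ x ∈ Ω, ∀ t ∈ Ioc (0 : ℝ) T,
    p * u x t ^ (p - 1) * ut x t = lap (fun y => u y t) x + b * u x t + u x t ^ p
  evol : ∀ x ∈ Ω, ∀ t ∈ Ioo (0 : ℝ) T,
    p * (u x t ^ p * utt x t - u x t ^ (p - 1) * ut x t ^ 2) =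
      u x t * lap (fun y => ut y t) x - ut x t * lap (fun y => u y t) x -
        p * (p - 1) * u x t ^ (p - 1) * ut x t ^ 2 + (p - 1) * u x t ^ p * ut x t

theorem FDSetting.exists_regSol (hn : 1 ≤ n) {Ω : Set V} {p b T c₀ : ℝ} {u ut utt : V → ℝ → ℝ}
    (h : FDSetting Ω p b T c₀ u ut utt) {r : V → ℝ} (hr : ContDiff ℝ (⊤ : ℕ∞) r)
    (hΩr : ∀ x, x ∈ Ω ↔ 0 < r x)
    (hrd : ∃ c > 0, ∀ x ∈ Ω, c * dB Ω x ≤ r x ∧ c * r x ≤ dB Ω x) :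
    ∃ B, RegSol Ω p b T u ut utt r B := by
  obtain ⟨⟨hΩo, hb, -, -⟩, hp, -, hT, hc₀, hC, hpos, hpde, hbd, hcmp⟩ := h
  obtain ⟨hu3, hut2, hdu, hdut, cu, cut, cutt, eu, euu, -, eut, euut⟩ := hC
  obtain ⟨c, hc, hrc⟩ := hrd
  have hc0 : 0 < c₀ := by linarith
  have hslice : ∀ {f : V → ℝ → ℝ}, ContinuousOn (fun z : V × ℝ => f z.1 z.2)
      (closure Ω ×ˢ Icc 0 T) → ∀ t ∈ Icc (0 : ℝ) T, ContinuousOn (fun x => f x t) (closure Ω) :=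
    fun hf t ht => hf.comp (f := fun x : V => (x, t)) (by fun_prop) fun x hx => ⟨hx, ht⟩
  have hΩu : Ω ≠ univ := ne_univ_of_isBounded hn hb
  obtain ⟨B1, hB1⟩ := (extendsCont_of_continuousOn cu).exists_bound hb
  obtain ⟨B2, hB2⟩ := (extendsCont_of_continuousOn cutt).exists_bound hb
  choose B3 hB3 using fun i => (eu i).exists_bound hb
  choose B4 hB4 using fun i => (eut i).exists_bound hb
  choose B5 hB5 using fun i => (euu i i).exists_bound hb
  choose B6 hB6 using fun i => (euut i i).exists_bound hb
  set S3 := ∑ i, |B3 i| with hS3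
  set S4 := ∑ i, |B4 i| with hS4
  set S5 := ∑ i, |B5 i| with hS5
  set S6 := ∑ i, |B6 i| with hS6
  have hsum : ∀ (f : Fin n → ℝ) (i : Fin n), f i ≤ ∑ j, |f j| := fun f i =>
    (le_abs_self _).trans (Finset.single_le_sum (f := fun j => |f j|) (fun _ _ => abs_nonneg _)
      (Finset.mem_univ i))
  have hS3' : 0 ≤ S3 := Finset.sum_nonneg fun _ _ => abs_nonneg _
  have hS4' : 0 ≤ S4 := Finset.sum_nonneg fun _ _ => abs_nonneg _
  have hS5' : 0 ≤ S5 := Finset.sum_nonneg fun _ _ => abs_nonneg _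
  have hS6' : 0 ≤ S6 := Finset.sum_nonneg fun _ _ => abs_nonneg _
  have hinc : Ioo (0 : ℝ) T ⊆ Icc 0 T := Ioo_subset_Icc_self
  have du : ∀ x ∈ Ω, ∀ t ∈ Ioo (0 : ℝ) T, HasDerivAt (u x) (ut x t) t := fun x hx t ht =>
    (hdu x hx t (hinc ht)).hasDerivAt (Icc_mem_nhds ht.1 ht.2)
  have dut : ∀ x ∈ Ω, ∀ t ∈ Ioo (0 : ℝ) T, HasDerivAt (ut x) (utt x t) t := fun x hx t ht =>
    (hdut x hx t (hinc ht)).hasDerivAt (Icc_mem_nhds ht.1 ht.2)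
  have hcu : ∀ x ∈ Ω, ContinuousOn (u x) (Icc 0 T) := fun x hx t ht =>
    (hdu x hx t ht).continuousWithinAt
  have hcut : ∀ x ∈ Ω, ContinuousOn (ut x) (Icc 0 T) := fun x hx t ht =>
    (hdut x hx t ht).continuousWithinAt
  have ddu : ∀ i, ∀ x ∈ Ω, ∀ t ∈ Ioo (0 : ℝ) T,
      HasDerivAt (fun s => pderiv' i (fun y => u y s) x) (pderiv' i (fun y => ut y t) x) t :=
    fun i x hx t ht => hasDerivAt_pderiv'_of_hasDerivAt hΩo
      (fun t ht => (hu3 t ht).differentiableOn (by simp))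
      (fun t ht => (hut2 t ht).differentiableOn (by simp)) hcu du hcut
      (fun x hx => (eut i).continuousOn_time hx) (hB4 i) hx ht
  have dddu : ∀ i, ∀ x ∈ Ω, ∀ t ∈ Ioo (0 : ℝ) T,
      HasDerivAt (fun s => pderiv' i (pderiv' i fun y => u y s) x)
        (pderiv' i (pderiv' i fun y => ut y t) x) t :=
    fun i x hx t ht => hasDerivAt_pderiv'_of_hasDerivAt hΩo
      (F := fun x t => pderiv' i (fun y => u y t) x)
      (g := fun x t => pderiv' i (fun y => ut y t) x)
      (fun t ht => ((hu3 t ht).pderiv'_of_isOpen hΩo (m := 1) (by norm_num) i).differentiableOn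
        (by simp))
      (fun t ht => ((hut2 t ht).pderiv'_of_isOpen hΩo (m := 1) (by norm_num) i).differentiableOn
        (by simp))
      (fun x hx => (eu i).continuousOn_time hx) (ddu i)
      (fun x hx => (eut i).continuousOn_time hx)
      (fun x hx => (euut i i).continuousOn_time hx) (hB6 i) hx ht
  have pde : ∀ x ∈ Ω, ∀ t ∈ Ioc (0 : ℝ) T,
      p * u x t ^ (p - 1) * ut x t = lap (fun y => u y t) x + b * u x t + u x t ^ p := by
    intro x hx t ht
    have ht' : t ∈ Icc 0 T := ⟨ht.1.le, ht.2⟩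
    have h1 := (hdu x hx t ht').rpow_const (p := p) (Or.inl (hpos x hx t ht').ne')
    have h2 := ((uniqueDiffOn_Icc hT) t ht').eq_deriv _ h1 (hpde x hx t ht)
    rw [← h2]; ring
  have evol : ∀ x ∈ Ω, ∀ t ∈ Ioo (0 : ℝ) T,
      p * (u x t ^ p * utt x t - u x t ^ (p - 1) * ut x t ^ 2) =
        u x t * lap (fun y => ut y t) x - ut x t * lap (fun y => u y t) x -
          p * (p - 1) * u x t ^ (p - 1) * ut x t ^ 2 + (p - 1) * u x t ^ p * ut x t := by
    intro x hx t ht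
    have hux := hpos x hx t (hinc ht)
    have h1 : HasDerivAt (fun s => p * u x s ^ (p - 1) * ut x s) _ t :=
      (((du x hx t ht).rpow_const (p := p - 1) (Or.inl hux.ne')).const_mul p).mul (dut x hx t ht)
    have h2 : HasDerivAt (fun s => lap (fun y => u y s) x) (lap (fun y => ut y t) x) t := by
      unfold lap
      exact HasDerivAt.fun_sum fun i _ => dddu i x hx t ht
    have h3 := (h2.add ((du x hx t ht).const_mul b)).add
      ((du x hx t ht).rpow_const (p := p) (Or.inl hux.ne'))
    have h4 : HasDerivAt (fun s => p * u x s ^ (p - 1) * ut x s) _ t :=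
      h3.congr_of_eventuallyEq (by
        filter_upwards [Ioo_mem_nhds ht.1 ht.2] with s hs using pde x hx s ⟨hs.1, hs.2.le⟩)
    have h5 := h1.unique h4
    have h6 := pde x hx t ⟨ht.1, ht.2.le⟩
    have e1 : u x t ^ (p - 1) = u x t ^ (p - 1 - 1) * u x t := by
      rw [← Real.rpow_add_one hux.ne']; ring_nf
    have e2 : u x t ^ p = u x t ^ (p - 1 - 1) * u x t ^ 2 := by
      rw [← Real.rpow_add_natCast hux.ne']; congr 1; push_cast; ring
    simp only [e1, e2] at h5 h6 ⊢
    linear_combination u x t * h5 - ut x t * h6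
  have hut0 := time_deriv_eq_zero_of_mem_frontier hT hdu cu cut hbd
  have hutd : ∀ x ∈ Ω, ∀ t ∈ Icc (0 : ℝ) T, |ut x t| ≤ n * S4 * dB Ω x := fun x hx t ht =>
    abs_le_mul_dB hΩo hΩu (hslice cut t ht) ((hut2 t ht).differentiableOn (by simp))
      (fun y hy i => (hB4 i y hy t ht).trans (hsum B4 i)) (fun y hy => hut0 y hy t ht) x hx
  set B := 1 + |B1| + |B2| + S3 + S4 + S5 + S6 + c₀ / c + n * S4 * c₀ with hB
  have p1 : 0 ≤ c₀ / c := by positivity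
  have p2 : 0 ≤ n * S4 * c₀ := by positivity
  have q1 := abs_nonneg B1
  have q2 := abs_nonneg B2
  refine ⟨B, hp, hT, by rw [hB]; linarith, hΩo, hb, hr, hΩr, fun t ht => (hu3 t ht).of_le
    (by norm_num), hut2, fun t ht => (hslice cutt t ht).mono subset_closure, hpos, hcu, hcut,
    fun i x hx => (eu i).continuousOn_time hx, du, dut, ddu, ?_, ?_, ?_, ?_, ?_, ?_, ?_, ?_, ?_,
    pde, evol⟩
  · intro x hx t ht
    have h1 := (hrc x hx).1
    have hrx := (hΩr x).1 hx
    calc u x t ≤ c₀ * dB Ω x := (hcmp x hx t ht).2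
      _ = c₀ / c * (c * dB Ω x) := by field_simp
      _ ≤ c₀ / c * r x := by gcongr
      _ ≤ B * r x := by gcongr; rw [hB]; linarith
  · intro x hx t ht
    have h1 := (hrc x hx).2
    have h2 := (hcmp x hx t ht).1
    have hux := hpos x hx t ht
    calc r x = c⁻¹ * (c * r x) := by field_simp
      _ ≤ c⁻¹ * dB Ω x := by gcongr
      _ = c₀ / c * (c₀⁻¹ * dB Ω x) := by field_simp
      _ ≤ c₀ / c * u x t := by gcongr
      _ ≤ B * u x t := by gcongr; rw [hB]; linarith
  · intro x hx t ht
    have h2 := (hcmp x hx t ht).1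
    have hux := hpos x hx t ht
    calc |ut x t| ≤ n * S4 * dB Ω x := hutd x hx t ht
      _ = n * S4 * c₀ * (c₀⁻¹ * dB Ω x) := by field_simp
      _ ≤ n * S4 * c₀ * u x t := by gcongr
      _ ≤ B * u x t := by gcongr; rw [hB]; linarith
  · exact fun x hx t ht => (le_abs_self _).trans ((hB1 x hx t ht).trans
      ((le_abs_self _).trans (by rw [hB]; linarith)))
  · exact fun x hx t ht => (hB2 x hx t ht).trans ((le_abs_self _).trans (by rw [hB]; linarith))
  · exact fun i x hx t ht => (hB3 i x hx t ht).trans ((hsum B3 i).trans (by rw [hB]; linarith))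
  · exact fun i x hx t ht => (hB4 i x hx t ht).trans ((hsum B4 i).trans (by rw [hB]; linarith))
  · exact fun i x hx t ht => (hB5 i x hx t ht).trans ((hsum B5 i).trans (by rw [hB]; linarith))
  · exact fun i x hx t ht => (hB6 i x hx t ht).trans ((hsum B6 i).trans (by rw [hB]; linarith))

end Solutions

section Moments

variable {n : ℕ}

local notation "V" => EuclideanSpace ℝ (Fin n)

lemma continuousOn_integral_of_bounded {Ω : Set V} (hΩ : IsOpen Ω) (hb : Bornology.IsBounded Ω)
    {I : Set ℝ} {F : V → ℝ → ℝ} {C : ℝ} (hx : ∀ s ∈ I, ContinuousOn (fun x => F x s) Ω)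
    (hs : ∀ x ∈ Ω, ContinuousOn (F x) I) (hC : ∀ x ∈ Ω, ∀ s ∈ I, |F x s| ≤ C) :
    ContinuousOn (fun s => ∫ x in Ω, F x s) I := by
  refine continuousOn_of_dominated (bound := fun _ => C)
    (fun s hsI => (hx s hsI).aestronglyMeasurable hΩ.measurableSet)
    (fun s hsI => (ae_restrict_iff' hΩ.measurableSet).2 (Eventually.of_forall fun x hxΩ =>
      hC x hxΩ s hsI))
    (integrableOn_const hb.measure_lt_top.ne)
    ((ae_restrict_iff' hΩ.measurableSet).2 (Eventually.of_forall fun x hxΩ => hs x hxΩ))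

lemma pderiv'_div (i : Fin n) {f g : V → ℝ} {x : V} (hf : DifferentiableAt ℝ f x)
    (hg : DifferentiableAt ℝ g x) (h0 : g x ≠ 0) :
    pderiv' i (fun y => f y / g y) x =
      (g x * pderiv' i f x - f x * pderiv' i g x) / g x ^ 2 := by
  have e : x + (0 : ℝ) • (EuclideanSpace.single i 1 : V) = x := by simp
  have h1 := hasDerivAt_line (i := i) (τ := 0) (f := fun y => f y / g y)
    (by rw [e]; simpa only [div_eq_mul_inv] using hf.fun_mul (hg.fun_inv h0))
  have h2 := hasDerivAt_line (i := i) (τ := 0) (f := f) (by rwa [e])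
  have h3 := hasDerivAt_line (i := i) (τ := 0) (f := g) (by rwa [e])
  have h4 := h1.unique (h2.fun_div h3 (by rwa [e]))
  simp only [e] at h4
  rw [h4]
  ring

variable {Ω : Set (EuclideanSpace ℝ (Fin n))} {p b T B : ℝ}
  {u ut utt : EuclideanSpace ℝ (Fin n) → ℝ → ℝ} {r : EuclideanSpace ℝ (Fin n) → ℝ}

lemma RegSol.abs_v_le (H : RegSol Ω p b T u ut utt r B) {x : V} (hx : x ∈ Ω) {t : ℝ}
    (ht : t ∈ Icc (0 : ℝ) T) : |ut x t / u x t| ≤ B := by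
  have hu := H.pos x hx t ht
  rw [abs_div, abs_of_pos hu, div_le_iff₀ hu]
  exact H.abs_ut_le x hx t ht

lemma RegSol.contDiffOn_v (H : RegSol Ω p b T u ut utt r B) {t : ℝ}
    (ht : t ∈ Icc (0 : ℝ) T) : ContDiffOn ℝ 2 (fun y => ut y t / u y t) Ω :=
  (H.smooth_ut t ht).div (H.smooth_u t ht) fun x hx => (H.pos x hx t ht).ne'

lemma RegSol.pderiv'_v (H : RegSol Ω p b T u ut utt r B) {x : V} (hx : x ∈ Ω) {t : ℝ}
    (ht : t ∈ Icc (0 : ℝ) T) (i : Fin n) : u x t ^ 2 * pderiv' i (fun y => ut y t / u y t) x =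
      u x t * pderiv' i (fun y => ut y t) x - ut x t * pderiv' i (fun y => u y t) x := by
  have hn := H.isOpen.mem_nhds hx
  have hu := (H.pos x hx t ht).ne'
  rw [pderiv'_div i (((H.smooth_ut t ht).differentiableOn (by simp)).differentiableAt hn)
    (((H.smooth_u t ht).differentiableOn (by simp)).differentiableAt hn) hu]
  field_simp

lemma RegSol.abs_flux_le (H : RegSol Ω p b T u ut utt r B) {x : V} (hx : x ∈ Ω) {t : ℝ}
    (ht : t ∈ Icc (0 : ℝ) T) (i : Fin n) :
    |u x t * pderiv' i (fun y => ut y t) x - ut x t * pderiv' i (fun y => u y t) x| ≤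
      (B + B ^ 2) * u x t := by
  have hu := H.pos x hx t ht
  have hB := H.B_pos
  refine (abs_sub _ _).trans ?_
  rw [abs_mul, abs_mul, abs_of_pos hu]
  have h1 := mul_le_mul_of_nonneg_left (H.dut_le i x hx t ht) hu.le
  have h2 := mul_le_mul (H.abs_ut_le x hx t ht) (H.du_le i x hx t ht) (abs_nonneg _) (by positivity)
  linarith

lemma RegSol.abs_mul_pderiv'_v_le (H : RegSol Ω p b T u ut utt r B) {x : V} (hx : x ∈ Ω) {t : ℝ}
    (ht : t ∈ Icc (0 : ℝ) T) (i : Fin n) :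
    |u x t * pderiv' i (fun y => ut y t / u y t) x| ≤ B + B ^ 2 := by
  have hu := H.pos x hx t ht
  have h1 := H.abs_flux_le hx ht i
  rw [← H.pderiv'_v hx ht i, pow_two, mul_assoc, abs_mul, abs_of_pos hu, mul_comm _ (u x t)] at h1
  exact le_of_mul_le_mul_left h1 hu

/-- The time derivative of the weighted integral of a function of `φ(t) - ∂ₜu / u`. -/
theorem RegSol.hasDerivAt_moment (H : RegSol Ω p b T u ut utt r B) {φ φ1 : ℝ → ℝ} {t1 t Bφ : ℝ}
    (ht1 : 0 ≤ t1) (ht : t ∈ Ioo t1 T) (hφ : ∀ s ∈ Ioo t1 T, HasDerivAt φ (φ1 s) s)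
    (hφb : ∀ s ∈ Ioo t1 T, |φ1 s| ≤ Bφ) {f f1 f2 : ℝ → ℝ} {S k : Set ℝ} (hS : IsOpen S)
    (hk : IsCompact k) (hkS : k ⊆ S) (hf : ∀ w ∈ S, HasDerivAt f (f1 w) w)
    (hf1 : ∀ w ∈ S, HasDerivAt f1 (f2 w) w) (hf2 : ContinuousOn f2 S)
    (hW : ∀ x ∈ Ω, ∀ s ∈ Ioo t1 T, φ s - ut x s / u x s ∈ k) :
    HasDerivAt (fun s => ∫ x in Ω, u x s ^ (p + 1) * f (φ s - ut x s / u x s))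
      ((∫ x in Ω, u x t ^ (p + 1) * (f1 (φ t - ut x t / u x t) *
          (φ1 t + (p - 1) * (ut x t / u x t) ^ 2 - (p - 1) / p * (ut x t / u x t)) +
          (p + 1) * (ut x t / u x t) * f (φ t - ut x t / u x t))) -
        1 / p * ∫ x in Ω, f2 (φ t - ut x t / u x t) *
          (u x t ^ 2 * ∑ i, pderiv' i (fun y => ut y t / u y t) x ^ 2)) t := by
  have hp := H.one_lt
  have hp0 : p ≠ 0 := by linarith
  have hB := H.B_pos
  have hΩo := H.isOpen
  have hb := H.bounded
  have hI : ∀ {s}, s ∈ Ioo t1 T → s ∈ Ioo 0 T := fun hs => ⟨ht1.trans_lt hs.1, hs.2⟩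
  have hI' : ∀ {s}, s ∈ Ioo t1 T → s ∈ Icc 0 T := fun hs => Ioo_subset_Icc_self (hI hs)
  have hfc : ContinuousOn f S := fun w hw => (hf w hw).continuousAt.continuousWithinAt
  have hf1c : ContinuousOn f1 S := fun w hw => (hf1 w hw).continuousAt.continuousWithinAt
  obtain ⟨C0, hC0⟩ := hk.exists_bound_of_continuousOn (hfc.mono hkS)
  obtain ⟨C1, hC1⟩ := hk.exists_bound_of_continuousOn (hf1c.mono hkS)
  obtain ⟨C2, hC2⟩ := hk.exists_bound_of_continuousOn (hf2.mono hkS)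
  simp only [Real.norm_eq_abs] at hC0 hC1 hC2
  have upow : ∀ {x s} (_ : x ∈ Ω) (_ : s ∈ Ioo t1 T) (a : ℝ), 0 ≤ a → |u x s ^ a| ≤ B ^ a :=
    fun {x s} hx hs a ha => by
      have hu := H.pos x hx s (hI' hs)
      rw [abs_of_nonneg (Real.rpow_nonneg hu.le _)]
      exact Real.rpow_le_rpow hu.le (H.u_le x hx s (hI' hs)) ha
  have absut : ∀ {x s} (_ : x ∈ Ω) (_ : s ∈ Ioo t1 T), |ut x s| ≤ B ^ 2 := fun {x s} hx hs => by
    have hu := H.pos x hx s (hI' hs)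
    calc |ut x s| ≤ B * u x s := H.abs_ut_le x hx s (hI' hs)
      _ ≤ B * B := by gcongr; exact H.u_le x hx s (hI' hs)
      _ = B ^ 2 := by ring
  set G : V → ℝ → ℝ := fun x s => (p + 1) * (u x s ^ p * ut x s) * f (φ s - ut x s / u x s) +
    f1 (φ s - ut x s / u x s) * (u x s ^ (p + 1) * φ1 s -
      (u x s ^ p * utt x s - u x s ^ (p - 1) * ut x s ^ 2)) with hG
  have hGd : ∀ x ∈ Ω, ∀ s ∈ Ioo t1 T,
      HasDerivAt (fun s => u x s ^ (p + 1) * f (φ s - ut x s / u x s)) (G x s) s := by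
    intro x hx s hs
    have hu := H.pos x hx s (hI' hs)
    have d1 := (H.deriv_u x hx s (hI hs)).rpow_const (p := p + 1) (Or.inl hu.ne')
    have d2 := (H.deriv_ut x hx s (hI hs)).fun_div (H.deriv_u x hx s (hI hs)) hu.ne'
    have d3 := (hf _ (hkS (hW x hx s hs))).comp s ((hφ s hs).fun_sub d2)
    have d4 := d1.fun_mul d3
    refine d4.congr_deriv ?_
    have e1 : u x s ^ p = u x s ^ (p - 1) * u x s := by
      rw [← Real.rpow_add_one hu.ne']; ring_nf
    have e2 : u x s ^ (p + 1) = u x s ^ (p - 1) * u x s ^ 2 := by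
      rw [← Real.rpow_add_natCast hu.ne']; congr 1; push_cast; ring
    rw [hG]
    simp only [Function.comp_apply, add_sub_cancel_right, e1, e2]
    field_simp
  have hCt : ∀ s ∈ Ioo t1 T, ContinuousOn (fun x => u x s) Ω ∧ ContinuousOn (fun x => ut x s) Ω ∧
      ContinuousOn (fun x => ut x s / u x s) Ω := fun s hs =>
    ⟨(H.smooth_u s (hI' hs)).continuousOn, (H.smooth_ut s (hI' hs)).continuousOn,
      (H.contDiffOn_v (hI' hs)).continuousOn⟩
  have hWc : ∀ s ∈ Ioo t1 T, ContinuousOn (fun x => φ s - ut x s / u x s) Ω := fun s hs =>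
    continuousOn_const.sub (hCt s hs).2.2
  have hcomp : ∀ {g : ℝ → ℝ}, ContinuousOn g S → ∀ s ∈ Ioo t1 T,
      ContinuousOn (fun x => g (φ s - ut x s / u x s)) Ω := fun hg s hs =>
    hg.comp (hWc s hs) fun x hx => hkS (hW x hx s hs)
  have hrp : ∀ (a : ℝ), ∀ s ∈ Ioo t1 T, ContinuousOn (fun x => u x s ^ a) Ω := fun a s hs =>
    (hCt s hs).1.rpow_const fun x hx => Or.inl (H.pos x hx s (hI' hs)).ne'
  have hGb : ∀ x ∈ Ω, ∀ s ∈ Ioo t1 T, |G x s| ≤ (p + 1) * (B ^ p * B ^ 2) * C0 +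
      C1 * (B ^ (p + 1) * Bφ + (B ^ p * B + B ^ (p - 1) * (B ^ 2) ^ 2)) := by
    intro x hx s hs
    have hw := hW x hx s hs
    rw [hG]
    simp only
    refine (abs_add_le _ _).trans ?_
    rw [abs_mul, abs_mul, abs_mul, abs_mul, abs_of_pos (by linarith : 0 < p + 1)]
    have a1 := upow hx hs p (by linarith)
    have a2 := upow hx hs (p + 1) (by linarith)
    have a3 := upow hx hs (p - 1) (by linarith)
    have a4 := absut hx hs
    have c0 := (abs_nonneg _).trans (hC0 _ hw)
    have c1 := (abs_nonneg _).trans (hC1 _ hw)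
    refine add_le_add ?_ ?_
    · gcongr
      exact hC0 _ hw
    · gcongr
      · exact hC1 _ hw
      · refine (abs_sub _ _).trans (add_le_add ?_ ((abs_sub _ _).trans (add_le_add ?_ ?_)))
        · rw [abs_mul]; gcongr; exact hφb s hs
        · rw [abs_mul]; gcongr; exact H.utt_le x hx s (hI' hs)
        · rw [abs_mul, abs_pow]; gcongr
  have hdom := (hasDerivAt_integral_of_dominated_loc_of_deriv_le
    (μ := volume.restrict Ω) (F := fun s x => u x s ^ (p + 1) * f (φ s - ut x s / u x s))
    (F' := fun s x => G x s) (x₀ := t) (s := Ioo t1 T)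
    (bound := fun _ => (p + 1) * (B ^ p * B ^ 2) * C0 +
      C1 * (B ^ (p + 1) * Bφ + (B ^ p * B + B ^ (p - 1) * (B ^ 2) ^ 2)))
    (Ioo_mem_nhds ht.1 ht.2)
    (by
      filter_upwards [Ioo_mem_nhds ht.1 ht.2] with s hs
      exact ((hrp _ s hs).mul (hcomp hfc s hs)).aestronglyMeasurable hΩo.measurableSet)
    (integrableOn_of_continuousOn_of_bounded (B := B ^ (p + 1) * C0) hΩo hb
      ((hrp _ t ht).mul (hcomp hfc t ht)) fun x hx => by
        rw [abs_mul]
        exact mul_le_mul (upow hx ht _ (by linarith)) (hC0 _ (hW x hx t ht)) (abs_nonneg _)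
          (by positivity))
    (by
      refine ContinuousOn.aestronglyMeasurable ?_ hΩo.measurableSet
      exact (((continuousOn_const.mul ((hrp p t ht).mul (hCt t ht).2.1)).mul (hcomp hfc t ht)).add
        ((hcomp hf1c t ht).mul (((hrp _ t ht).mul continuousOn_const).sub
          (((hrp p t ht).mul (H.cont_utt t (hI' ht))).sub
            ((hrp _ t ht).mul ((hCt t ht).2.1.pow 2)))))))
    ((ae_restrict_iff' hΩo.measurableSet).2 (Eventually.of_forall fun x hx s hs => hGb x hx s hs))
    (integrableOn_const hb.measure_lt_top.ne)
    ((ae_restrict_iff' hΩo.measurableSet).2 (Eventually.of_forall fun x hx s hs =>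
      hGd x hx s hs))).2
  refine hdom.congr_deriv ?_
  have ht' := hI' ht
  set v : V → ℝ := fun y => ut y t / u y t with hv
  set X : Fin n → V → ℝ := fun i x => f1 (φ t - v x) *
    (u x t * pderiv' i (fun y => ut y t) x - ut x t * pderiv' i (fun y => u y t) x) with hX
  have du1 : ∀ i, ContDiffOn ℝ 1 (fun x => pderiv' i (fun y => u y t) x) Ω := fun i =>
    (H.smooth_u t ht').pderiv'_of_isOpen hΩo (by norm_num) i
  have dut1 : ∀ i, ContDiffOn ℝ 1 (fun x => pderiv' i (fun y => ut y t) x) Ω := fun i =>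
    (H.smooth_ut t ht').pderiv'_of_isOpen hΩo (by norm_num) i
  have hf1s : ContDiffOn ℝ 1 f1 S := by
    rw [show (1 : WithTop ℕ∞) = 0 + 1 from rfl, contDiffOn_succ_iff_deriv_of_isOpen hS]
    refine ⟨fun w hw => (hf1 w hw).differentiableAt.differentiableWithinAt, by simp, ?_⟩
    rw [contDiffOn_zero]
    exact hf2.congr fun w hw => (hf1 w hw).deriv
  have hv1 : ContDiffOn ℝ 1 v Ω := (H.contDiffOn_v ht').of_le (by norm_num)
  have hu1 : ContDiffOn ℝ 1 (fun x => u x t) Ω := (H.smooth_u t ht').of_le (by norm_num)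
  have hut1 : ContDiffOn ℝ 1 (fun x => ut x t) Ω := (H.smooth_ut t ht').of_le (by norm_num)
  have hXs : ∀ i, ContDiffOn ℝ 1 (X i) Ω := fun i =>
    (hf1s.comp (contDiffOn_const.sub hv1) fun x hx => hkS (hW x hx t ht)).mul
      ((hu1.mul (dut1 i)).sub (hut1.mul (du1 i)))
  have hC1' : ∀ x ∈ Ω, |f1 (φ t - v x)| ≤ C1 := fun x hx => hC1 _ (hW x hx t ht)
  have hXb : ∀ i, ∀ x ∈ Ω, |X i x| ≤ (|C1| * ((B + B ^ 2) * B)) * r x := by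
    intro i x hx
    rw [hX]
    simp only
    rw [abs_mul]
    calc _ ≤ |C1| * ((B + B ^ 2) * u x t) := by
          exact mul_le_mul ((hC1' x hx).trans (le_abs_self _)) (H.abs_flux_le hx ht' i)
            (abs_nonneg _) (abs_nonneg _)
      _ ≤ |C1| * ((B + B ^ 2) * (B * r x)) := by gcongr; exact H.u_le_r x hx t ht'
      _ = _ := by ring
  have hdiv : ∀ x ∈ Ω, ∑ i, pderiv' i (X i) x =
      f1 (φ t - v x) * (u x t * lap (fun y => ut y t) x - ut x t * lap (fun y => u y t) x) -
        f2 (φ t - v x) * (u x t ^ 2 * ∑ i, pderiv' i v x ^ 2) := by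
    intro x hx
    have hn := hΩo.mem_nhds hx
    have dv := (hv1.differentiableOn (by simp)).differentiableAt hn
    have du := (hu1.differentiableOn (by simp)).differentiableAt hn
    have dut := (hut1.differentiableOn (by simp)).differentiableAt hn
    have d1 := fun i => ((du1 i).differentiableOn (by simp)).differentiableAt hn
    have d2 := fun i => ((dut1 i).differentiableOn (by simp)).differentiableAt hn
    have hw := hkS (hW x hx t ht)
    have e : ∀ i, pderiv' i (X i) x = f1 (φ t - v x) * (u x t * pderiv' i (pderiv' i fun y => ut y t) x
        - ut x t * pderiv' i (pderiv' i fun y => u y t) x) -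
        f2 (φ t - v x) * (u x t ^ 2 * pderiv' i v x ^ 2) := by
      intro i
      have dW : DifferentiableAt ℝ (fun y => φ t - v y) x := dv.const_sub _
      have c1 : pderiv' i (fun y => f1 (φ t - v y)) x = f2 (φ t - v x) * -pderiv' i v x := by
        rw [pderiv'_comp i (f := fun y => φ t - v y) (hf1 _ hw) dW,
          pderiv'_sub i (f := fun _ => φ t) (g := v) (differentiableAt_const _) dv, pderiv'_const]
        ring
      have c2 : pderiv' i (fun y => u y t * pderiv' i (fun y => ut y t) y
          - ut y t * pderiv' i (fun y => u y t) y) x =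
          u x t * pderiv' i (pderiv' i fun y => ut y t) x
          - ut x t * pderiv' i (pderiv' i fun y => u y t) x := by
        rw [pderiv'_sub i (f := fun y => u y t * pderiv' i (fun y => ut y t) y)
          (g := fun y => ut y t * pderiv' i (fun y => u y t) y) (du.mul (d2 i)) (dut.mul (d1 i)),
          pderiv'_mul i du (d2 i), pderiv'_mul i dut (d1 i)]
        ring
      have c3 := H.pderiv'_v hx ht' i
      rw [hX]
      simp only
      rw [pderiv'_mul i (f := fun y => f1 (φ t - v y)) (g := fun y =>
        u y t * pderiv' i (fun y => ut y t) y - ut y t * pderiv' i (fun y => u y t) y)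
        ((hf1 _ hw).differentiableAt.comp x dW) ((du.mul (d2 i)).sub (dut.mul (d1 i))), c1, c2,
        ← c3]
      ring
    rw [Finset.sum_congr rfl fun i _ => e i]
    simp only [lap, Finset.mul_sum, ← Finset.sum_sub_distrib]
  have hgrad : ∀ x ∈ Ω, |u x t ^ 2 * ∑ i, pderiv' i v x ^ 2| ≤ n * (B + B ^ 2) ^ 2 := by
    intro x hx
    rw [Finset.mul_sum]
    refine (Finset.abs_sum_le_sum_abs _ _).trans
      ((Finset.sum_le_sum (g := fun _ => (B + B ^ 2) ^ 2) fun i _ => ?_).trans (by simp))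
    rw [← mul_pow, abs_pow]
    exact pow_le_pow_left₀ (abs_nonneg _) (H.abs_mul_pderiv'_v_le hx ht' i) 2
  have hdv : ∀ i, ContinuousOn (pderiv' i v) Ω := fun i =>
    (hv1.pderiv'_of_isOpen hΩo (m := 0) (by simp) i).continuousOn
  have int2 : IntegrableOn (fun x => f2 (φ t - v x) * (u x t ^ 2 * ∑ i, pderiv' i v x ^ 2)) Ω := by
    refine integrableOn_of_continuousOn_of_bounded (B := C2 * (n * (B + B ^ 2) ^ 2)) hΩo hb
      ((hcomp hf2 t ht).mul (((hCt t ht).1.pow 2).mul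
        (continuousOn_finsetSum _ fun i _ => (hdv i).pow 2))) fun x hx => ?_
    rw [abs_mul]
    have := hC2 _ (hW x hx t ht)
    exact mul_le_mul this (hgrad x hx) (abs_nonneg _) ((abs_nonneg _).trans this)
  have hlapb : ∀ x ∈ Ω, |u x t * lap (fun y => ut y t) x - ut x t * lap (fun y => u y t) x| ≤
      B * (n * B) + B ^ 2 * (n * B) := by
    intro x hx
    have l1 : |lap (fun y => ut y t) x| ≤ n * B :=
      (Finset.abs_sum_le_sum_abs _ _).trans
        ((Finset.sum_le_sum fun i _ => H.ddut_le i x hx t ht').trans (by simp))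
    have l2 : |lap (fun y => u y t) x| ≤ n * B :=
      (Finset.abs_sum_le_sum_abs _ _).trans
        ((Finset.sum_le_sum fun i _ => H.ddu_le i x hx t ht').trans (by simp))
    refine (abs_sub _ _).trans (add_le_add ?_ ?_)
    · rw [abs_mul, abs_of_pos (H.pos x hx t ht')]
      exact mul_le_mul (H.u_le x hx t ht') l1 (abs_nonneg _) hB.le
    · rw [abs_mul]
      exact mul_le_mul (absut hx ht) l2 (abs_nonneg _) (by positivity)
  have hXint : IntegrableOn (fun x => ∑ i, pderiv' i (X i) x) Ω := by
    refine integrableOn_of_continuousOn_of_bounded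
      (B := C1 * (B * (n * B) + B ^ 2 * (n * B)) + C2 * (n * (B + B ^ 2) ^ 2)) hΩo hb
      (continuousOn_finsetSum _ fun i _ =>
        ((hXs i).pderiv'_of_isOpen hΩo (m := 0) (by simp) i).continuousOn) fun x hx => ?_
    rw [hdiv x hx]
    refine (abs_sub _ _).trans (add_le_add ?_ ?_)
    · rw [abs_mul]
      have := hC1' x hx
      exact mul_le_mul this (hlapb x hx) (abs_nonneg _) ((abs_nonneg _).trans this)
    · rw [abs_mul]
      have := hC2 _ (hW x hx t ht)
      exact mul_le_mul this (hgrad x hx) (abs_nonneg _) ((abs_nonneg _).trans this)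
  have hzero := integral_div_eq_zero hb H.smooth_r H.mem_iff hXs hXb hXint
  have hGe : ∀ x ∈ Ω, G x t = u x t ^ (p + 1) * (f1 (φ t - v x) *
          (φ1 t + (p - 1) * v x ^ 2 - (p - 1) / p * v x) +
          (p + 1) * v x * f (φ t - v x)) -
        1 / p * (f2 (φ t - v x) * (u x t ^ 2 * ∑ i, pderiv' i v x ^ 2)) -
        1 / p * ∑ i, pderiv' i (X i) x := by
    intro x hx
    have hu := H.pos x hx t ht'
    have hev := H.evol x hx t (hI ht)
    have hut : ut x t = v x * u x t := by rw [hv]; field_simp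
    have e1 : u x t ^ p = u x t ^ (p - 1) * u x t := by
      rw [← Real.rpow_add_one hu.ne']; ring_nf
    have e2 : u x t ^ (p + 1) = u x t ^ (p - 1) * u x t ^ 2 := by
      rw [← Real.rpow_add_natCast hu.ne']; congr 1; push_cast; ring
    rw [hdiv x hx, hG]
    simp only
    have hev2 : u x t * lap (fun y => ut y t) x - ut x t * lap (fun y => u y t) x =
        p * (u x t ^ p * utt x t - u x t ^ (p - 1) * ut x t ^ 2) +
        p * (p - 1) * u x t ^ (p - 1) * ut x t ^ 2 - (p - 1) * u x t ^ p * ut x t := by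
      linarith
    rw [hev2, show ut x t / u x t = v x from rfl, e2, e1, hut]
    field_simp
    ring
  have int3 : IntegrableOn (fun x => u x t ^ (p + 1) * (f1 (φ t - v x) *
          (φ1 t + (p - 1) * v x ^ 2 - (p - 1) / p * v x) +
          (p + 1) * v x * f (φ t - v x))) Ω := by
    refine integrableOn_of_continuousOn_of_bounded
      (B := B ^ (p + 1) * (C1 * (Bφ + (p - 1) * B ^ 2 + (p - 1) / p * B) + (p + 1) * B * C0))
      hΩo hb ((hrp _ t ht).mul (((hcomp hf1c t ht).mul ((continuousOn_const.add
        (continuousOn_const.mul ((hCt t ht).2.2.pow 2))).sub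
        (continuousOn_const.mul (hCt t ht).2.2))).add
        ((continuousOn_const.mul (hCt t ht).2.2).mul (hcomp hfc t ht)))) fun x hx => ?_
    have hvb : |v x| ≤ B := H.abs_v_le hx ht'
    have c0 := (abs_nonneg _).trans (hC0 _ (hW x hx t ht))
    have c1 := (abs_nonneg _).trans (hC1' x hx)
    have hp1 : 0 ≤ p - 1 := by linarith
    have hpp : 0 ≤ (p - 1) / p := div_nonneg hp1 (by linarith)
    rw [abs_mul]
    gcongr
    · exact upow hx ht _ (by linarith)
    · refine (abs_add_le _ _).trans (add_le_add ?_ ?_)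
      · rw [abs_mul]
        gcongr
        · exact hC1' x hx
        · refine (abs_sub _ _).trans
            (add_le_add ((abs_add_le _ _).trans (add_le_add (hφb t ht) ?_)) ?_)
          · rw [abs_mul, abs_of_nonneg hp1, abs_pow]; gcongr
          · rw [abs_mul, abs_of_nonneg hpp]; gcongr
      · rw [abs_mul, abs_mul, abs_of_pos (by linarith : 0 < p + 1)]
        gcongr
        exact hC0 _ (hW x hx t ht)
  have int4 := int3.sub (int2.const_mul (1 / p))
  rw [Pi.sub_def] at int4
  rw [setIntegral_congr_fun hΩo.measurableSet hGe, integral_sub int4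
    (hXint.const_mul _), integral_sub int3 (int2.const_mul _), integral_const_mul,
    integral_const_mul, hzero]
  ring

end Moments

section OrdinaryDifferentialInequalities

lemma antitoneOn_Icc_of_hasDerivAt_nonpos {y y' : ℝ → ℝ} {a c : ℝ} (hy : ContinuousOn y (Icc a c))
    (hd : ∀ t ∈ Ioo a c, HasDerivAt y (y' t) t) (hle : ∀ t ∈ Ioo a c, y' t ≤ 0) :
    AntitoneOn y (Icc a c) := by
  refine antitoneOn_of_deriv_nonpos (convex_Icc a c) hy ?_ ?_
  · rw [interior_Icc]
    exact fun t ht => (hd t ht).differentiableAt.differentiableWithinAt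
  · rw [interior_Icc]
    exact fun t ht => by rw [(hd t ht).deriv]; exact hle t ht

lemma hasDerivAt_integral_of_continuousOn_Icc {g : ℝ → ℝ} {a c : ℝ} (hg : ContinuousOn g (Icc a c))
    {t : ℝ} (ht : t ∈ Ioo a c) : HasDerivAt (fun s => ∫ σ in a..s, g σ) (g t) t :=
  intervalIntegral.integral_hasDerivAt_right
    ((hg.mono (Icc_subset_Icc_right ht.2.le)).intervalIntegrable_of_Icc ht.1.le)
    ((hg.mono Ioo_subset_Icc_self).stronglyMeasurableAtFilter isOpen_Ioo t ht)
    (hg.continuousAt (Icc_mem_nhds ht.1 ht.2))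

lemma continuousOn_integral_of_continuousOn_Icc {g : ℝ → ℝ} {a c : ℝ} (hac : a ≤ c)
    (hg : ContinuousOn g (Icc a c)) : ContinuousOn (fun s => ∫ σ in a..s, g σ) (Icc a c) := by
  have := intervalIntegral.continuousOn_primitive_interval' (f := g) (μ := volume) (a := a)
    (b₁ := a) (b₂ := c) (hg.intervalIntegrable_of_Icc hac) left_mem_uIcc
  rwa [uIcc_of_le hac] at this

/-- Grönwall's inequality with a continuous coefficient. -/
theorem le_mul_exp_integral {y y' g : ℝ → ℝ} {a c : ℝ} (hac : a ≤ c)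
    (hy : ContinuousOn y (Icc a c)) (hg : ContinuousOn g (Icc a c))
    (hd : ∀ t ∈ Ioo a c, HasDerivAt y (y' t) t) (hle : ∀ t ∈ Ioo a c, y' t ≤ g t * y t) :
    y c ≤ y a * exp (∫ t in a..c, g t) := by
  have hGc := continuousOn_integral_of_continuousOn_Icc hac hg
  have hanti := antitoneOn_Icc_of_hasDerivAt_nonpos
    (y := fun t => y t * exp (-∫ s in a..t, g s)) (hy.mul hGc.neg.rexp)
    (fun t ht => (hd t ht).mul (hasDerivAt_integral_of_continuousOn_Icc hg ht).fun_neg.exp)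
    (fun t ht => by
      have := mul_nonneg (sub_nonneg.2 (hle t ht)) (exp_pos (-∫ s in a..t, g s)).le
      linarith)
  have h := hanti (left_mem_Icc.2 hac) (right_mem_Icc.2 hac) hac
  simp only [intervalIntegral.integral_same, neg_zero, exp_zero, mul_one] at h
  rwa [exp_neg, ← div_eq_mul_inv, div_le_iff₀ (exp_pos _)] at h

lemma exists_le_div_of_integral_le {f : ℝ → ℝ} {a c S : ℝ} (hac : a < c)
    (hf : ContinuousOn f (Icc a c)) (hS : ∫ t in a..c, f t ≤ S) :
    ∃ t ∈ Icc a c, f t ≤ S / (c - a) := by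
  obtain ⟨t, ht, hmin⟩ := isCompact_Icc.exists_isMinOn (nonempty_Icc.2 hac.le) hf
  refine ⟨t, ht, ?_⟩
  rw [le_div_iff₀ (sub_pos.2 hac)]
  refine le_trans ?_ hS
  have := intervalIntegral.integral_mono_on (f := fun _ => f t) hac.le
    (intervalIntegrable_const (μ := volume))
    (hf.intervalIntegrable_of_Icc hac.le) fun s hs => hmin hs
  simpa [mul_comm] using this

/-- A smoothing estimate for differential inequalities `y' ≤ - z + g y`. -/
theorem bound_of_deriv_le {y y' z g : ℝ → ℝ} {a c T s S G : ℝ} (hac : a < c) (hcT : c ≤ T)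
    (hs : 0 < s) (hy : ContinuousOn y (Icc a T)) (hz : ContinuousOn z (Icc a T))
    (hg : ContinuousOn g (Icc a T)) (hy0 : ∀ t ∈ Icc a T, 0 ≤ y t) (hz0 : ∀ t ∈ Icc a T, 0 ≤ z t)
    (hg0 : ∀ t ∈ Icc a T, 0 ≤ g t) (hd : ∀ t ∈ Ioo a T, HasDerivAt y (y' t) t)
    (hle : ∀ t ∈ Ioo a T, y' t ≤ -z t + g t * y t) (hS : ∫ t in a..c, y t ^ s ≤ S)
    (hG : ∫ t in a..T, g t ≤ G) :
    (∀ t ∈ Icc c T, y t ≤ (S / (c - a)) ^ (1 / s) * exp G) ∧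
      ∫ t in c..T, z t ≤ (S / (c - a)) ^ (1 / s) * exp G * (1 + G) := by
  obtain ⟨t0, ht0, hyt0⟩ := exists_le_div_of_integral_le hac
    ((hy.mono (Icc_subset_Icc_right hcT)).rpow_const fun t _ => Or.inr hs.le) hS
  have ht0T : t0 ∈ Icc a T := ⟨ht0.1, ht0.2.trans hcT⟩
  have hy0t0 := hy0 t0 ht0T
  have h1 : y t0 ≤ (S / (c - a)) ^ (1 / s) := by
    have := Real.rpow_le_rpow (Real.rpow_nonneg hy0t0 s) hyt0 (by positivity : 0 ≤ 1 / s)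
    rwa [← Real.rpow_mul hy0t0, mul_one_div_cancel hs.ne', Real.rpow_one] at this
  have hii : ∀ {f : ℝ → ℝ}, ContinuousOn f (Icc a T) → ∀ {α β}, a ≤ α → α ≤ β → β ≤ T →
      IntervalIntegrable f volume α β := fun {f} hf {α β} h1 h2 h3 =>
    (hf.mono (Icc_subset_Icc h1 h3)).intervalIntegrable_of_Icc h2
  have hGle : ∀ {α β}, a ≤ α → α ≤ β → β ≤ T → ∫ t in α..β, g t ≤ G := by
    intro α β h1 h2 h3
    refine le_trans ?_ hG
    refine intervalIntegral.integral_mono_interval h1 h2 h3 ?_ (hii hg le_rfl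
      (h1.trans (h2.trans h3)) le_rfl)
    exact (ae_restrict_iff' measurableSet_Ioc).2 (Eventually.of_forall fun t ht =>
      hg0 t ⟨ht.1.le, ht.2⟩)
  have hY : ∀ t ∈ Icc c T, y t ≤ (S / (c - a)) ^ (1 / s) * exp G := by
    intro t ht
    have h0t : t0 ≤ t := ht0.2.trans ht.1
    have hsub : Icc t0 t ⊆ Icc a T := Icc_subset_Icc ht0.1 ht.2
    have hsub' : Ioo t0 t ⊆ Ioo a T := Ioo_subset_Ioo ht0.1 ht.2
    refine (le_mul_exp_integral h0t (hy.mono hsub) (hg.mono hsub) (fun t ht => hd t (hsub' ht))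
      fun t ht => (hle t (hsub' ht)).trans ?_).trans ?_
    · linarith [hz0 t (Ioo_subset_Icc_self (hsub' ht))]
    · have := hGle ht0.1 h0t ht.2
      have := hy0t0.trans h1
      gcongr
  refine ⟨hY, ?_⟩
  set Y := (S / (c - a)) ^ (1 / s) * exp G with hYd
  have hsub : Icc c T ⊆ Icc a T := Icc_subset_Icc_left hac.le
  have hsub' : Ioo c T ⊆ Ioo a T := Ioo_subset_Ioo_left hac.le
  have hcc : c ∈ Icc c T := left_mem_Icc.2 hcT
  have hgy : ContinuousOn (fun t => g t * y t) (Icc c T) := (hg.mul hy).mono hsub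
  have hanti := antitoneOn_Icc_of_hasDerivAt_nonpos
    (y := fun t => y t + (∫ σ in c..t, z σ) - ∫ σ in c..t, g σ * y σ)
    (((hy.mono hsub).add (continuousOn_integral_of_continuousOn_Icc hcT (hz.mono hsub))).sub
      (continuousOn_integral_of_continuousOn_Icc hcT hgy))
    (fun t ht => ((hd t (hsub' ht)).add (hasDerivAt_integral_of_continuousOn_Icc
      (hz.mono hsub) ht)).sub (hasDerivAt_integral_of_continuousOn_Icc hgy ht))
    (fun t ht => by linarith [hle t (hsub' ht)])
  have h := hanti hcc (right_mem_Icc.2 hcT) hcT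
  simp only [intervalIntegral.integral_same, add_zero, sub_zero] at h
  have h2 : ∫ σ in c..T, g σ * y σ ≤ ∫ σ in c..T, g σ * Y :=
    intervalIntegral.integral_mono_on hcT (hgy.intervalIntegrable_of_Icc hcT)
      ((hii hg hac.le hcT le_rfl).mul_const Y)
      fun t ht => mul_le_mul_of_nonneg_left (hY t ht) (hg0 t (hsub ht))
  rw [intervalIntegral.integral_mul_const] at h2
  have hY0 : 0 ≤ Y := (hy0 c (hsub hcc)).trans (hY c hcc)
  have h3 := mul_le_mul_of_nonneg_right (hGle hac.le hcT le_rfl) hY0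
  linarith [hY c hcc, hy0 T ⟨hac.le.trans hcT, le_rfl⟩]

end OrdinaryDifferentialInequalities

section Estimates

variable {n : ℕ}

local notation "V" => EuclideanSpace ℝ (Fin n)

lemma hasDerivAt_mul_abs_self (w : ℝ) : HasDerivAt (fun w : ℝ => w * |w|) (2 * |w|) w := by
  rcases lt_trichotomy w 0 with h | h | h
  · refine (((hasDerivAt_id w).fun_mul (hasDerivAt_abs_neg h))).congr_deriv ?_
    rw [abs_of_neg h]; simp; ring
  · subst h
    rw [hasDerivAt_iff_tendsto_slope]
    have : slope (fun w : ℝ => w * |w|) 0 =ᶠ[𝓝[≠] 0] fun w => |w| := by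
      filter_upwards [self_mem_nhdsWithin] with w hw
      rw [slope_def_field]
      simp only [mem_compl_iff, mem_singleton_iff] at hw
      simp only [zero_mul, sub_zero]
      field_simp
    refine Tendsto.congr' this.symm ?_
    have h := (continuous_abs (G := ℝ)).tendsto 0
    simp only [abs_zero, mul_zero] at h ⊢
    exact h.mono_left nhdsWithin_le_nhds
  · refine (((hasDerivAt_id w).fun_mul (hasDerivAt_abs_pos h))).congr_deriv ?_
    rw [abs_of_pos h]; simp; ring

variable {Ω : Set (EuclideanSpace ℝ (Fin n))} {p b T B : ℝ}
  {u ut utt : EuclideanSpace ℝ (Fin n) → ℝ → ℝ} {r : EuclideanSpace ℝ (Fin n) → ℝ}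

lemma RegSol.continuousOn_moment (H : RegSol Ω p b T u ut utt r B) {φ : ℝ → ℝ} {I : Set ℝ}
    (hI : I ⊆ Icc 0 T) (hφ : ContinuousOn φ I) {f : ℝ → ℝ} {k : Set ℝ} (hk : IsCompact k)
    (hf : ContinuousOn f k) (hW : ∀ x ∈ Ω, ∀ s ∈ I, φ s - ut x s / u x s ∈ k) :
    ContinuousOn (fun s => ∫ x in Ω, u x s ^ (p + 1) * f (φ s - ut x s / u x s)) I := by
  have hp := H.one_lt
  obtain ⟨C, hC⟩ := hk.exists_bound_of_continuousOn hf
  refine continuousOn_integral_of_bounded H.isOpen H.bounded (C := B ^ (p + 1) * C)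
    (fun s hs => ?_) (fun x hx => ?_) (fun x hx s hs => ?_)
  · refine ((H.smooth_u s (hI hs)).continuousOn.rpow_const fun x hx =>
      Or.inl (H.pos x hx s (hI hs)).ne').mul (hf.comp ?_ fun x hx => hW x hx s hs)
    exact continuousOn_const.sub (H.contDiffOn_v (hI hs)).continuousOn
  · refine (((H.cont_u x hx).mono hI).rpow_const fun s hs =>
      Or.inl (H.pos x hx s (hI hs)).ne').mul (hf.comp ?_ fun s hs => hW x hx s hs)
    exact hφ.sub (((H.cont_ut x hx).mono hI).div ((H.cont_u x hx).mono hI)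
      fun s hs => (H.pos x hx s (hI hs)).ne')
  · have hu := H.pos x hx s (hI hs)
    rw [abs_mul, abs_of_nonneg (Real.rpow_nonneg hu.le _)]
    exact mul_le_mul (Real.rpow_le_rpow hu.le (H.u_le x hx s (hI hs)) (by linarith))
      (hC _ (hW x hx s hs)) (abs_nonneg _) (Real.rpow_nonneg H.B_pos.le _)

lemma RegSol.integrableOn_moment (H : RegSol Ω p b T u ut utt r B) {s : ℝ} (hs : s ∈ Icc 0 T)
    {f : ℝ → ℝ} {k : Set ℝ} (hk : IsCompact k) (hf : ContinuousOn f k) {w : ℝ}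
    (hW : ∀ x ∈ Ω, w - ut x s / u x s ∈ k) :
    IntegrableOn (fun x => u x s ^ (p + 1) * f (w - ut x s / u x s)) Ω := by
  have hp := H.one_lt
  obtain ⟨C, hC⟩ := hk.exists_bound_of_continuousOn hf
  refine integrableOn_of_continuousOn_of_bounded (B := B ^ (p + 1) * C) H.isOpen H.bounded ?_ ?_
  · refine ((H.smooth_u s hs).continuousOn.rpow_const fun x hx =>
      Or.inl (H.pos x hx s hs).ne').mul (hf.comp ?_ fun x hx => hW x hx)
    exact continuousOn_const.sub (H.contDiffOn_v hs).continuousOn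
  · intro x hx
    have hu := H.pos x hx s hs
    rw [abs_mul, abs_of_nonneg (Real.rpow_nonneg hu.le _)]
    exact mul_le_mul (Real.rpow_le_rpow hu.le (H.u_le x hx s hs) (by linarith))
      (hC _ (hW x hx)) (abs_nonneg _) (Real.rpow_nonneg H.B_pos.le _)

/-- The Aronson–Bénilan type upper bound for `∂ₜu / u`. -/
theorem RegSol.v_le (H : RegSol Ω p b T u ut utt r B) {x : V} (hx : x ∈ Ω) {t : ℝ}
    (ht : t ∈ Ioc 0 T) : ut x t / u x t ≤ 1 / p + 1 / ((p - 1) * t) := by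
  have hp := H.one_lt
  have hp0 : 0 < p := by linarith
  have hp1 : 0 < p - 1 := by linarith
  have hB := H.B_pos
  have hT := H.T_pos
  have hΩo := H.isOpen
  set φ : ℝ → ℝ := fun s => 1 / p + 1 / ((p - 1) * s) with hφ
  set φ1 : ℝ → ℝ := fun s => -1 / ((p - 1) * s ^ 2) with hφ1
  obtain ⟨t1, ht1, ht1t, ht1B⟩ : ∃ t1 > 0, t1 < t ∧ B ≤ 1 / ((p - 1) * t1) := by
    refine ⟨min (t / 2) (1 / ((p - 1) * B)), lt_min (by linarith [ht.1]) (by positivity),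
      (min_le_left _ _).trans_lt (by linarith [ht.1]), ?_⟩
    rw [le_div_iff₀ (mul_pos hp1 (lt_min (by linarith [ht.1]) (by positivity)))]
    calc B * ((p - 1) * min (t / 2) (1 / ((p - 1) * B)))
        ≤ B * ((p - 1) * (1 / ((p - 1) * B))) := by gcongr; exact min_le_right _ _
      _ = 1 := by field_simp
  have hφd : ∀ s ∈ Ioo t1 T, HasDerivAt φ (φ1 s) s := by
    intro s hs
    have hs0 : s ≠ 0 := (ht1.trans hs.1).ne'
    have h1 : HasDerivAt (fun s => (p - 1) * s) (p - 1) s := by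
      simpa using (hasDerivAt_id s).const_mul (p - 1)
    have h := ((h1.fun_inv (mul_ne_zero hp1.ne' hs0)).const_add (1 / p))
    simp only [hφ, one_div] at h ⊢
    refine h.congr_deriv ?_
    rw [hφ1]
    simp only
    field_simp
  have hφc : ContinuousOn φ (Icc t1 t) := by
    refine continuousOn_const.add (continuousOn_const.div (by fun_prop) fun s hs => ?_)
    have : 0 < s := ht1.trans_le hs.1
    positivity
  have hφb : ∀ s ∈ Icc t1 T, |φ s| ≤ 1 / p + 1 / ((p - 1) * t1) := by
    intro s hs
    have hs0 : 0 < s := ht1.trans_le hs.1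
    rw [hφ, abs_of_nonneg (by positivity)]
    simp only
    gcongr
    exact hs.1
  have hφ_bound : ∀ s ∈ Ioo t1 T, |φ1 s| ≤ 1 / ((p - 1) * t1 ^ 2) := by
    intro s hs
    have hs0 : 0 < s := ht1.trans hs.1
    rw [hφ1]
    simp only
    rw [neg_div, abs_neg, abs_of_nonneg (by positivity)]
    gcongr
    exact hs.1.le
  set M := 1 / p + 1 / ((p - 1) * t1) + B with hM
  have hW : ∀ x ∈ Ω, ∀ s ∈ Icc t1 T, φ s - ut x s / u x s ∈ Icc (-M) M := by
    intro x hx s hs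
    have h1 := abs_le.1 (hφb s hs)
    have h2 := abs_le.1 (H.abs_v_le hx (t := s) ⟨ht1.le.trans hs.1, hs.2⟩)
    constructor <;> linarith [h1.1, h1.2, h2.1, h2.2]
  set f : ℝ → ℝ := fun w => (w * (w * |w|) - w ^ 3) / 2 with hf
  set f1 : ℝ → ℝ := fun w => 3 / 2 * (w * |w| - w ^ 2) with hf1
  set f2 : ℝ → ℝ := fun w => 3 * (|w| - w) with hf2
  have hfc : Continuous f := by rw [hf]; fun_prop
  have hf0 : ∀ w, 0 ≤ f w := fun w => by
    rw [hf]; simp only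
    nlinarith [mul_nonneg (sq_nonneg w) (sub_nonneg.2 (le_abs_self w))]
  set I : ℝ → ℝ := fun s => ∫ x in Ω, u x s ^ (p + 1) * f (φ s - ut x s / u x s) with hI
  have hIc : ContinuousOn I (Icc t1 t) := H.continuousOn_moment
    (Icc_subset_Icc ht1.le ht.2) hφc isCompact_Icc hfc.continuousOn
    fun x hx s hs => hW x hx s ⟨hs.1, hs.2.trans ht.2⟩
  have hId := fun s (hs : s ∈ Ioo t1 t) => H.hasDerivAt_moment ht1.le ⟨hs.1, hs.2.trans_le ht.2⟩
    hφd hφ_bound (f := f) (f1 := f1) (f2 := f2) isOpen_univ isCompact_Icc (subset_univ _)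
    (fun w _ => by
      have := ((hasDerivAt_id w).fun_mul (hasDerivAt_mul_abs_self w)).fun_sub (hasDerivAt_pow 3 w)
      refine (this.div_const 2).congr_deriv ?_
      rw [hf1]; simp; ring)
    (fun w _ => by
      have := ((hasDerivAt_mul_abs_self w).fun_sub (hasDerivAt_pow 2 w)).const_mul (3 / 2)
      refine this.congr_deriv ?_
      rw [hf2]; simp; ring)
    (by rw [hf2]; fun_prop) (fun x hx s hs => hW x hx s (Ioo_subset_Icc_self hs))
  have hIle := le_mul_exp_integral (g := fun _ => (p + 1) * B) ht1t.le hIc continuousOn_const hId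
    (fun s hs => by
      have hs0 : 0 < s := ht1.trans hs.1
      have hs' : s ∈ Icc 0 T := ⟨hs0.le, hs.2.le.trans ht.2⟩
      have hn2 : 0 ≤ ∫ x in Ω, f2 (φ s - ut x s / u x s) *
          (u x s ^ 2 * ∑ i, pderiv' i (fun y => ut y s / u y s) x ^ 2) :=
        setIntegral_nonneg hΩo.measurableSet fun x hx => mul_nonneg
          (by rw [hf2]; linarith [le_abs_self (φ s - ut x s / u x s)])
          (mul_nonneg (sq_nonneg _) (Finset.sum_nonneg fun _ _ => sq_nonneg _))
      have hW' : ∀ x ∈ Ω, φ s - ut x s / u x s ∈ Icc (-M) M := fun x hx =>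
        hW x hx s ⟨hs.1.le, hs.2.le.trans ht.2⟩
      have hle : (∫ x in Ω, u x s ^ (p + 1) * (f1 (φ s - ut x s / u x s) *
          (φ1 s + (p - 1) * (ut x s / u x s) ^ 2 - (p - 1) / p * (ut x s / u x s)) +
          (p + 1) * (ut x s / u x s) * f (φ s - ut x s / u x s))) ≤
          ∫ x in Ω, (p + 1) * B * (u x s ^ (p + 1) * f (φ s - ut x s / u x s)) := by
        refine setIntegral_mono_on ?_ ((H.integrableOn_moment hs' isCompact_Icc hfc.continuousOn
          hW').const_mul _) hΩo.measurableSet fun x hx => ?_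
        · refine (H.integrableOn_moment hs' isCompact_Icc (w := φ s) (f := fun w => f1 w *
            (φ1 s + (p - 1) * (φ s - w) ^ 2 - (p - 1) / p * (φ s - w)) +
            (p + 1) * (φ s - w) * f w) (Continuous.continuousOn (by rw [hf1]; fun_prop))
            hW').congr_fun (fun x hx => ?_) hΩo.measurableSet
          simp only [sub_sub_cancel]
        · set v := ut x s / u x s with hv
          have hvB : v ≤ B := (le_abs_self _).trans (H.abs_v_le hx hs')
          have hu : 0 ≤ u x s ^ (p + 1) := Real.rpow_nonneg (H.pos x hx s hs').le _
          have e : f1 (φ s - v) * (φ1 s + (p - 1) * v ^ 2 - (p - 1) / p * v) ≤ 0 := by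
            rcases le_or_gt 0 (φ s - v) with h | h
            · have : f1 (φ s - v) = 0 := by
                rw [hf1]; simp only; rw [abs_of_nonneg h]; ring
              rw [this, zero_mul]
            · refine mul_nonpos_of_nonpos_of_nonneg ?_ ?_
              · rw [hf1]; simp only; rw [abs_of_neg h]; nlinarith
              · have h1 : 1 / ((p - 1) * s) ≤ v - 1 / p := by
                  rw [hφ] at h; simp only at h; linarith
                have h2 : (1 / ((p - 1) * s)) ^ 2 ≤ (v - 1 / p) ^ 2 :=
                  pow_le_pow_left₀ (by positivity) h1 2
                have h3 : (p - 1) * (1 / ((p - 1) * s)) ^ 2 = -φ1 s := by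
                  rw [hφ1]; field_simp
                have h4 := mul_le_mul_of_nonneg_left h2 hp1.le
                have h5 : 0 ≤ (p - 1) * ((v - 1 / p) * (1 / p)) := by
                  have : 0 < 1 / ((p - 1) * s) := by positivity
                  have : 0 ≤ v - 1 / p := by linarith
                  positivity
                have h6 : (p - 1) * v ^ 2 - (p - 1) / p * v =
                    (p - 1) * (v - 1 / p) ^ 2 + (p - 1) * ((v - 1 / p) * (1 / p)) := by
                  field_simp; ring
                linarith
          have e2 : (p + 1) * v * f (φ s - v) ≤ (p + 1) * B * f (φ s - v) := by
            have := hf0 (φ s - v)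
            gcongr
          calc _ ≤ u x s ^ (p + 1) * ((p + 1) * B * f (φ s - v)) :=
                mul_le_mul_of_nonneg_left (by linarith) hu
            _ = _ := by ring
      rw [integral_const_mul] at hle
      have : 0 ≤ 1 / p * ∫ x in Ω, f2 (φ s - ut x s / u x s) *
          (u x s ^ 2 * ∑ i, pderiv' i (fun y => ut y s / u y s) x ^ 2) := by positivity
      linarith)
  have hIt1 : I t1 = 0 := by
    rw [hI]
    refine setIntegral_eq_zero_of_forall_eq_zero fun x hx => ?_
    have h1 := (le_abs_self _).trans (H.abs_v_le hx (t := t1) ⟨ht1.le, (ht1t.trans_le ht.2).le⟩)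
    have h2 : 0 ≤ φ t1 - ut x t1 / u x t1 := by
      rw [hφ]; simp only
      have : 0 < 1 / p := by positivity
      linarith
    rw [hf]; simp only; rw [abs_of_nonneg h2]; ring
  rw [hIt1, zero_mul] at hIle
  have ht' : t ∈ Icc 0 T := ⟨ht.1.le, ht.2⟩
  have htt1 : t ∈ Icc t1 T := ⟨ht1t.le, ht.2⟩
  have hnn : ∀ x ∈ Ω, 0 ≤ u x t ^ (p + 1) * f (φ t - ut x t / u x t) := fun x hx =>
    mul_nonneg (Real.rpow_nonneg (H.pos x hx t ht').le _) (hf0 _)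
  have hI0 : I t = 0 := le_antisymm hIle (setIntegral_nonneg hΩo.measurableSet hnn)
  have hae := (setIntegral_eq_zero_iff_of_nonneg_ae
    ((ae_restrict_iff' hΩo.measurableSet).2 (Eventually.of_forall hnn))
    (H.integrableOn_moment ht' isCompact_Icc hfc.continuousOn fun x hx => hW x hx t htt1)).1 hI0
  have hcont : ContinuousOn (fun x => u x t ^ (p + 1) * f (φ t - ut x t / u x t)) Ω :=
    ((H.smooth_u t ht').continuousOn.rpow_const fun x hx => Or.inl (H.pos x hx t ht').ne').mul
      (hfc.comp_continuousOn (continuousOn_const.sub (H.contDiffOn_v ht').continuousOn))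
  have heq := Measure.eqOn_open_of_ae_eq hae hΩo hcont continuousOn_const hx
  simp only [Pi.zero_apply] at heq
  have hfz : f (φ t - ut x t / u x t) = 0 :=
    (mul_eq_zero.1 heq).resolve_left (Real.rpow_pos_of_pos (H.pos x hx t ht') _).ne'
  by_contra hlt
  have hneg : φ t - ut x t / u x t < 0 := by rw [hφ]; simp only; linarith
  rw [hf] at hfz
  simp only at hfz
  rw [abs_of_neg hneg] at hfz
  have := pow_pos (neg_pos.2 hneg) 3
  nlinarith

end Estimates

section Energy

variable {n : ℕ}

local notation "V" => EuclideanSpace ℝ (Fin n)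

variable {Ω : Set (EuclideanSpace ℝ (Fin n))} {p b T B : ℝ}
  {u ut utt : EuclideanSpace ℝ (Fin n) → ℝ → ℝ} {r : EuclideanSpace ℝ (Fin n) → ℝ}

lemma RegSol.hasDerivAt_energy (H : RegSol Ω p b T u ut utt r B) {t : ℝ} (ht : t ∈ Ioo 0 T) :
    HasDerivAt (fun s => ∫ x in Ω, ((∑ i, pderiv' i (fun y => u y s) x ^ 2) / 2 -
      b / 2 * u x s ^ 2 - u x s ^ (p + 1) / (p + 1)))
      (-p * ∫ x in Ω, u x t ^ (p + 1) * (ut x t / u x t) ^ 2) t := by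
  have hp := H.one_lt
  have hB := H.B_pos
  have hΩo := H.isOpen
  have hb := H.bounded
  have hI' : ∀ {s}, s ∈ Ioo 0 T → s ∈ Icc 0 T := fun hs => Ioo_subset_Icc_self hs
  have absut : ∀ {x s} (_ : x ∈ Ω) (_ : s ∈ Ioo 0 T), |ut x s| ≤ B ^ 2 := fun {x s} hx hs => by
    have hu := H.pos x hx s (hI' hs)
    calc |ut x s| ≤ B * u x s := H.abs_ut_le x hx s (hI' hs)
      _ ≤ B * B := by gcongr; exact H.u_le x hx s (hI' hs)
      _ = B ^ 2 := by ring
  have absu : ∀ {x s} (_ : x ∈ Ω) (_ : s ∈ Ioo 0 T), |u x s| ≤ B := fun {x s} hx hs => by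
    rw [abs_of_pos (H.pos x hx s (hI' hs))]; exact H.u_le x hx s (hI' hs)
  have upow : ∀ {x s} (_ : x ∈ Ω) (_ : s ∈ Ioo 0 T) (a : ℝ), 0 ≤ a → |u x s ^ a| ≤ B ^ a :=
    fun {x s} hx hs a ha => by
      have hu := H.pos x hx s (hI' hs)
      rw [abs_of_nonneg (Real.rpow_nonneg hu.le _)]
      exact Real.rpow_le_rpow hu.le (H.u_le x hx s (hI' hs)) ha
  set F : ℝ → V → ℝ := fun s x => (∑ i, pderiv' i (fun y => u y s) x ^ 2) / 2 -
      b / 2 * u x s ^ 2 - u x s ^ (p + 1) / (p + 1) with hF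
  set G : ℝ → V → ℝ := fun s x => (∑ i, pderiv' i (fun y => u y s) x *
      pderiv' i (fun y => ut y s) x) - b * (u x s * ut x s) - u x s ^ p * ut x s with hG
  have du1 : ∀ s ∈ Ioo 0 T, ∀ i, ContDiffOn ℝ 1 (fun x => pderiv' i (fun y => u y s) x) Ω :=
    fun s hs i => (H.smooth_u s (hI' hs)).pderiv'_of_isOpen hΩo (by norm_num) i
  have dut1 : ∀ s ∈ Ioo 0 T, ∀ i, ContDiffOn ℝ 1 (fun x => pderiv' i (fun y => ut y s) x) Ω :=
    fun s hs i => (H.smooth_ut s (hI' hs)).pderiv'_of_isOpen hΩo (by norm_num) i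
  have hrp : ∀ (a : ℝ), ∀ s ∈ Ioo 0 T, ContinuousOn (fun x => u x s ^ a) Ω := fun a s hs =>
    (H.smooth_u s (hI' hs)).continuousOn.rpow_const fun x hx => Or.inl (H.pos x hx s (hI' hs)).ne'
  have hFc : ∀ s ∈ Ioo 0 T, ContinuousOn (F s) Ω := fun s hs =>
    (((continuousOn_finsetSum _ fun i _ => (du1 s hs i).continuousOn.pow 2).div_const 2).sub
      (continuousOn_const.mul ((H.smooth_u s (hI' hs)).continuousOn.pow 2))).sub
      ((hrp _ s hs).div_const _)
  have hGc : ∀ s ∈ Ioo 0 T, ContinuousOn (G s) Ω := fun s hs =>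
    ((continuousOn_finsetSum _ fun i _ => (du1 s hs i).continuousOn.mul
      (dut1 s hs i).continuousOn).sub (continuousOn_const.mul
      ((H.smooth_u s (hI' hs)).continuousOn.mul (H.smooth_ut s (hI' hs)).continuousOn))).sub
      ((hrp _ s hs).mul (H.smooth_ut s (hI' hs)).continuousOn)
  have hGb : ∀ x ∈ Ω, ∀ s ∈ Ioo 0 T, |G s x| ≤ n * (B * B) + |b| * (B * B ^ 2) + B ^ p * B ^ 2 := by
    intro x hx s hs
    refine (abs_sub _ _).trans (add_le_add ((abs_sub _ _).trans (add_le_add ?_ ?_)) ?_)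
    · refine (Finset.abs_sum_le_sum_abs _ _).trans
        ((Finset.sum_le_sum (g := fun _ => B * B) fun i _ => ?_).trans (by simp))
      rw [abs_mul]
      exact mul_le_mul (H.du_le i x hx s (hI' hs)) (H.dut_le i x hx s (hI' hs)) (abs_nonneg _) hB.le
    · rw [abs_mul, abs_mul]
      gcongr
      · exact absu hx hs
      · exact absut hx hs
    · rw [abs_mul]
      gcongr
      · exact upow hx hs p (by linarith)
      · exact absut hx hs
  have hFi : IntegrableOn (F t) Ω := by
    refine integrableOn_of_continuousOn_of_bounded (B := n * B ^ 2 / 2 + |b| / 2 * B ^ 2 +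
      B ^ (p + 1) / (p + 1)) hΩo hb (hFc t ht) fun x hx => ?_
    refine (abs_sub _ _).trans (add_le_add ((abs_sub _ _).trans (add_le_add ?_ ?_)) ?_)
    · rw [abs_div, abs_two]
      gcongr
      refine (Finset.abs_sum_le_sum_abs _ _).trans
        ((Finset.sum_le_sum (g := fun _ => B ^ 2) fun i _ => ?_).trans (by simp))
      rw [abs_pow]
      exact pow_le_pow_left₀ (abs_nonneg _) (H.du_le i x hx t (hI' ht)) 2
    · rw [abs_mul, abs_div, abs_two, abs_pow]
      gcongr
      exact absu hx ht
    · rw [abs_div, abs_of_pos (by linarith : 0 < p + 1)]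
      have := upow hx ht (p + 1) (by linarith)
      gcongr
  have hFd : ∀ x ∈ Ω, ∀ s ∈ Ioo 0 T, HasDerivAt (fun s => F s x) (G s x) s := by
    intro x hx s hs
    have hu := H.pos x hx s (hI' hs)
    have d1 := H.deriv_u x hx s hs
    have d2 := d1.rpow_const (p := p + 1) (Or.inl hu.ne')
    have d3 := HasDerivAt.fun_sum (u := Finset.univ) fun i _ => (H.deriv_du i x hx s hs).fun_pow 2
    refine (((d3.div_const 2).fun_sub ((d1.fun_pow 2).const_mul (b / 2))).fun_sub
      (d2.div_const (p + 1))).congr_deriv ?_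
    rw [hG]
    simp only [add_sub_cancel_right]
    rw [Finset.sum_div]
    congr 1
    · congr 1
      · exact Finset.sum_congr rfl fun i _ => by push_cast; ring
      · push_cast; ring
    · field_simp
  have hdom := (hasDerivAt_integral_of_dominated_loc_of_deriv_le
    (μ := volume.restrict Ω) (F := F) (F' := G) (x₀ := t) (s := Ioo 0 T)
    (bound := fun _ => n * (B * B) + |b| * (B * B ^ 2) + B ^ p * B ^ 2)
    (Ioo_mem_nhds ht.1 ht.2)
    (by
      filter_upwards [Ioo_mem_nhds ht.1 ht.2] with s hs
      exact (hFc s hs).aestronglyMeasurable hΩo.measurableSet)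
    hFi ((hGc t ht).aestronglyMeasurable hΩo.measurableSet)
    ((ae_restrict_iff' hΩo.measurableSet).2 (Eventually.of_forall fun x hx s hs => hGb x hx s hs))
    (integrableOn_const hb.measure_lt_top.ne)
    ((ae_restrict_iff' hΩo.measurableSet).2 (Eventually.of_forall fun x hx s hs =>
      hFd x hx s hs))).2
  refine hdom.congr_deriv ?_
  have ht' := hI' ht
  set X : Fin n → V → ℝ := fun i x => ut x t * pderiv' i (fun y => u y t) x with hX
  have hut1 : ContDiffOn ℝ 1 (fun x => ut x t) Ω := (H.smooth_ut t ht').of_le (by norm_num)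
  have hXs : ∀ i, ContDiffOn ℝ 1 (X i) Ω := fun i => hut1.mul (du1 t ht i)
  have hXb : ∀ i, ∀ x ∈ Ω, |X i x| ≤ (B * B * B) * r x := by
    intro i x hx
    rw [hX]
    simp only
    rw [abs_mul]
    have hu := H.pos x hx t ht'
    calc _ ≤ (B * u x t) * B :=
          mul_le_mul (H.abs_ut_le x hx t ht') (H.du_le i x hx t ht') (abs_nonneg _) (by positivity)
      _ ≤ (B * (B * r x)) * B := by gcongr; exact H.u_le_r x hx t ht'
      _ = _ := by ring
  have hdiv : ∀ x ∈ Ω, ∑ i, pderiv' i (X i) x =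
      G t x + p * (u x t ^ (p + 1) * (ut x t / u x t) ^ 2) := by
    intro x hx
    have hn := hΩo.mem_nhds hx
    have hu := H.pos x hx t ht'
    have dut := (hut1.differentiableOn (by simp)).differentiableAt hn
    have d1 := fun i => ((du1 t ht i).differentiableOn (by simp)).differentiableAt hn
    have e : ∀ i, pderiv' i (X i) x = ut x t * pderiv' i (pderiv' i fun y => u y t) x +
        pderiv' i (fun y => u y t) x * pderiv' i (fun y => ut y t) x := fun i =>
      pderiv'_mul i dut (d1 i)
    rw [Finset.sum_congr rfl fun i _ => e i, Finset.sum_add_distrib, ← Finset.mul_sum]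
    change ut x t * lap (fun y => u y t) x + _ = _
    have h := H.pde x hx t ⟨ht.1, ht.2.le⟩
    have e2 : u x t ^ (p + 1) = u x t ^ (p - 1) * u x t ^ 2 := by
      rw [← Real.rpow_add_natCast hu.ne']; congr 1; push_cast; ring
    have e3 : u x t ^ (p + 1) * (ut x t / u x t) ^ 2 = u x t ^ (p - 1) * ut x t ^ 2 := by
      rw [e2]; field_simp
    rw [e3, hG]
    simp only
    linear_combination -(ut x t) * h
  have hNi : IntegrableOn (fun x => u x t ^ (p + 1) * (ut x t / u x t) ^ 2) Ω := by
    refine (H.integrableOn_moment ht' (isCompact_Icc (a := -B) (b := B)) (f := fun w => w ^ 2)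
      (w := 0) (by fun_prop) fun x hx => ?_).congr_fun (fun x hx => ?_) hΩo.measurableSet
    · have := abs_le.1 (H.abs_v_le hx ht')
      constructor <;> linarith [this.1, this.2]
    · simp
  have hGi : IntegrableOn (G t) Ω := integrableOn_of_continuousOn_of_bounded hΩo hb (hGc t ht)
    fun x hx => hGb x hx t ht
  have h0 := integral_div_eq_zero hb H.smooth_r H.mem_iff hXs hXb
    ((hGi.add (hNi.const_mul p)).congr_fun (fun x hx => (hdiv x hx).symm) hΩo.measurableSet)
  rw [setIntegral_congr_fun hΩo.measurableSet hdiv, integral_add hGi (hNi.const_mul p),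
    integral_const_mul] at h0
  linarith

/-- The energy inequality. -/
theorem RegSol.integral_moment_two_le (H : RegSol Ω p b T u ut utt r B) {M E : ℝ}
    (hM : ∀ x ∈ Ω, u x T ≤ M)
    (hE : (∫ x in Ω, (‖gradient (fun y => u y 0) x‖ ^ 2 + u x 0 ^ 2)) ≤ E) :
    ∫ t in 0..T, ∫ x in Ω, u x t ^ (p + 1) * (ut x t / u x t) ^ 2 ≤
      (1 + |b|) / 2 * E + (|b| / 2 * M ^ 2 + M ^ (p + 1)) * volume.real Ω := by
  have hp := H.one_lt
  have hB := H.B_pos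
  have hT := H.T_pos
  have hΩo := H.isOpen
  have hb := H.bounded
  have h0T : (0 : ℝ) ∈ Icc 0 T := ⟨le_rfl, hT.le⟩
  have hTT : T ∈ Icc 0 T := ⟨hT.le, le_rfl⟩
  set J : ℝ → ℝ := fun s => ∫ x in Ω, ((∑ i, pderiv' i (fun y => u y s) x ^ 2) / 2 -
      b / 2 * u x s ^ 2 - u x s ^ (p + 1) / (p + 1)) with hJ
  set N : ℝ → ℝ := fun s => ∫ x in Ω, u x s ^ (p + 1) * (ut x s / u x s) ^ 2 with hN
  have hNc : ContinuousOn N (Icc 0 T) := by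
    refine (H.continuousOn_moment subset_rfl (φ := fun _ => 0) continuousOn_const
      (isCompact_Icc (a := -B) (b := B)) (f := fun w => w ^ 2)
      (by fun_prop) fun x hx s hs => ?_).congr fun s hs => ?_
    · have := abs_le.1 (H.abs_v_le hx hs)
      constructor <;> linarith [this.1, this.2]
    · simp [hN]
  have hN0 : ∀ t ∈ Icc 0 T, 0 ≤ N t := fun t ht => setIntegral_nonneg hΩo.measurableSet
    fun x hx => mul_nonneg (Real.rpow_nonneg (H.pos x hx t ht).le _) (sq_nonneg _)
  have du1 : ∀ s ∈ Icc 0 T, ∀ i, ContinuousOn (fun x => pderiv' i (fun y => u y s) x) Ω :=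
    fun s hs i => ((H.smooth_u s hs).pderiv'_of_isOpen hΩo (m := 1) (by norm_num) i).continuousOn
  have hFc1 : ∀ s ∈ Icc 0 T, ContinuousOn (fun x => ∑ i, pderiv' i (fun y => u y s) x ^ 2) Ω :=
    fun s hs => continuousOn_finsetSum _ fun i _ => (du1 s hs i).pow 2
  have hFc2 : ∀ s ∈ Icc 0 T, ContinuousOn (fun x => u x s ^ 2) Ω :=
    fun s hs => (H.smooth_u s hs).continuousOn.pow 2
  have hFc3 : ∀ s ∈ Icc 0 T, ContinuousOn (fun x => u x s ^ (p + 1)) Ω := fun s hs =>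
    (H.smooth_u s hs).continuousOn.rpow_const fun x hx => Or.inl (H.pos x hx s hs).ne'
  have b1 : ∀ x ∈ Ω, ∀ s ∈ Icc 0 T, |∑ i, pderiv' i (fun y => u y s) x ^ 2| ≤ n * B ^ 2 := by
    intro x hx s hs
    refine (Finset.abs_sum_le_sum_abs _ _).trans
        ((Finset.sum_le_sum (g := fun _ => B ^ 2) fun i _ => ?_).trans (by simp))
    rw [abs_pow]
    exact pow_le_pow_left₀ (abs_nonneg _) (H.du_le i x hx s hs) 2
  have b2 : ∀ x ∈ Ω, ∀ s ∈ Icc 0 T, |u x s ^ 2| ≤ B ^ 2 := by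
    intro x hx s hs
    have hu := H.pos x hx s hs
    rw [abs_of_nonneg (by positivity)]
    exact pow_le_pow_left₀ hu.le (H.u_le x hx s hs) 2
  have b3 : ∀ x ∈ Ω, ∀ s ∈ Icc 0 T, |u x s ^ (p + 1)| ≤ B ^ (p + 1) := by
    intro x hx s hs
    have hu := H.pos x hx s hs
    rw [abs_of_nonneg (by positivity)]
    exact Real.rpow_le_rpow hu.le (H.u_le x hx s hs) (by linarith)
  have i1 : ∀ s ∈ Icc 0 T, IntegrableOn (fun x => ∑ i, pderiv' i (fun y => u y s) x ^ 2) Ω :=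
    fun s hs => integrableOn_of_continuousOn_of_bounded hΩo hb (hFc1 s hs) fun x hx => b1 x hx s hs
  have i2 : ∀ s ∈ Icc 0 T, IntegrableOn (fun x => u x s ^ 2) Ω :=
    fun s hs => integrableOn_of_continuousOn_of_bounded hΩo hb (hFc2 s hs) fun x hx => b2 x hx s hs
  have i3 : ∀ s ∈ Icc 0 T, IntegrableOn (fun x => u x s ^ (p + 1)) Ω :=
    fun s hs => integrableOn_of_continuousOn_of_bounded hΩo hb (hFc3 s hs) fun x hx => b3 x hx s hs
  have hJc : ContinuousOn J (Icc 0 T) := by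
    refine continuousOn_integral_of_bounded hΩo hb (C := n * B ^ 2 / 2 + |b| / 2 * B ^ 2 +
      B ^ (p + 1) / (p + 1)) (fun s hs => ?_) (fun x hx => ?_) (fun x hx s hs => ?_)
    · exact (((hFc1 s hs).div_const 2).sub (continuousOn_const.mul (hFc2 s hs))).sub
        ((hFc3 s hs).div_const _)
    · exact (((continuousOn_finsetSum _ fun i _ => (H.cont_du i x hx).pow 2).div_const 2).sub
        (continuousOn_const.mul ((H.cont_u x hx).pow 2))).sub
        (((H.cont_u x hx).rpow_const fun s hs => Or.inl (H.pos x hx s hs).ne').div_const _)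
    · refine (abs_sub _ _).trans (add_le_add ((abs_sub _ _).trans (add_le_add ?_ ?_)) ?_)
      · rw [abs_div, abs_two]
        have := b1 x hx s hs
        gcongr
      · rw [abs_mul, abs_div, abs_two]
        have := b2 x hx s hs
        gcongr
      · rw [abs_div, abs_of_pos (by linarith : 0 < p + 1)]
        have := b3 x hx s hs
        gcongr
  have hanti := antitoneOn_Icc_of_hasDerivAt_nonpos
    (y := fun t => J t + p * ∫ σ in 0..t, N σ)
    (hJc.add (continuousOn_const.mul (continuousOn_integral_of_continuousOn_Icc hT.le hNc)))
    (fun t ht => (H.hasDerivAt_energy ht).add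
      ((hasDerivAt_integral_of_continuousOn_Icc hNc ht).const_mul p))
    (fun t ht => by rw [neg_mul, neg_add_cancel])
  have h := hanti h0T hTT hT.le
  simp only [intervalIntegral.integral_same, mul_zero, add_zero] at h
  have hNI : 0 ≤ ∫ σ in 0..T, N σ := intervalIntegral.integral_nonneg hT.le hN0
  have hJT : -((|b| / 2 * M ^ 2 + M ^ (p + 1)) * volume.real Ω) ≤ J T := by
    have : ∫ x in Ω, -(|b| / 2 * M ^ 2 + M ^ (p + 1)) =
        -((|b| / 2 * M ^ 2 + M ^ (p + 1)) * volume.real Ω) := by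
      simp; ring
    rw [← this]
    refine setIntegral_mono_on (integrableOn_const hb.measure_lt_top.ne)
      ((((i1 T hTT).div_const 2).sub ((i2 T hTT).const_mul _)).sub ((i3 T hTT).div_const _))
      hΩo.measurableSet fun x hx => ?_
    have hu := H.pos x hx T hTT
    have c1 : 0 ≤ ∑ i, pderiv' i (fun y => u y T) x ^ 2 :=
      Finset.sum_nonneg fun i _ => sq_nonneg _
    have c2 : b / 2 * u x T ^ 2 ≤ |b| / 2 * M ^ 2 := by
      gcongr
      · exact le_abs_self b
      · exact hM x hx
    have c3 : u x T ^ (p + 1) / (p + 1) ≤ M ^ (p + 1) :=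
      (div_le_self (by positivity) (by linarith)).trans
        (Real.rpow_le_rpow hu.le (hM x hx) (by linarith))
    linarith
  have hJ0 : J 0 ≤ (1 + |b|) / 2 * E := by
    have hE' : (1 + |b|) / 2 * (∫ x in Ω, (‖gradient (fun y => u y 0) x‖ ^ 2 + u x 0 ^ 2)) ≤
        (1 + |b|) / 2 * E := by gcongr
    refine le_trans ?_ hE'
    rw [← integral_const_mul]
    simp only [gradient_norm_sq_eq]
    refine setIntegral_mono_on
      ((((i1 0 h0T).div_const 2).sub ((i2 0 h0T).const_mul _)).sub ((i3 0 h0T).div_const _))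
      (((i1 0 h0T).add (i2 0 h0T)).const_mul _) hΩo.measurableSet fun x hx => ?_
    have hu := H.pos x hx 0 h0T
    have c1 : 0 ≤ ∑ i, pderiv' i (fun y => u y 0) x ^ 2 :=
      Finset.sum_nonneg fun i _ => sq_nonneg _
    have c2 := mul_nonneg (abs_nonneg b) c1
    have c3 : -b * u x 0 ^ 2 ≤ |b| * u x 0 ^ 2 := by
      gcongr
      exact neg_le_abs b
    have c4 : 0 ≤ u x 0 ^ (p + 1) / (p + 1) := by positivity
    have c5 := sq_nonneg (u x 0)
    linarith
  have h5 : (∫ σ in 0..T, N σ) ≤ p * ∫ σ in 0..T, N σ := le_mul_of_one_le_left hNI hp.le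
  linarith

end Energy

section MomentInequalities

variable {n : ℕ}

local notation "V" => EuclideanSpace ℝ (Fin n)

lemma integral_rpow_mul_rpow_le {Ω : Set V} (hΩ : IsOpen Ω) (hb : Bornology.IsBounded Ω)
    {F G : V → ℝ} {C θ : ℝ} (hF : ContinuousOn F Ω) (hG : ContinuousOn G Ω)
    (hF0 : ∀ x ∈ Ω, 0 ≤ F x) (hG0 : ∀ x ∈ Ω, 0 ≤ G x) (hFC : ∀ x ∈ Ω, F x ≤ C)
    (hGC : ∀ x ∈ Ω, G x ≤ C) (h0 : 0 < θ) (h1 : θ < 1) :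
    ∫ x in Ω, F x ^ (1 - θ) * G x ^ θ ≤ (∫ x in Ω, F x) ^ (1 - θ) * (∫ x in Ω, G x) ^ θ := by
  have hfin : IsFiniteMeasure (volume.restrict Ω) :=
    ⟨by rw [Measure.restrict_apply_univ]; exact hb.measure_lt_top⟩
  have h1' : 0 < 1 - θ := by linarith
  have hae : ∀ {P : V → Prop}, (∀ x ∈ Ω, P x) → ∀ᵐ x ∂volume.restrict Ω, P x := fun h =>
    (ae_restrict_iff' hΩ.measurableSet).2 (Eventually.of_forall h)
  have hconj : (1 / (1 - θ)).HolderConjugate (1 / θ) := by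
    rw [Real.holderConjugate_iff]
    refine ⟨by rw [lt_div_iff₀ h1']; linarith, by simp⟩
  have hm : ∀ {f : V → ℝ} {a : ℝ} {q : ENNReal}, 0 < a → ContinuousOn f Ω → (∀ x ∈ Ω, 0 ≤ f x) →
      (∀ x ∈ Ω, f x ≤ C) → MemLp (fun x => f x ^ a) q (volume.restrict Ω) := by
    intro f a q ha hf hf0 hfC
    refine MemLp.of_bound ((hf.rpow_const fun x _ => Or.inr ha.le).aestronglyMeasurable
      hΩ.measurableSet) (C ^ a) (hae fun x hx => ?_)
    rw [Real.norm_of_nonneg (Real.rpow_nonneg (hf0 x hx) _)]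
    exact Real.rpow_le_rpow (hf0 x hx) (hfC x hx) ha.le
  have h := integral_mul_le_Lp_mul_Lq_of_nonneg (μ := volume.restrict Ω) hconj
    (hae fun x hx => Real.rpow_nonneg (hF0 x hx) (1 - θ))
    (hae fun x hx => Real.rpow_nonneg (hG0 x hx) θ) (hm h1' hF hF0 hFC) (hm h0 hG hG0 hGC)
  rw [one_div_one_div, one_div_one_div] at h
  convert h using 3
  · exact setIntegral_congr_fun hΩ.measurableSet fun x hx => by
      rw [← Real.rpow_mul (hF0 x hx), mul_one_div_cancel h1'.ne', Real.rpow_one]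
  · exact setIntegral_congr_fun hΩ.measurableSet fun x hx => by
      rw [← Real.rpow_mul (hG0 x hx), mul_one_div_cancel h0.ne', Real.rpow_one]

/-- Young's inequality for a product with a small power. -/
lemma exists_mul_rpow_le {α a β : ℝ} (h0 : 0 < α) (h1 : α < 1) (ha : 0 < a) (hβ : 0 ≤ β) :
    ∃ C, 0 ≤ C ∧ ∀ X Z : ℝ, 0 ≤ X → 0 ≤ Z →
      β * (X * Z ^ α) ≤ a * Z + C * X ^ (1 / (1 - α)) := by
  have h1' : 0 < 1 - α := by linarith
  refine ⟨(β * a ^ (-α)) ^ (1 / (1 - α)), by positivity, fun X Z hX hZ => ?_⟩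
  have h := Real.geom_mean_le_arith_mean2_weighted (w₁ := α) (w₂ := 1 - α) (p₁ := a * Z)
    (p₂ := (β * a ^ (-α) * X) ^ (1 / (1 - α))) h0.le h1'.le (by positivity) (by positivity)
    (by ring)
  have e1 : ((β * a ^ (-α) * X) ^ (1 / (1 - α))) ^ (1 - α) = β * a ^ (-α) * X := by
    rw [← Real.rpow_mul (by positivity), one_div_mul_cancel h1'.ne', Real.rpow_one]
  have e2 : a ^ α * a ^ (-α) = 1 := by rw [← Real.rpow_add ha]; simp
  rw [e1, Real.mul_rpow ha.le hZ] at h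
  rw [← Real.mul_rpow (by positivity) hX]
  have h2 : 0 ≤ (β * a ^ (-α) * X) ^ (1 / (1 - α)) := by positivity
  have h3 : 0 ≤ a * Z := by positivity
  have h4 : a ^ α * Z ^ α * (β * a ^ (-α) * X) = β * (X * Z ^ α) := by
    linear_combination (Z ^ α * β * X) * e2
  rw [h4] at h
  nlinarith

/-- The weighted moments of `K - ∂ₜu / u`. -/
def moment (Ω : Set V) (p K : ℝ) (u ut : V → ℝ → ℝ) (q s : ℝ) : ℝ :=
  ∫ x in Ω, u x s ^ (p + 1) * (K - ut x s / u x s) ^ q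

/-- Solutions on which the quantitative estimates are uniform. -/
def UniformSol (Ω : Set V) (p b T : ℝ) (r : V → ℝ) (κ K t1 : ℝ) (u ut : V → ℝ → ℝ) : Prop :=
  ∃ utt B, RegSol Ω p b T u ut utt r B ∧
    (∀ x ∈ Ω, ∀ s ∈ Icc 0 T, r x ≤ κ * u x s ∧ u x s ≤ κ * r x) ∧
    ∀ x ∈ Ω, ∀ s ∈ Icc t1 T, 1 ≤ K - ut x s / u x s

variable {Ω : Set (EuclideanSpace ℝ (Fin n))} {p b T B K κ t1 : ℝ}
  {u ut utt : EuclideanSpace ℝ (Fin n) → ℝ → ℝ} {r : EuclideanSpace ℝ (Fin n) → ℝ}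

lemma RegSol.sub_v_mem (H : RegSol Ω p b T u ut utt r B) {x : V} (hx : x ∈ Ω) {s : ℝ}
    (hs : s ∈ Icc 0 T) (h : 1 ≤ K - ut x s / u x s) :
    K - ut x s / u x s ∈ Icc 1 (K + B) :=
  ⟨h, by linarith [(abs_le.1 (H.abs_v_le hx hs)).1]⟩

lemma continuousOn_rpow_Icc_one (q c : ℝ) : ContinuousOn (fun w : ℝ => w ^ q) (Icc 1 c) :=
  continuousOn_id.rpow_const fun w hw => Or.inl (by simp only [id]; linarith [hw.1])

lemma RegSol.integrableOn_sub_v_rpow (H : RegSol Ω p b T u ut utt r B) {s : ℝ} (hs : s ∈ Icc 0 T)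
    (hK : ∀ x ∈ Ω, 1 ≤ K - ut x s / u x s) (q : ℝ) :
    IntegrableOn (fun x => u x s ^ (p + 1) * (K - ut x s / u x s) ^ q) Ω :=
  H.integrableOn_moment hs isCompact_Icc (continuousOn_rpow_Icc_one q _)
    fun x hx => H.sub_v_mem hx hs (hK x hx)

lemma UniformSol.continuousOn_moment (h : UniformSol Ω p b T r κ K t1 u ut) (ht1 : 0 ≤ t1)
    (q : ℝ) : ContinuousOn (moment Ω p K u ut q) (Icc t1 T) := by
  obtain ⟨utt, B, H, -, hK⟩ := h
  exact H.continuousOn_moment (Icc_subset_Icc_left ht1) continuousOn_const isCompact_Icc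
    (continuousOn_rpow_Icc_one q (K + B)) fun x hx s hs =>
      H.sub_v_mem hx ⟨ht1.trans hs.1, hs.2⟩ (hK x hx s hs)

lemma UniformSol.moment_nonneg (h : UniformSol Ω p b T r κ K t1 u ut) (ht1 : 0 ≤ t1)
    (q : ℝ) {s : ℝ} (hs : s ∈ Icc t1 T) : 0 ≤ moment Ω p K u ut q s := by
  obtain ⟨utt, B, H, -, hK⟩ := h
  exact setIntegral_nonneg H.isOpen.measurableSet fun x hx => mul_nonneg
    (Real.rpow_nonneg (H.pos x hx s ⟨ht1.trans hs.1, hs.2⟩).le _)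
    (Real.rpow_nonneg (by linarith [hK x hx s hs]) _)

lemma UniformSol.moment_mono (h : UniformSol Ω p b T r κ K t1 u ut) (ht1 : 0 ≤ t1)
    {q q' : ℝ} (hq : q ≤ q') {s : ℝ} (hs : s ∈ Icc t1 T) :
    moment Ω p K u ut q s ≤ moment Ω p K u ut q' s := by
  obtain ⟨utt, B, H, -, hK⟩ := h
  have hs' : s ∈ Icc 0 T := ⟨ht1.trans hs.1, hs.2⟩
  refine setIntegral_mono_on (H.integrableOn_sub_v_rpow hs' (fun x hx => hK x hx s hs) q)
    (H.integrableOn_sub_v_rpow hs' (fun x hx => hK x hx s hs) q') H.isOpen.measurableSet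
    fun x hx => ?_
  exact mul_le_mul_of_nonneg_left (Real.rpow_le_rpow_of_exponent_le (hK x hx s hs) hq)
    (Real.rpow_nonneg (H.pos x hx s hs').le _)

/-- Interpolation between moments. -/
lemma UniformSol.moment_interpolate (h : UniformSol Ω p b T r κ K t1 u ut) (ht1 : 0 ≤ t1)
    {q q' θ : ℝ} (h0 : 0 < θ) (h1 : θ < 1) {s : ℝ} (hs : s ∈ Icc t1 T) :
    moment Ω p K u ut ((1 - θ) * q + θ * q') s ≤
      moment Ω p K u ut q s ^ (1 - θ) * moment Ω p K u ut q' s ^ θ := by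
  obtain ⟨utt, B, H, -, hK⟩ := h
  have hs' : s ∈ Icc 0 T := ⟨ht1.trans hs.1, hs.2⟩
  have hp := H.one_lt
  have hu := fun x hx => H.pos x hx s hs'
  have hW : ∀ x ∈ Ω, 0 < K - ut x s / u x s := fun x hx => by linarith [hK x hx s hs]
  obtain ⟨C1, hC1⟩ := isCompact_Icc.exists_bound_of_continuousOn
    (continuousOn_rpow_Icc_one q (K + B))
  obtain ⟨C2, hC2⟩ := isCompact_Icc.exists_bound_of_continuousOn
    (continuousOn_rpow_Icc_one q' (K + B))
  have hc : ∀ q : ℝ, ContinuousOn (fun x => u x s ^ (p + 1) * (K - ut x s / u x s) ^ q) Ω :=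
    fun q => ((H.smooth_u s hs').continuousOn.rpow_const fun x hx => Or.inl (hu x hx).ne').mul
      ((continuousOn_const.sub (H.contDiffOn_v hs').continuousOn).rpow_const
        fun x hx => Or.inl (hW x hx).ne')
  have hbd : ∀ x ∈ Ω, u x s ^ (p + 1) ≤ B ^ (p + 1) := fun x hx =>
    Real.rpow_le_rpow (hu x hx).le (H.u_le x hx s hs') (by linarith)
  have hB := H.B_pos
  have key := integral_rpow_mul_rpow_le H.isOpen H.bounded (hc q) (hc q')
    (C := B ^ (p + 1) * max C1 C2)
    (fun x hx => mul_nonneg (Real.rpow_nonneg (hu x hx).le _) (Real.rpow_nonneg (hW x hx).le _))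
    (fun x hx => mul_nonneg (Real.rpow_nonneg (hu x hx).le _) (Real.rpow_nonneg (hW x hx).le _))
    (fun x hx => mul_le_mul (hbd x hx) ((le_abs_self _).trans ((hC1 _
      (H.sub_v_mem hx hs' (hK x hx s hs))).trans (le_max_left _ _)))
      (Real.rpow_nonneg (hW x hx).le _) (by positivity))
    (fun x hx => mul_le_mul (hbd x hx) ((le_abs_self _).trans ((hC2 _
      (H.sub_v_mem hx hs' (hK x hx s hs))).trans (le_max_right _ _)))
      (Real.rpow_nonneg (hW x hx).le _) (by positivity)) h0 h1
  refine le_of_eq_of_le (setIntegral_congr_fun H.isOpen.measurableSet fun x hx => ?_) key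
  have hux := Real.rpow_pos_of_pos (hu x hx) (p + 1)
  rw [Real.mul_rpow hux.le (Real.rpow_nonneg (hW x hx).le _),
    Real.mul_rpow hux.le (Real.rpow_nonneg (hW x hx).le _), ← Real.rpow_mul (hW x hx).le,
    ← Real.rpow_mul (hW x hx).le, mul_mul_mul_comm, ← Real.rpow_add hux, sub_add_cancel,
    Real.rpow_one, ← Real.rpow_add (hW x hx)]
  congr 2
  ring

end MomentInequalities

section MomentDerivative

variable {n : ℕ}

local notation "V" => EuclideanSpace ℝ (Fin n)

variable {Ω : Set (EuclideanSpace ℝ (Fin n))} {p b T B K κ t1 : ℝ}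
  {u ut utt : EuclideanSpace ℝ (Fin n) → ℝ → ℝ} {r : EuclideanSpace ℝ (Fin n) → ℝ}

/-- The dissipation integral of the moment of order `q`. -/
def dissip (Ω : Set V) (K : ℝ) (u ut : V → ℝ → ℝ) (q s : ℝ) : ℝ :=
  ∫ x in Ω, (K - ut x s / u x s) ^ (q - 2) *
    (u x s ^ 2 * ∑ i, pderiv' i (fun y => ut y s / u y s) x ^ 2)

lemma UniformSol.exists_hasDerivAt_moment (h : UniformSol Ω p b T r κ K t1 u ut) (ht1 : 0 ≤ t1)
    (hK0 : 0 ≤ K) {q : ℝ} (hq : 0 ≤ q) {s : ℝ} (hs : s ∈ Ioo t1 T) :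
    ∃ D, HasDerivAt (moment Ω p K u ut q) D s ∧
      D ≤ -(q * (q - 1) / p) * dissip Ω K u ut q s +
        (q * (p - 1) - (p + 1)) * moment Ω p K u ut (q + 1) s +
        (q * (p - 1) * (K ^ 2 + 1) + (p + 1) * K) * moment Ω p K u ut q s := by
  obtain ⟨utt, B, H, -, hK⟩ := h
  have hp := H.one_lt
  have hIcc : ∀ {s}, s ∈ Ioo t1 T → s ∈ Icc 0 T := fun hs => ⟨ht1.trans hs.1.le, hs.2.le⟩
  have hd := H.hasDerivAt_moment ht1 hs (φ := fun _ => K) (φ1 := fun _ => 0) (Bφ := 0)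
    (fun s _ => hasDerivAt_const s K) (fun _ _ => by simp)
    (f := fun w => w ^ q) (f1 := fun w => q * w ^ (q - 1))
      (f2 := fun w => q * (q - 1) * w ^ (q - 2))
    (S := Ioi 0) (k := Icc 1 (K + B)) isOpen_Ioi isCompact_Icc (fun w hw => by
      simp only [mem_Ioi]; linarith [hw.1])
    (fun w hw => Real.hasDerivAt_rpow_const (Or.inl (ne_of_gt hw)))
    (fun w hw => by
      refine ((Real.hasDerivAt_rpow_const (p := q - 1)
        (Or.inl (ne_of_gt hw))).const_mul q).congr_deriv ?_
      rw [show q - 1 - 1 = q - 2 by ring]; ring)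
    (continuousOn_const.mul (continuousOn_id.rpow_const fun w hw => Or.inl (ne_of_gt hw)))
    (fun x hx s hs => H.sub_v_mem hx (hIcc hs) (hK x hx s (Ioo_subset_Icc_self hs)))
  refine ⟨_, hd, ?_⟩
  have hs' := hIcc hs
  have hK' : ∀ x ∈ Ω, 1 ≤ K - ut x s / u x s := fun x hx => hK x hx s (Ioo_subset_Icc_self hs)
  have e1 : (∫ x in Ω, q * (q - 1) * (K - ut x s / u x s) ^ (q - 2) *
      (u x s ^ 2 * ∑ i, pderiv' i (fun y => ut y s / u y s) x ^ 2)) =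
      q * (q - 1) * dissip Ω K u ut q s := by
    rw [dissip, ← integral_const_mul]
    exact integral_congr_ae (Eventually.of_forall fun x => by simp only; ring)
  have im := fun a => H.integrableOn_sub_v_rpow hs' hK' a
  have hle : (∫ x in Ω, u x s ^ (p + 1) * (q * (K - ut x s / u x s) ^ (q - 1) *
      (0 + (p - 1) * (ut x s / u x s) ^ 2 - (p - 1) / p * (ut x s / u x s)) +
      (p + 1) * (ut x s / u x s) * (K - ut x s / u x s) ^ q)) ≤
      ∫ x in Ω, ((q * (p - 1) - (p + 1)) * (u x s ^ (p + 1) * (K - ut x s / u x s) ^ (q + 1)) +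
        (q * (p - 1) * (K ^ 2 + 1) + (p + 1) * K) *
          (u x s ^ (p + 1) * (K - ut x s / u x s) ^ q)) := by
    refine setIntegral_mono_on ?_ (((im _).const_mul _).add ((im _).const_mul _))
      H.isOpen.measurableSet fun x hx => ?_
    · refine (H.integrableOn_moment hs' isCompact_Icc (w := K) (f := fun w => q * w ^ (q - 1) *
        (0 + (p - 1) * (K - w) ^ 2 - (p - 1) / p * (K - w)) + (p + 1) * (K - w) * w ^ q)
        ?_ fun x hx => H.sub_v_mem hx hs' (hK' x hx)).congr_fun (fun x hx => ?_)
        H.isOpen.measurableSet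
      · exact ((continuousOn_const.mul (continuousOn_rpow_Icc_one _ _)).mul (by fun_prop)).add
          ((Continuous.continuousOn (by fun_prop)).mul (continuousOn_rpow_Icc_one _ _))
      · simp only [sub_sub_cancel]
    · have hw := hK' x hx
      obtain ⟨w, hwd⟩ : ∃ w, w = K - ut x s / u x s := ⟨_, rfl⟩
      rw [← hwd] at hw ⊢
      have hv : ut x s / u x s = K - w := by linarith
      rw [hv]
      have hU := Real.rpow_nonneg (H.pos x hx s hs').le (p + 1)
      have hw0 : 0 < w := by linarith
      have w1 : w ^ q = w ^ (q - 1) * w := by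
        rw [← Real.rpow_add_one hw0.ne']; ring_nf
      have w2 : w ^ (q + 1) = w ^ (q - 1) * w ^ 2 := by
        rw [← Real.rpow_add_natCast hw0.ne']; congr 1; push_cast; ring
      have hP := Real.rpow_nonneg hw0.le (q - 1)
      rw [w1, w2]
      set P := w ^ (q - 1)
      have hp1 : (p - 1) / p ≤ p - 1 := div_le_self (by linarith) hp.le
      have hp1' : 0 ≤ (p - 1) / p := div_nonneg (by linarith) (by linarith)
      have key : q * (0 + (p - 1) * (K - w) ^ 2 - (p - 1) / p * (K - w)) +
          (p + 1) * (K - w) * w ≤ (q * (p - 1) - (p + 1)) * w ^ 2 +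
          (q * (p - 1) * (K ^ 2 + 1) + (p + 1) * K) * w := by
        have k1 : (p - 1) * (K - w) ^ 2 - (p - 1) / p * (K - w) ≤
            (p - 1) * w ^ 2 + (p - 1) * (K ^ 2 + 1) * w := by
          have a1 : 0 ≤ (p - 1) / p * K := by positivity
          have a2 : (p - 1) / p * w ≤ (p - 1) * w := by gcongr
          have a3 : 0 ≤ (p - 1) * (K ^ 2 * (w - 1)) :=
            mul_nonneg (by linarith) (mul_nonneg (sq_nonneg K) (by linarith))
          have a4 : 0 ≤ (p - 1) * (2 * K * w) := mul_nonneg (by linarith) (by positivity)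
          linarith
        have := mul_le_mul_of_nonneg_left k1 hq
        linarith
      calc _ = u x s ^ (p + 1) * P * (q * (0 + (p - 1) * (K - w) ^ 2 - (p - 1) / p * (K - w)) +
          (p + 1) * (K - w) * w) := by ring
        _ ≤ u x s ^ (p + 1) * P * ((q * (p - 1) - (p + 1)) * w ^ 2 +
          (q * (p - 1) * (K ^ 2 + 1) + (p + 1) * K) * w) :=
            mul_le_mul_of_nonneg_left key (by positivity)
        _ = _ := by ring
  rw [integral_add ((im _).const_mul _) ((im _).const_mul _), integral_const_mul,
    integral_const_mul] at hle
  change _ ≤ _ * dissip Ω K u ut q s + _ * (∫ x in Ω, u x s ^ (p + 1) *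
    (K - ut x s / u x s) ^ (q + 1)) + _ * (∫ x in Ω, u x s ^ (p + 1) * (K - ut x s / u x s) ^ q)
  rw [e1]
  have e2 : 1 / p * (q * (q - 1) * dissip Ω K u ut q s) =
      q * (q - 1) / p * dissip Ω K u ut q s := by ring
  rw [e2]
  linarith

/-- The reverse estimate of the dissipation by a higher moment. -/
lemma exists_moment_le_dissip (hn : 1 ≤ n) (hb : Bornology.IsBounded Ω)
    (hr : ContDiff ℝ (⊤ : ℕ∞) r) (hΩ : ∀ x, x ∈ Ω ↔ 0 < r x) {c : ℝ} (hc : 0 < c)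
    (hcr : ∀ x ∈ Ω, r x < c → c ≤ (∑ i, pderiv' i r x ^ 2) / 2 + r x * lap r x)
    (hp : 1 < p) (hcrit : n ≤ 2 ∨ p + 1 ≤ 2 * n / ((n : ℝ) - 2)) (hκ : 0 < κ) (ht1 : 0 ≤ t1)
    (q : ℝ) : ∃ C > 0, ∀ u ut, UniformSol Ω p b T r κ K t1 u ut → ∀ s ∈ Icc t1 T,
      moment Ω p K u ut (q * ((p + 1) / 2)) s ^ (2 / (p + 1)) ≤
        C * (dissip Ω K u ut q s + moment Ω p K u ut q s) := by
  obtain ⟨S, hS, hsob⟩ := weighted_sobolev hn hb hr hΩ hc hcr (P := p + 1) (by linarith) hcrit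
  refine ⟨κ ^ 2 * S * (κ ^ 2 * (q / 2) ^ 2 + κ ^ (p + 1)), by positivity, fun u ut h s hs => ?_⟩
  have hmnn := h.moment_nonneg ht1
  obtain ⟨utt, B, H, hcmp, hK⟩ := h
  have hs' : s ∈ Icc 0 T := ⟨ht1.trans hs.1, hs.2⟩
  have hB := H.B_pos
  have hΩo := H.isOpen
  have hu := fun x hx => H.pos x hx s hs'
  have hr0 : ∀ x ∈ Ω, 0 < r x := fun x hx => (H.mem_iff x).1 hx
  have hW : ∀ x ∈ Ω, 0 < K - ut x s / u x s := fun x hx => by linarith [hK x hx s hs]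
  have hmem := fun x hx => H.sub_v_mem hx hs' (hK x hx s hs)
  set v : V → ℝ := fun y => ut y s / u y s with hv
  have hvs : ContDiffOn ℝ 1 v Ω := (H.contDiffOn_v hs').of_le (by norm_num)
  have hWs : ContDiffOn ℝ 1 (fun x => K - v x) Ω := contDiffOn_const.sub hvs
  set f : V → ℝ := fun x => (K - v x) ^ (q / 2) with hf
  have hfs : ContDiffOn ℝ 1 f Ω := hWs.rpow_const_of_ne fun x hx => (hW x hx).ne'
  have hdf : ∀ x ∈ Ω, ∀ i, pderiv' i f x = -(q / 2 * (K - v x) ^ (q / 2 - 1)) * pderiv' i v x := by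
    intro x hx i
    have dv := (hvs.differentiableOn (by simp)).differentiableAt (hΩo.mem_nhds hx)
    rw [hf, pderiv'_comp i (f := fun y => K - v y) (g := fun w => w ^ (q / 2))
      (Real.hasDerivAt_rpow_const (Or.inl (hW x hx).ne')) (dv.const_sub _),
      pderiv'_sub i (f := fun _ => K) (g := v) (differentiableAt_const _) dv, pderiv'_const]
    ring
  obtain ⟨C1, hC1⟩ := isCompact_Icc.exists_bound_of_continuousOn
    (continuousOn_rpow_Icc_one (q / 2) (K + B))
  obtain ⟨C2, hC2⟩ := isCompact_Icc.exists_bound_of_continuousOn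
    (continuousOn_rpow_Icc_one (q / 2 - 1) (K + B))
  obtain ⟨C3, hC3⟩ := isCompact_Icc.exists_bound_of_continuousOn
    (continuousOn_rpow_Icc_one (q - 2) (K + B))
  simp only [Real.norm_eq_abs] at hC1 hC2 hC3
  have hfb : ∃ B', ∀ x ∈ Ω, |f x| ≤ B' ∧ ∀ i, |r x * pderiv' i f x| ≤ B' := by
    refine ⟨max C1 (|q / 2| * C2 * (B * (B + B ^ 2))), fun x hx =>
      ⟨(hC1 _ (hmem x hx)).trans (le_max_left _ _), fun i => le_trans ?_ (le_max_right _ _)⟩⟩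
    have h1 := H.abs_mul_pderiv'_v_le hx hs' i
    have h2 := H.r_le_u x hx s hs'
    have h3 := hC2 _ (hmem x hx)
    have h4 : r x * |pderiv' i v x| ≤ B * (B + B ^ 2) := by
      rw [abs_mul, abs_of_pos (hu x hx)] at h1
      calc r x * |pderiv' i v x| ≤ (B * u x s) * |pderiv' i v x| := by gcongr
        _ = B * (u x s * |pderiv' i v x|) := by ring
        _ ≤ _ := by gcongr
    rw [hdf x hx i, abs_mul, abs_mul, abs_neg, abs_mul, abs_of_pos (hr0 x hx)]
    calc _ = |q / 2| * |(K - v x) ^ (q / 2 - 1)| * (r x * |pderiv' i v x|) := by ring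
      _ ≤ _ := by
        have := (abs_nonneg _).trans h3
        have := mul_nonneg (hr0 x hx).le (abs_nonneg (pderiv' i v x))
        gcongr
  have hsob' := hsob f hfs hfb
  have hfsq : ∀ x ∈ Ω, f x ^ 2 = (K - v x) ^ q := by
    intro x hx
    rw [hf, ← Real.rpow_natCast, ← Real.rpow_mul (hW x hx).le]
    congr 1; push_cast; ring
  have im := fun a => H.integrableOn_sub_v_rpow hs' (fun x hx => hK x hx s hs) a
  have hc0 : ∀ {g : V → ℝ}, ContDiffOn ℝ 1 g Ω → ∀ i, ContinuousOn (pderiv' i g) Ω := fun hg i =>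
    (hg.pderiv'_of_isOpen hΩo (m := 0) (by simp) i).continuousOn
  have huc := (H.smooth_u s hs').continuousOn
  have hrc := hr.continuous.continuousOn (s := Ω)
  have hgrad : ∀ x ∈ Ω, |u x s ^ 2 * ∑ i, pderiv' i v x ^ 2| ≤ n * (B + B ^ 2) ^ 2 := by
    intro x hx
    rw [Finset.mul_sum]
    refine (Finset.abs_sum_le_sum_abs _ _).trans
      ((Finset.sum_le_sum (g := fun _ => (B + B ^ 2) ^ 2) fun i _ => ?_).trans (by simp))
    rw [← mul_pow, abs_pow]
    exact pow_le_pow_left₀ (abs_nonneg _) (H.abs_mul_pderiv'_v_le hx hs' i) 2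
  have idis : IntegrableOn (fun x => (K - v x) ^ (q - 2) *
      (u x s ^ 2 * ∑ i, pderiv' i v x ^ 2)) Ω := by
    refine integrableOn_of_continuousOn_of_bounded (B := C3 * (n * (B + B ^ 2) ^ 2)) hΩo hb
      ((hWs.continuousOn.rpow_const fun x hx => Or.inl (hW x hx).ne').mul ((huc.pow 2).mul
        (continuousOn_finsetSum _ fun i _ => (hc0 hvs i).pow 2))) fun x hx => ?_
    rw [abs_mul]
    have := hC3 _ (hmem x hx)
    exact mul_le_mul this (hgrad x hx) (abs_nonneg _) ((abs_nonneg _).trans this)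
  have hdis0 : 0 ≤ dissip Ω K u ut q s := setIntegral_nonneg hΩo.measurableSet fun x hx =>
    mul_nonneg (Real.rpow_nonneg (hW x hx).le _)
      (mul_nonneg (sq_nonneg _) (Finset.sum_nonneg fun _ _ => sq_nonneg _))
  have hrsq : ∀ x ∈ Ω, r x ^ 2 * ∑ i, pderiv' i f x ^ 2 ≤
      κ ^ 2 * (q / 2) ^ 2 * ((K - v x) ^ (q - 2) * (u x s ^ 2 * ∑ i, pderiv' i v x ^ 2)) := by
    intro x hx
    have e : ∑ i, pderiv' i f x ^ 2 =
        (q / 2) ^ 2 * (K - v x) ^ (q - 2) * ∑ i, pderiv' i v x ^ 2 := by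
      have e0 : ((K - v x) ^ (q / 2 - 1)) ^ 2 = (K - v x) ^ (q - 2) := by
        rw [← Real.rpow_natCast, ← Real.rpow_mul (hW x hx).le]
        congr 1; push_cast; ring
      rw [Finset.mul_sum]
      refine Finset.sum_congr rfl fun i _ => ?_
      rw [hdf x hx i, ← e0]; ring
    have h1 : r x ^ 2 ≤ (κ * u x s) ^ 2 := pow_le_pow_left₀ (hr0 x hx).le (hcmp x hx s hs').1 2
    have h2 : 0 ≤ (K - v x) ^ (q - 2) := Real.rpow_nonneg (hW x hx).le _
    have h3 : 0 ≤ ∑ i, pderiv' i v x ^ 2 := Finset.sum_nonneg fun _ _ => sq_nonneg _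
    rw [e]
    calc _ ≤ (κ * u x s) ^ 2 * ((q / 2) ^ 2 * (K - v x) ^ (q - 2) * ∑ i, pderiv' i v x ^ 2) := by
          gcongr
      _ = _ := by ring
  have t1' : (∫ x in Ω, r x ^ 2 * ∑ i, pderiv' i f x ^ 2) ≤
      κ ^ 2 * (q / 2) ^ 2 * dissip Ω K u ut q s := by
    rw [dissip, ← integral_const_mul]
    refine setIntegral_mono_on ?_ (idis.const_mul _) hΩo.measurableSet hrsq
    refine Integrable.mono' (idis.const_mul (κ ^ 2 * (q / 2) ^ 2))
      (((hrc.pow 2).mul (continuousOn_finsetSum _ fun i _ =>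
        (hc0 hfs i).pow 2)).aestronglyMeasurable hΩo.measurableSet)
      ((ae_restrict_iff' hΩo.measurableSet).2 (Eventually.of_forall fun x hx => ?_))
    rw [Real.norm_of_nonneg (mul_nonneg (sq_nonneg _) (Finset.sum_nonneg fun _ _ => sq_nonneg _))]
    exact hrsq x hx
  have hrp : ∀ x ∈ Ω, r x ^ (p + 1) ≤ κ ^ (p + 1) * u x s ^ (p + 1) := fun x hx => by
    rw [← Real.mul_rpow hκ.le (hu x hx).le]
    exact Real.rpow_le_rpow (hr0 x hx).le (hcmp x hx s hs').1 (by linarith)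
  have hup : ∀ x ∈ Ω, u x s ^ (p + 1) ≤ κ ^ (p + 1) * r x ^ (p + 1) := fun x hx => by
    rw [← Real.mul_rpow hκ.le (hr0 x hx).le]
    exact Real.rpow_le_rpow (hu x hx).le (hcmp x hx s hs').2 (by linarith)
  have hrpc : ContinuousOn (fun x => r x ^ (p + 1)) Ω :=
    hrc.rpow_const fun x hx => Or.inl (hr0 x hx).ne'
  have t2 : (∫ x in Ω, r x ^ (p + 1) * f x ^ 2) ≤ κ ^ (p + 1) * moment Ω p K u ut q s := by
    rw [moment, ← integral_const_mul]
    have hle : ∀ x ∈ Ω, r x ^ (p + 1) * f x ^ 2 ≤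
        κ ^ (p + 1) * (u x s ^ (p + 1) * (K - v x) ^ q) := by
      intro x hx
      rw [hfsq x hx, ← mul_assoc]
      exact mul_le_mul_of_nonneg_right (hrp x hx) (Real.rpow_nonneg (hW x hx).le _)
    refine setIntegral_mono_on ?_ ((im q).const_mul _) hΩo.measurableSet hle
    refine Integrable.mono' ((im q).const_mul (κ ^ (p + 1)))
      ((hrpc.mul (hfs.continuousOn.pow 2)).aestronglyMeasurable hΩo.measurableSet)
      ((ae_restrict_iff' hΩo.measurableSet).2 (Eventually.of_forall fun x hx => ?_))
    rw [Real.norm_of_nonneg (mul_nonneg (Real.rpow_nonneg (hr0 x hx).le _) (sq_nonneg _))]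
    exact hle x hx
  have hfp : ∀ x ∈ Ω, (r x * |f x|) ^ (p + 1) =
      r x ^ (p + 1) * (K - v x) ^ (q * ((p + 1) / 2)) := by
    intro x hx
    have hfx : 0 ≤ f x := Real.rpow_nonneg (hW x hx).le _
    rw [abs_of_nonneg hfx, Real.mul_rpow (hr0 x hx).le hfx, hf, ← Real.rpow_mul (hW x hx).le]
    congr 2; ring
  have t3 : moment Ω p K u ut (q * ((p + 1) / 2)) s ≤
      κ ^ (p + 1) * ∫ x in Ω, (r x * |f x|) ^ (p + 1) := by
    rw [moment, ← integral_const_mul]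
    refine setIntegral_mono_on (im _) ?_ hΩo.measurableSet fun x hx => ?_
    · refine Integrable.const_mul ?_ _
      have hcont : ContinuousOn (fun x => r x ^ (p + 1) * (K - v x) ^ (q * ((p + 1) / 2))) Ω :=
        hrpc.mul (hWs.continuousOn.rpow_const fun x hx => Or.inl (hW x hx).ne')
      refine IntegrableOn.congr_fun ?_ (fun x hx => (hfp x hx).symm) hΩo.measurableSet
      refine Integrable.mono' ((im (q * ((p + 1) / 2))).const_mul (κ ^ (p + 1)))
        (hcont.aestronglyMeasurable hΩo.measurableSet)
        ((ae_restrict_iff' hΩo.measurableSet).2 (Eventually.of_forall fun x hx => ?_))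
      have := Real.rpow_nonneg (hW x hx).le (q * ((p + 1) / 2))
      rw [Real.norm_of_nonneg (mul_nonneg (Real.rpow_nonneg (hr0 x hx).le _) this), ← mul_assoc]
      exact mul_le_mul_of_nonneg_right (hrp x hx) this
    · rw [hfp x hx, ← mul_assoc]
      exact mul_le_mul_of_nonneg_right (hup x hx) (Real.rpow_nonneg (hW x hx).le _)
  have hint0 : 0 ≤ ∫ x in Ω, (r x * |f x|) ^ (p + 1) :=
    setIntegral_nonneg hΩo.measurableSet fun x hx =>
      Real.rpow_nonneg (mul_nonneg (hr0 x hx).le (abs_nonneg _)) _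
  have e5 : (κ ^ (p + 1)) ^ (2 / (p + 1)) = κ ^ 2 := by
    rw [← Real.rpow_mul hκ.le, mul_div_cancel₀ _ (by linarith), ← Real.rpow_natCast]
    norm_num
  have hM0 := hmnn q hs
  calc moment Ω p K u ut (q * ((p + 1) / 2)) s ^ (2 / (p + 1))
      ≤ (κ ^ (p + 1) * ∫ x in Ω, (r x * |f x|) ^ (p + 1)) ^ (2 / (p + 1)) :=
        Real.rpow_le_rpow (hmnn _ hs) t3
          (div_nonneg zero_le_two (by linarith))
    _ = κ ^ 2 * (∫ x in Ω, (r x * |f x|) ^ (p + 1)) ^ (2 / (p + 1)) := by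
        rw [Real.mul_rpow (by positivity) hint0, e5]
    _ ≤ κ ^ 2 * (S * (κ ^ 2 * (q / 2) ^ 2 * dissip Ω K u ut q s +
          κ ^ (p + 1) * moment Ω p K u ut q s)) := by
        refine mul_le_mul_of_nonneg_left (hsob'.trans ?_) (sq_nonneg _)
        gcongr
    _ = κ ^ 2 * S * (κ ^ 2 * (q / 2) ^ 2 * dissip Ω K u ut q s +
          κ ^ (p + 1) * moment Ω p K u ut q s) := by ring
    _ ≤ κ ^ 2 * S * ((κ ^ 2 * (q / 2) ^ 2 + κ ^ (p + 1)) *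
          (dissip Ω K u ut q s + moment Ω p K u ut q s)) := by
        refine mul_le_mul_of_nonneg_left ?_ (by positivity)
        have a1 : 0 ≤ κ ^ 2 * (q / 2) ^ 2 * moment Ω p K u ut q s := by positivity
        have a2 : 0 ≤ κ ^ (p + 1) * dissip Ω K u ut q s := by positivity
        linarith
    _ = _ := by ring

end MomentDerivative

section Iteration

/-- A family of time-dependent moments that satisfies a Moser type differential inequality. -/
structure MomentFamily (χ Q t1 T : ℝ) (F : Set (ℝ → ℝ → ℝ)) : Prop where
  one_lt_gain : 1 < χ
  one_lt_crit : 1 < Q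
  crit_eq : Q * (χ - 1) = χ
  cont : ∀ M ∈ F, ∀ q, ContinuousOn (M q) (Icc t1 T)
  nonneg : ∀ M ∈ F, ∀ q, ∀ s ∈ Icc t1 T, 0 ≤ M q s
  mono : ∀ M ∈ F, ∀ q q', q ≤ q' → ∀ s ∈ Icc t1 T, M q s ≤ M q' s
  deriv_le : ∀ q, 1 < q → ∃ a > 0, ∃ C, 0 ≤ C ∧ ∀ M ∈ F, ∀ s ∈ Ioo t1 T, ∃ D,
    HasDerivAt (M q) D s ∧ D ≤ -(a * M (q * χ) s ^ (1 / χ)) +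
      C * (1 + if q ≤ Q then 0 else M q s ^ (1 / (q - Q))) * M q s

/-- Bounds after an arbitrarily small time for the moment of order `q`, together with a bound for
the integral of the corresponding power of the moment of order `q * χ`. -/
def MomentBound (χ t1 T : ℝ) (F : Set (ℝ → ℝ → ℝ)) (q : ℝ) : Prop :=
  ∀ c ∈ Ioo t1 T, ∃ C, ∀ M ∈ F, (∀ s ∈ Icc c T, M q s ≤ C) ∧
    ∫ s in c..T, M (q * χ) s ^ (1 / χ) ≤ C

variable {χ Q t1 T : ℝ} {F : Set (ℝ → ℝ → ℝ)}

lemma MomentFamily.momentBound_of_integral (h : MomentFamily χ Q t1 T F) {q σ : ℝ} (hq : 1 < q)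
    (hσ : 0 < σ) (hS : ∀ c ∈ Ioo t1 T, ∃ S, ∀ M ∈ F, ∫ s in c..T, M q s ^ σ ≤ S)
    (hG : ∀ c ∈ Ioo t1 T, ∃ G, ∀ M ∈ F,
      ∫ s in c..T, (1 + if q ≤ Q then 0 else M q s ^ (1 / (q - Q))) ≤ G) :
    MomentBound χ t1 T F q := by
  intro c hc
  have hχ := h.one_lt_gain
  set a := (t1 + c) / 2 with ha
  have hat : t1 < a := by have := hc.1; linarith
  have hac : a < c := by have := hc.1; linarith
  have haT : a ∈ Ioo t1 T := ⟨hat, hac.trans hc.2⟩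
  obtain ⟨S, hS⟩ := hS a haT
  obtain ⟨G, hG⟩ := hG a haT
  obtain ⟨α, hα, C, hC, hd⟩ := h.deriv_le q hq
  set Y := (S / (c - a)) ^ (1 / σ) * exp (C * G) with hY
  refine ⟨max Y (Y * (1 + C * G) / α), fun M hM => ?_⟩
  choose! D hD hDle using hd M hM
  have hsub : Icc a T ⊆ Icc t1 T := Icc_subset_Icc_left hat.le
  have hsub' : Ioo a T ⊆ Ioo t1 T := Ioo_subset_Ioo_left hat.le
  have hcont := fun q => (h.cont M hM q).mono hsub
  have hnn := fun q s hs => h.nonneg M hM q s (hsub hs)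
  have hωc : ContinuousOn (fun s => 1 + if q ≤ Q then 0 else M q s ^ (1 / (q - Q))) (Icc a T) := by
    split_ifs with hqQ
    · exact continuousOn_const
    · push Not at hqQ
      exact continuousOn_const.add ((hcont q).rpow_const fun s _ =>
        Or.inr (one_div_nonneg.2 (by linarith)))
  have hω0 : ∀ s ∈ Icc a T, 0 ≤ 1 + if q ≤ Q then 0 else M q s ^ (1 / (q - Q)) := by
    intro s hs
    split_ifs
    · norm_num
    · have := Real.rpow_nonneg (hnn q s hs) (1 / (q - Q))
      linarith
  have hpc : ContinuousOn (fun s => M q s ^ σ) (Icc a T) :=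
    (hcont q).rpow_const fun s _ => Or.inr hσ.le
  have key := bound_of_deriv_le (y := M q) (y' := D) (z := fun s => α * M (q * χ) s ^ (1 / χ))
    (g := fun s => C * (1 + if q ≤ Q then 0 else M q s ^ (1 / (q - Q)))) (S := S) (G := C * G)
    hac hc.2.le hσ (hcont q)
    (continuousOn_const.mul ((hcont _).rpow_const fun s _ => Or.inr (by positivity)))
    (continuousOn_const.mul hωc) (hnn q)
    (fun s hs => mul_nonneg hα.le (Real.rpow_nonneg (hnn _ s hs) _))
    (fun s hs => mul_nonneg hC (hω0 s hs)) (fun s hs => hD s (hsub' hs))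
    (fun s hs => hDle s (hsub' hs))
    (le_trans (intervalIntegral.integral_mono_interval le_rfl hac.le hc.2.le
      ((ae_restrict_iff' measurableSet_Ioc).2 (Eventually.of_forall fun s hs =>
        Real.rpow_nonneg (hnn q s (Ioc_subset_Icc_self hs)) _))
      (hpc.intervalIntegrable_of_Icc haT.2.le)) (hS M hM))
    (by
      rw [intervalIntegral.integral_const_mul]
      exact mul_le_mul_of_nonneg_left (hG M hM) hC)
  refine ⟨fun s hs => (key.1 s hs).trans (le_max_left _ _), le_trans ?_ (le_max_right _ _)⟩
  rw [le_div_iff₀ hα, mul_comm]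
  have := key.2
  rwa [intervalIntegral.integral_const_mul] at this

lemma MomentFamily.momentBound_of_le_crit (h : MomentFamily χ Q t1 T F) {q σ : ℝ} (hq : 1 < q)
    (hqQ : q ≤ Q) (hσ : 0 < σ)
    (hS : ∀ c ∈ Ioo t1 T, ∃ S, ∀ M ∈ F, ∫ s in c..T, M q s ^ σ ≤ S) :
    MomentBound χ t1 T F q :=
  h.momentBound_of_integral hq hσ hS fun c _ => ⟨T - c, fun M _ => by simp [hqQ]⟩

lemma MomentFamily.momentBound_of_momentBound (h : MomentFamily χ Q t1 T F) {q q' : ℝ}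
    (hq' : 1 < q') (hqq : q' ≤ q * χ) (hqQ : q' ≤ Q) (hb : MomentBound χ t1 T F q) :
    MomentBound χ t1 T F q' := by
  have hχ := h.one_lt_gain
  have hχ0 : 0 ≤ 1 / χ := by positivity
  refine h.momentBound_of_le_crit hq' hqQ (σ := 1 / χ) (by positivity) fun c hc => ?_
  obtain ⟨C, hC⟩ := hb c hc
  refine ⟨C, fun M hM => le_trans ?_ (hC M hM).2⟩
  have hsub : Icc c T ⊆ Icc t1 T := Icc_subset_Icc_left hc.1.le
  have hcont := fun q => (((h.cont M hM q).mono hsub).rpow_const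
    fun s _ => Or.inr hχ0).intervalIntegrable_of_Icc (μ := volume) hc.2.le
  exact intervalIntegral.integral_mono_on hc.2.le (hcont q') (hcont _) fun s hs =>
    Real.rpow_le_rpow (h.nonneg M hM _ s (hsub hs)) (h.mono M hM _ _ hqq s (hsub hs)) hχ0

lemma MomentFamily.momentBound_mul (h : MomentFamily χ Q t1 T F) {q : ℝ} (hqQ : Q ≤ q)
    (hb : MomentBound χ t1 T F q) : MomentBound χ t1 T F (q * χ) := by
  have hχ := h.one_lt_gain
  have hQ := h.one_lt_crit
  have hQχ := h.crit_eq
  have hχ0 : 0 ≤ 1 / χ := by positivity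
  have hlt : Q < q * χ := by nlinarith
  have hgap : χ ≤ q * χ - Q := by nlinarith
  refine h.momentBound_of_integral (hQ.trans hlt) (σ := 1 / χ) (by positivity)
    (fun c hc => (hb c hc).imp fun C hC M hM => (hC M hM).2) fun c hc => ?_
  obtain ⟨C, hC⟩ := hb c hc
  refine ⟨2 * (T - c) + C, fun M hM => ?_⟩
  have hsub : Icc c T ⊆ Icc t1 T := Icc_subset_Icc_left hc.1.le
  have hcont := (h.cont M hM (q * χ)).mono hsub
  simp only [not_le.2 hlt, if_false]
  have hi := (hcont.rpow_const (p := 1 / χ)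
    fun s _ => Or.inr hχ0).intervalIntegrable_of_Icc (μ := volume) hc.2.le
  have he0 : 0 ≤ 1 / (q * χ - Q) := one_div_nonneg.2 (by linarith)
  have hle : ∫ s in c..T, (1 + M (q * χ) s ^ (1 / (q * χ - Q))) ≤
      ∫ s in c..T, (2 + M (q * χ) s ^ (1 / χ)) := by
    refine intervalIntegral.integral_mono_on hc.2.le
      ((continuousOn_const.add (hcont.rpow_const
        fun s _ => Or.inr he0)).intervalIntegrable_of_Icc hc.2.le)
      (intervalIntegrable_const.add hi) fun s hs => ?_
    have hM0 := h.nonneg M hM (q * χ) s (hsub hs)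
    rcases le_total (M (q * χ) s) 1 with h1 | h1
    · have := Real.rpow_le_one hM0 h1 he0
      have := Real.rpow_nonneg hM0 (1 / χ)
      linarith
    · have := Real.rpow_le_rpow_of_exponent_le h1
        (one_div_le_one_div_of_le (by linarith : 0 < χ) hgap)
      linarith
  refine hle.trans ?_
  rw [intervalIntegral.integral_add intervalIntegrable_const hi, intervalIntegral.integral_const]
  have := (hC M hM).2
  simp only [smul_eq_mul]
  linarith

/-- Moser type iteration. -/
theorem MomentFamily.exists_bound (h : MomentFamily χ Q t1 T F) {q₀ : ℝ} (hq₀ : 1 < q₀)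
    (hq₀Q : q₀ ≤ Q) (hS : ∃ S, ∀ M ∈ F, ∫ s in t1..T, M q₀ s ≤ S) (q : ℝ) {c : ℝ}
    (hc : c ∈ Ioo t1 T) : ∃ C, ∀ M ∈ F, ∀ s ∈ Icc c T, M q s ≤ C := by
  have hχ := h.one_lt_gain
  have hQ := h.one_lt_crit
  obtain ⟨S, hS⟩ := hS
  have h0 : MomentBound χ t1 T F q₀ := by
    refine h.momentBound_of_le_crit hq₀ hq₀Q one_pos fun c hc => ⟨S, fun M hM => ?_⟩
    simp only [Real.rpow_one]
    refine le_trans (intervalIntegral.integral_mono_interval hc.1.le hc.2.le le_rfl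
      ((ae_restrict_iff' measurableSet_Ioc).2 (Eventually.of_forall fun s hs =>
        h.nonneg M hM q₀ s (Ioc_subset_Icc_self hs)))
      ((h.cont M hM q₀).intervalIntegrable_of_Icc (hc.1.trans hc.2).le)) (hS M hM)
  have hk1 : ∀ k : ℕ, 1 ≤ χ ^ k := fun k => one_le_pow₀ hχ.le
  have h1 : ∀ k : ℕ, MomentBound χ t1 T F (min (q₀ * χ ^ k) Q) := by
    intro k
    induction k with
    | zero => simpa [hq₀Q] using h0
    | succ k ih =>
      refine h.momentBound_of_momentBound (lt_min ?_ hQ) ?_ (min_le_right _ _) ih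
      · nlinarith [hk1 (k + 1)]
      · rw [min_mul_of_nonneg _ _ (by linarith : 0 ≤ χ)]
        refine min_le_min (by rw [pow_succ]; linarith) ?_
        nlinarith
  obtain ⟨k, hk⟩ := pow_unbounded_of_one_lt Q hχ
  have h2 : MomentBound χ t1 T F Q := by
    have := h1 k
    rwa [min_eq_right (by nlinarith)] at this
  have h3 : ∀ k : ℕ, MomentBound χ t1 T F (Q * χ ^ k) := by
    intro k
    induction k with
    | zero => simpa using h2
    | succ k ih =>
      rw [pow_succ, ← mul_assoc]
      exact h.momentBound_mul (by nlinarith [hk1 k]) ih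
  obtain ⟨k, hk⟩ := pow_unbounded_of_one_lt q hχ
  obtain ⟨C, hC⟩ := h3 k c hc
  refine ⟨C, fun M hM s hs => le_trans (h.mono M hM _ _ ?_ s ⟨hc.1.le.trans hs.1, hs.2⟩)
    ((hC M hM).1 s hs)⟩
  nlinarith [hk1 k]

end Iteration

section Conclusion

variable {n : ℕ}

local notation "V" => EuclideanSpace ℝ (Fin n)

variable {Ω : Set (EuclideanSpace ℝ (Fin n))} {p b T K κ t1 : ℝ}
  {r : EuclideanSpace ℝ (Fin n) → ℝ}

/-- The family of moments of uniformly controlled solutions is a moment family. -/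
lemma momentFamily_of_uniformSol (hn : 1 ≤ n) (hb : Bornology.IsBounded Ω)
    (hr : ContDiff ℝ (⊤ : ℕ∞) r) (hΩ : ∀ x, x ∈ Ω ↔ 0 < r x) {c : ℝ} (hc : 0 < c)
    (hcr : ∀ x ∈ Ω, r x < c → c ≤ (∑ i, pderiv' i r x ^ 2) / 2 + r x * lap r x)
    (hp : 1 < p) (hcrit : n ≤ 2 ∨ p + 1 ≤ 2 * n / ((n : ℝ) - 2)) (hκ : 0 < κ) (ht1 : 0 ≤ t1)
    (hK : 0 ≤ K) {F : Set (ℝ → ℝ → ℝ)}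
    (hF : ∀ M ∈ F, ∃ u ut, UniformSol Ω p b T r κ K t1 u ut ∧ M = moment Ω p K u ut) :
    MomentFamily ((p + 1) / 2) ((p + 1) / (p - 1)) t1 T F := by
  have hp1 : 0 < p - 1 := by linarith
  refine ⟨by linarith, by rw [lt_div_iff₀ hp1]; linarith, by field_simp; ring, ?_, ?_, ?_, ?_⟩
  · intro M hM q
    obtain ⟨u, ut, h, rfl⟩ := hF M hM
    exact h.continuousOn_moment ht1 q
  · intro M hM q s hs
    obtain ⟨u, ut, h, rfl⟩ := hF M hM
    exact h.moment_nonneg ht1 q hs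
  · intro M hM q q' hq s hs
    obtain ⟨u, ut, h, rfl⟩ := hF M hM
    exact h.moment_mono ht1 hq hs
  intro q hq
  obtain ⟨C2, hC2, hS⟩ := exists_moment_le_dissip (b := b) (T := T) (K := K) hn hb hr hΩ hc hcr hp
    hcrit hκ ht1 q
  set a₀ := q * (q - 1) / (p * C2) with ha₀
  set β := q * (p - 1) - (p + 1) with hβ
  set C1 := q * (p - 1) * (K ^ 2 + 1) + (p + 1) * K with hC1
  have hq1 : 0 < q - 1 := by linarith
  have hA : 0 < q * (q - 1) / p := by positivity
  have ha₀' : 0 < a₀ := by positivity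
  have hC1' : 0 ≤ C1 := by positivity
  have hbase : ∀ u ut, UniformSol Ω p b T r κ K t1 u ut → ∀ s ∈ Ioo t1 T, ∃ D,
      HasDerivAt (moment Ω p K u ut q) D s ∧
      D ≤ -(a₀ * moment Ω p K u ut (q * ((p + 1) / 2)) s ^ (1 / ((p + 1) / 2))) +
        β * moment Ω p K u ut (q + 1) s + (C1 + q * (q - 1) / p) * moment Ω p K u ut q s := by
    intro u ut h s hs
    obtain ⟨D, hD, hDle⟩ := h.exists_hasDerivAt_moment ht1 hK (by linarith : 0 ≤ q) hs
    refine ⟨D, hD, hDle.trans ?_⟩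
    have h1 := hS u ut h s (Ioo_subset_Icc_self hs)
    have h2 : a₀ * moment Ω p K u ut (q * ((p + 1) / 2)) s ^ (2 / (p + 1)) ≤
        q * (q - 1) / p * (dissip Ω K u ut q s + moment Ω p K u ut q s) := by
      calc _ ≤ a₀ * (C2 * (dissip Ω K u ut q s + moment Ω p K u ut q s)) := by gcongr
        _ = _ := by rw [ha₀]; field_simp
    rw [one_div_div]
    linarith
  rcases le_or_gt q ((p + 1) / (p - 1)) with hqQ | hqQ
  · refine ⟨a₀, ha₀', C1 + q * (q - 1) / p, by positivity, fun M hM s hs => ?_⟩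
    obtain ⟨u, ut, h, rfl⟩ := hF M hM
    obtain ⟨D, hD, hDle⟩ := hbase u ut h s hs
    refine ⟨D, hD, hDle.trans ?_⟩
    have hβ0 : β ≤ 0 := by rw [le_div_iff₀ hp1] at hqQ; linarith
    have := mul_nonpos_of_nonpos_of_nonneg hβ0
      (h.moment_nonneg ht1 (q + 1) (Ioo_subset_Icc_self hs))
    rw [if_pos hqQ]
    linarith
  · have hqQ' := hqQ
    rw [div_lt_iff₀ hp1] at hqQ'
    have hβ0 : 0 ≤ β := by linarith
    set α := (p + 1) / (q * (p - 1)) with hα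
    have hα0 : 0 < α := by positivity
    have hα1 : α < 1 := by rw [hα, div_lt_one (by positivity)]; exact hqQ'
    obtain ⟨C3, hC3, hY⟩ := exists_mul_rpow_le hα0 hα1 (half_pos ha₀') hβ0
    refine ⟨a₀ / 2, half_pos ha₀', C1 + q * (q - 1) / p + C3, by positivity, fun M hM s hs => ?_⟩
    obtain ⟨u, ut, h, rfl⟩ := hF M hM
    obtain ⟨D, hD, hDle⟩ := hbase u ut h s hs
    refine ⟨D, hD, hDle.trans ?_⟩
    have hs' := Ioo_subset_Icc_self hs
    have hm := h.moment_nonneg ht1 q hs'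
    have hm' := h.moment_nonneg ht1 (q * ((p + 1) / 2)) hs'
    set X := moment Ω p K u ut q s with hX
    set Y := moment Ω p K u ut (q * ((p + 1) / 2)) s with hYd
    set θ := 2 / (q * (p - 1)) with hθ
    have hθ0 : 0 < θ := by positivity
    have hθ1 : θ < 1 := by rw [hθ, div_lt_one (by positivity)]; linarith
    have hint := h.moment_interpolate ht1 (q := q) (q' := q * ((p + 1) / 2)) hθ0 hθ1 hs'
    have e1 : (1 - θ) * q + θ * (q * ((p + 1) / 2)) = q + 1 := by
      rw [hθ]; field_simp; ring
    have hq0 : 0 < q - (p + 1) / (p - 1) := by linarith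
    have hne : q * (p - 1) - (p + 1) ≠ 0 := by linarith
    have e2 : (1 - θ) * (1 / (1 - α)) = 1 / (q - (p + 1) / (p - 1)) + 1 := by
      have : 1 - α = (q * (p - 1) - (p + 1)) / (q * (p - 1)) := by rw [hα]; field_simp
      have h' : q - (p + 1) / (p - 1) = (q * (p - 1) - (p + 1)) / (p - 1) := by field_simp
      rw [this, h', hθ]; field_simp; ring
    have e3 : (Y ^ (1 / ((p + 1) / 2))) ^ α = Y ^ θ := by
      rw [← Real.rpow_mul hm']; congr 1; rw [hα, hθ]; field_simp
    rw [e1] at hint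
    have hYY := hY (X ^ (1 - θ)) (Y ^ (1 / ((p + 1) / 2))) (by positivity) (by positivity)
    have he : 0 ≤ 1 / (q - (p + 1) / (p - 1)) := by positivity
    rw [e3, ← Real.rpow_mul hm, e2, Real.rpow_add_one' hm (by positivity)] at hYY
    rw [if_neg (not_le.2 hqQ)]
    have h3 := mul_le_mul_of_nonneg_left hint hβ0
    have h4 : 0 ≤ (C1 + q * (q - 1) / p) * (X ^ (1 / (q - (p + 1) / (p - 1))) * X) := by positivity
    have h5 : 0 ≤ C3 * X := by positivity
    nlinarith

end Conclusion

section MomentBounds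

variable {n : ℕ}

local notation "V" => EuclideanSpace ℝ (Fin n)

variable {Ω : Set (EuclideanSpace ℝ (Fin n))} {p b T B K κ t1 : ℝ}
  {u ut utt : EuclideanSpace ℝ (Fin n) → ℝ → ℝ} {r : EuclideanSpace ℝ (Fin n) → ℝ}

/-- The initial space-time bound for the moment iteration. -/
lemma UniformSol.integral_moment_le (h : UniformSol Ω p b T r κ K t1 u ut) (ht1 : 0 ≤ t1)
    (ht1T : t1 ≤ T) {q M E : ℝ} (hq : q ≤ 2)
    (hM : ∀ x ∈ Ω, ∀ s ∈ Icc 0 T, u x s ≤ M)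
    (hE : (∫ x in Ω, (‖gradient (fun y => u y 0) x‖ ^ 2 + u x 0 ^ 2)) ≤ E) :
    ∫ s in t1..T, moment Ω p K u ut q s ≤
      2 * (K ^ 2 * M ^ (p + 1) * volume.real Ω) * (T - t1) +
        2 * ((1 + |b|) / 2 * E + (|b| / 2 * M ^ 2 + M ^ (p + 1)) * volume.real Ω) := by
  have hmono := fun s hs => h.moment_mono (s := s) ht1 hq hs
  have hcont := h.continuousOn_moment ht1 q
  obtain ⟨utt, B, H, hcmp, hK⟩ := h
  have hp := H.one_lt
  have hT := H.T_pos
  have hΩo := H.isOpen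
  have hsub : ∀ {s}, s ∈ Icc t1 T → s ∈ Icc 0 T := fun hs => ⟨ht1.trans hs.1, hs.2⟩
  set N : ℝ → ℝ := fun s => ∫ x in Ω, u x s ^ (p + 1) * (ut x s / u x s) ^ 2 with hN
  have hmem : ∀ x ∈ Ω, ∀ s ∈ Icc 0 T, 0 - ut x s / u x s ∈ Icc (-B) B := by
    intro x hx s hs
    have := abs_le.1 (H.abs_v_le hx hs)
    constructor <;> linarith [this.1, this.2]
  have hsq : ∀ y : ℝ, (0 - y) ^ 2 = y ^ 2 := fun y => by ring
  have hNi : ∀ s ∈ Icc 0 T, IntegrableOn (fun x => u x s ^ (p + 1) * (ut x s / u x s) ^ 2) Ω := by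
    intro s hs
    simpa only [hsq] using H.integrableOn_moment (w := 0) hs isCompact_Icc
      (f := fun w : ℝ => w ^ (2 : ℕ)) (by fun_prop) fun x hx => hmem x hx s hs
  have hNc : ContinuousOn N (Icc 0 T) := by
    simpa only [hN, hsq] using
      H.continuousOn_moment (φ := fun _ => 0) Subset.rfl continuousOn_const
      isCompact_Icc (f := fun w : ℝ => w ^ (2 : ℕ)) (by fun_prop) fun x hx s hs => hmem x hx s hs
  have hN0 : ∀ s ∈ Icc 0 T, 0 ≤ N s := fun s hs =>
    setIntegral_nonneg hΩo.measurableSet fun x hx =>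
      mul_nonneg (Real.rpow_nonneg (H.pos x hx s hs).le _) (sq_nonneg _)
  have hfin : volume Ω ≠ ⊤ := H.bounded.measure_lt_top.ne
  have hle : ∀ s ∈ Icc t1 T, moment Ω p K u ut q s ≤
      2 * (K ^ 2 * M ^ (p + 1) * volume.real Ω) + 2 * N s := by
    intro s hs
    refine (hmono s hs).trans ?_
    have hconst : IntegrableOn (fun _ : V => 2 * (K ^ 2 * M ^ (p + 1))) Ω :=
      integrableOn_const hfin
    have e : 2 * (K ^ 2 * M ^ (p + 1) * volume.real Ω) + 2 * N s =
        ∫ x in Ω, (2 * (K ^ 2 * M ^ (p + 1)) + 2 * (u x s ^ (p + 1) * (ut x s / u x s) ^ 2)) := by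
      rw [integral_add hconst ((hNi s (hsub hs)).const_mul 2), setIntegral_const,
        integral_const_mul, smul_eq_mul]
      ring
    rw [e]
    refine setIntegral_mono_on (H.integrableOn_sub_v_rpow (hsub hs) (fun x hx => hK x hx s hs) 2)
      (hconst.add ((hNi s (hsub hs)).const_mul 2)) hΩo.measurableSet fun x hx => ?_
    have hu := H.pos x hx s (hsub hs)
    have hu1 := Real.rpow_nonneg hu.le (p + 1)
    have hu2 := Real.rpow_le_rpow hu.le (hM x hx s (hsub hs)) (by linarith : 0 ≤ p + 1)
    rw [Real.rpow_two]
    nlinarith [mul_nonneg hu1 (sq_nonneg (K + ut x s / u x s)),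
      mul_le_mul_of_nonneg_left hu2 (sq_nonneg K)]
  have hNint : IntervalIntegrable N volume t1 T :=
    (hNc.mono (Icc_subset_Icc_left ht1)).intervalIntegrable_of_Icc ht1T
  calc ∫ s in t1..T, moment Ω p K u ut q s
      ≤ ∫ s in t1..T, (2 * (K ^ 2 * M ^ (p + 1) * volume.real Ω) + 2 * N s) :=
        intervalIntegral.integral_mono_on ht1T (hcont.intervalIntegrable_of_Icc ht1T)
          (intervalIntegrable_const.add (hNint.const_mul 2)) hle
    _ = 2 * (K ^ 2 * M ^ (p + 1) * volume.real Ω) * (T - t1) + 2 * ∫ s in t1..T, N s := by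
        rw [intervalIntegral.integral_add intervalIntegrable_const (hNint.const_mul 2),
          intervalIntegral.integral_const, intervalIntegral.integral_const_mul, smul_eq_mul]
        ring
    _ ≤ _ := by
        have h1 : ∫ s in t1..T, N s ≤ ∫ s in (0 : ℝ)..T, N s := by
          refine intervalIntegral.integral_mono_interval ht1 ht1T le_rfl ?_
            (hNc.intervalIntegrable_of_Icc hT.le)
          exact (ae_restrict_iff' measurableSet_Ioc).2
            (Eventually.of_forall fun s hs => hN0 s (Ioc_subset_Icc_self hs))
        have h2 := H.integral_moment_two_le (fun x hx => hM x hx T ⟨hT.le, le_rfl⟩) hE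
        linarith

lemma RegSol.curvQ_sub_one (H : RegSol Ω p b T u ut utt r B) {x : V} (hx : x ∈ Ω) {t : ℝ}
    (ht : t ∈ Ioc 0 T) : curvQ p b u x t - 1 = -(p * (ut x t / u x t)) := by
  have hu := H.pos x hx t (Ioc_subset_Icc_self ht)
  have h := H.pde x hx t ht
  have e : -(lap (fun y => u y t) x) - b * u x t =
      u x t ^ p - p * (u x t ^ p / u x t) * ut x t := by
    rw [← Real.rpow_sub_one hu.ne']; linarith
  have hup := (Real.rpow_pos_of_pos hu p).ne'
  rw [curvQ, e, Real.rpow_neg hu.le]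
  field_simp
  ring

lemma UniformSol.integral_curvQ_le (h : UniformSol Ω p b T r κ K t1 u ut)
    (hK0 : 0 ≤ K) {q : ℝ} (hq : 0 ≤ q) {t : ℝ} (ht : t ∈ Icc t1 T) (ht0 : 0 < t) :
    (∫ x in Ω, |curvQ p b u x t - 1| ^ q * u x t ^ (p + 1)) ≤
      (p * (K + 1)) ^ q * moment Ω p K u ut q t := by
  obtain ⟨utt, B, H, hcmp, hK⟩ := h
  have hp := H.one_lt
  have htI : t ∈ Ioc 0 T := ⟨ht0, ht.2⟩
  have htI' : t ∈ Icc 0 T := Ioc_subset_Icc_self htI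
  rw [moment, ← integral_const_mul]
  refine integral_mono_of_nonneg ?_
    ((H.integrableOn_sub_v_rpow htI' (fun x hx => hK x hx t ht) q).const_mul _) ?_
  · exact (ae_restrict_iff' H.isOpen.measurableSet).2 (Eventually.of_forall fun x hx =>
      mul_nonneg (Real.rpow_nonneg (abs_nonneg _) _) (Real.rpow_nonneg (H.pos x hx t htI').le _))
  · refine (ae_restrict_iff' H.isOpen.measurableSet).2 (Eventually.of_forall fun x hx => ?_)
    have hW := hK x hx t ht
    have hu := Real.rpow_nonneg (H.pos x hx t htI').le (p + 1)
    have h1 : |curvQ p b u x t - 1| ≤ p * (K + 1) * (K - ut x t / u x t) := by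
      rw [H.curvQ_sub_one hx htI, abs_neg, abs_mul, abs_of_pos (by linarith : 0 < p), mul_assoc]
      refine mul_le_mul_of_nonneg_left (abs_le.2 ⟨?_, ?_⟩) (by linarith) <;> nlinarith
    calc |curvQ p b u x t - 1| ^ q * u x t ^ (p + 1)
        ≤ (p * (K + 1) * (K - ut x t / u x t)) ^ q * u x t ^ (p + 1) := by gcongr
      _ = (p * (K + 1)) ^ q * (u x t ^ (p + 1) * (K - ut x t / u x t) ^ q) := by
          rw [Real.mul_rpow (by positivity) (by linarith)]; ring

end MomentBounds

/-- Integral bounds for the curvature-like quantity (Proposition 4.4 of the paper):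
the moments `M_q(t) = ∫_Ω |𝓡 - 1|^q u^{p+1}` are bounded on `(T/4, T]` for every
`q > 1`.  The constant depends only on `n`, `Ω`, `T`, `p`, `b`, `c₀`, `q` and
(an upper bound `E` for) `∫_Ω (|∇u(·,0)|² + u(·,0)²)`. -/
theorem stmt11 (n : ℕ) (hn : 1 ≤ n) (Ω : Set (EuclideanSpace ℝ (Fin n)))
    (p b c₀ T E q : ℝ) (hq : 1 < q) :
    ∃ C : ℝ, 0 < C ∧
      ∀ (u ut utt : EuclideanSpace ℝ (Fin n) → ℝ → ℝ),
        FDSetting Ω p b T c₀ u ut utt →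
        (∫ x in Ω, (‖gradient (fun y => u y 0) x‖ ^ 2 + u x 0 ^ 2)) ≤ E →
        ∀ t ∈ Set.Ioc (T / 4) T,
          (∫ x in Ω, |curvQ p b u x t - 1| ^ q * u x t ^ (p + 1)) ≤ C := by
  by_cases hex : ∃ u ut utt, FDSetting Ω p b T c₀ u ut utt
  swap
  · exact ⟨1, one_pos, fun u ut utt h => absurd ⟨u, ut, utt, h⟩ hex⟩
  obtain ⟨-, -, -, hsm, hp, hcrit, hT, hc₀, -⟩ := hex
  obtain ⟨r, hr, hΩr, ⟨c, hc, hrd⟩, ⟨c', hc', hcr⟩⟩ := hsm.exists_defining hn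
  have hb := hsm.2.1
  obtain ⟨D, hD, hdB⟩ := exists_bound_of_bounded hb (f := dB Ω) (Metric.continuous_infDist_pt _)
  have hp1 : 0 < p - 1 := by linarith
  set K := 1 + 1 / p + 1 / ((p - 1) * (T / 8)) with hK
  have hK0 : 0 ≤ K := by positivity
  have ht1 : 0 ≤ T / 8 := by positivity
  have hκ : 0 < c₀ / c := by positivity
  have hcrit' : n ≤ 2 ∨ p + 1 ≤ 2 * n / ((n : ℝ) - 2) := by
    rcases le_or_gt n 2 with h2 | h2
    · exact Or.inl h2
    · right
      have h2' : (2 : ℝ) < n := by exact_mod_cast h2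
      have hn2 : (0 : ℝ) < n - 2 := by linarith
      have := hcrit.resolve_left (by omega)
      rw [le_div_iff₀ hn2] at this ⊢
      linarith
  set F : Set (ℝ → ℝ → ℝ) := {M | ∃ u ut, UniformSol Ω p b T r (c₀ / c) K (T / 8) u ut ∧
    (∀ x ∈ Ω, ∀ s ∈ Icc 0 T, u x s ≤ c₀ * D) ∧
    (∫ x in Ω, (‖gradient (fun y => u y 0) x‖ ^ 2 + u x 0 ^ 2)) ≤ E ∧
    M = moment Ω p K u ut} with hF
  have hfam : MomentFamily ((p + 1) / 2) ((p + 1) / (p - 1)) (T / 8) T F :=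
    momentFamily_of_uniformSol hn hb hr hΩr hc' hcr hp hcrit' hκ ht1 hK0
      fun M ⟨u, ut, h, _, _, hM⟩ => ⟨u, ut, h, hM⟩
  obtain ⟨C, hC⟩ := hfam.exists_bound (q₀ := min 2 ((p + 1) / (p - 1)))
    (lt_min one_lt_two hfam.one_lt_crit) (min_le_right _ _)
    ⟨_, fun M ⟨u, ut, h, hM, hE, hMeq⟩ => hMeq ▸ h.integral_moment_le ht1 (by linarith)
      (min_le_left _ _) hM hE⟩ q (c := T / 4) ⟨by linarith, by linarith⟩
  refine ⟨max 1 ((p * (K + 1)) ^ q * C), lt_max_of_lt_left one_pos,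
    fun u ut utt h hE t ht => le_max_of_le_right ?_⟩
  obtain ⟨B, H⟩ := h.exists_regSol hn hr hΩr ⟨c, hc, hrd⟩
  obtain ⟨-, -, -, -, -, -, hpos, -, -, hcmp⟩ := h
  have hU : UniformSol Ω p b T r (c₀ / c) K (T / 8) u ut := by
    refine ⟨utt, B, H, fun x hx s hs => ?_, fun x hx s hs => ?_⟩
    · obtain ⟨h1, h2⟩ := hcmp x hx s hs
      obtain ⟨h3, h4⟩ := hrd x hx
      rw [inv_mul_le_iff₀ (by linarith)] at h1
      rw [div_mul_eq_mul_div, div_mul_eq_mul_div, le_div_iff₀ hc, le_div_iff₀ hc]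
      constructor
      · linarith
      · nlinarith
    · have hs0 : 0 < s := by linarith [hs.1]
      have h1 := H.v_le hx ⟨hs0, hs.2⟩
      have h2 : 1 / ((p - 1) * s) ≤ 1 / ((p - 1) * (T / 8)) := by
        gcongr
        exact hs.1
      linarith
  have hbd : ∀ x ∈ Ω, ∀ s ∈ Icc 0 T, u x s ≤ c₀ * D := fun x hx s hs =>
    (hcmp x hx s hs).2.trans (mul_le_mul_of_nonneg_left
      ((le_abs_self _).trans (hdB x (subset_closure hx))) (by linarith))
  refine (hU.integral_curvQ_le hK0 (by linarith) ⟨by linarith [ht.1], ht.2⟩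
    (by linarith [ht.1])).trans ?_
  exact mul_le_mul_of_nonneg_left (hC _ ⟨u, ut, hU, hbd, hE, rfl⟩ t ⟨ht.1.le, ht.2⟩)
    (by positivity)
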